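/- arXiv:2402.16076 — 4 statements merged into one kernel-verified Lean document; each statement's English description precedes it below -/
import Mathlib

section
/- Let P be a Peano continuum in ℝ² (a locally connected, connected, compact metric subspace) and V a connected component of ℝ² \ P. For any w ∈ V and z ∈ ∂V, there exists an arc L with endpoint set {w, z} such that L \ {z} ⊆ V. -/
open Set Filter Topology Metric

namespace Acc

lemma exp_const {D : Set ℂ} (hD : IsPreconnected D) {φ : ℂ → ℂ} (hc : ContinuousOn φ D)
    (he : ∀ u ∈ D, Complex.exp (φ u) = 1) {s t : ℂ} (hs : s ∈ D) (ht : t ∈ D) : φ s = φ t := by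
  have hpi : (2 * Real.pi * Complex.I : ℂ) ≠ 0 := Complex.two_pi_I_ne_zero
  have hint : ∀ u ∈ D, ∃ n : ℤ, φ u = n * (2 * Real.pi * Complex.I) := fun u hu =>
    Complex.exp_eq_one_iff.1 (he u hu)
  have hd : IsDiscrete (Set.range ((↑) : ℤ → ℝ)) :=
    ⟨(Int.isClosedEmbedding_coe_real.isEmbedding.toHomeomorph).symm.isEmbedding.discreteTopology⟩
  have key := hD.constant_of_mapsTo (T := Set.range ((↑) : ℤ → ℝ))
    hd (f := fun u => (φ u / (2 * Real.pi * Complex.I)).re)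
    (Complex.continuous_re.comp_continuousOn (hc.div_const _)) (by
      intro u hu
      obtain ⟨n, hn⟩ := hint u hu
      refine ⟨n, ?_⟩
      simp only [hn]
      rw [mul_div_cancel_right₀ _ hpi]; simp) hs ht
  obtain ⟨n, hn⟩ := hint s hs
  obtain ⟨m, hm⟩ := hint t ht
  simp only [hn, hm] at key
  rw [mul_div_cancel_right₀ _ hpi, mul_div_cancel_right₀ _ hpi] at key
  simp at key
  rw [hn, hm, key]

lemma no_log (h : ℂ → ℂ) (hc : Continuous h) (h0 : ∀ u, h u ≠ 0) (x : ℂ) (c : ℤ) (R : ℝ)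
    (hR : 0 < R) (hh : ∀ u, dist u x = R → h u = (u - x) ^ c) : c = 0 := by
  obtain ⟨g, hgc, hg⟩ : ∃ g : ℂ → ℂ, Continuous g ∧ ∀ u, Complex.exp (g u) = h u := by
    obtain ⟨F, ⟨-, hF⟩, -⟩ := Complex.isCoveringMapOn_exp.existsUnique_continuousMap_lifts
      (⟨h, hc⟩ : C(ℂ, ℂ)) (a₀ := 0) (Complex.exp_log (h0 0)) (fun a => h0 a)
    exact ⟨F, F.continuous, fun u => congrFun hF u⟩
  have hRc : (R : ℂ) ≠ 0 := by exact_mod_cast hR.ne'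
  let ψ : ℂ → ℂ := fun t => g (x + R * Complex.exp ((t.re : ℂ) * Complex.I)) - c * (t.re * Complex.I)
      - c * Real.log R
  have hψ : Continuous ψ := by fun_prop
  have h1 : ∀ u ∈ (univ : Set ℂ), Complex.exp (ψ u) = 1 := by
    intro u _
    simp only [ψ]
    rw [Complex.exp_sub, Complex.exp_sub, hg, hh, Complex.exp_int_mul, Complex.exp_int_mul,
      ← Complex.ofReal_exp, Real.exp_log hR, add_sub_cancel_left, mul_zpow]
    · have := Complex.exp_ne_zero ((u.re : ℂ) * Complex.I)
      field_simp
    · rw [dist_eq_norm]; simp [Complex.norm_exp_ofReal_mul_I, hR.le]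
  have := exp_const isPreconnected_univ hψ.continuousOn h1 (mem_univ 0) (mem_univ ((2 * Real.pi : ℝ) : ℂ))
  simp only [ψ, Complex.ofReal_re, Complex.zero_re] at this
  have e1 : Complex.exp (((2 * Real.pi : ℝ) : ℂ) * Complex.I) = 1 := by
    push_cast; exact Complex.exp_two_pi_mul_I
  rw [e1] at this
  simp only [Complex.ofReal_zero, zero_mul, Complex.exp_zero, mul_zero, sub_zero] at this
  have h2 : (c : ℂ) * (((2 * Real.pi : ℝ) : ℂ) * Complex.I) = 0 := by linear_combination this
  have h3 := Real.pi_pos.ne'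
  simpa [h3] using h2

lemma borsuk (U : Set ℂ) (hUo : IsOpen U) (hUb : Bornology.IsBounded U) (x : ℂ) (hx : x ∈ U)
    (c : ℤ) (k L : ℂ → ℂ) (hk : ContinuousOn k (closure U)) (hk0 : ∀ u ∈ closure U, k u ≠ 0)
    (hL : ContinuousOn L (closure U \ U))
    (he : ∀ u ∈ closure U \ U, Complex.exp (L u) = (u - x) ^ c * k u) : c = 0 := by
  classical
  have hF : IsClosed (closure U \ U) := isClosed_closure.sdiff hUo
  obtain ⟨L', hL'⟩ := ContinuousMap.exists_restrict_eq hF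
    ⟨_, continuousOn_iff_continuous_domRestrict.1 hL⟩
  have hL'' : ∀ u ∈ closure U \ U, L' u = L u := fun u hu => by
    have := congrArg (fun f => f ⟨u, hu⟩) hL'
    simpa using this
  let h : ℂ → ℂ := fun u => if u ∈ U then Complex.exp (L' u) / k u else (u - x) ^ c
  have hcl : ∀ u ∈ closure U, h u = Complex.exp (L' u) / k u := by
    intro u hu
    by_cases hU : u ∈ U
    · simp [h, hU]
    · simp only [h, hU, if_false]
      rw [hL'' u ⟨hu, hU⟩, he u ⟨hu, hU⟩, mul_div_cancel_right₀ _ (hk0 u hu)]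
  have hc1 : ContinuousOn h (closure U) :=
    ContinuousOn.congr ((Complex.continuous_exp.comp L'.continuous).continuousOn.div hk hk0) hcl
  have hc2 : ContinuousOn h Uᶜ := by
    have : ContinuousOn (fun u : ℂ => (u - x) ^ c) Uᶜ := by
      apply ContinuousOn.zpow₀ (by fun_prop)
      intro u hu
      left
      rw [sub_ne_zero]
      rintro rfl
      exact hu hx
    exact this.congr (fun u hu => by simp only [h]; rw [if_neg hu])
  have hc : Continuous h := by
    rw [← continuousOn_univ]
    have := hc1.union_of_isClosed hc2 isClosed_closure hUo.isClosed_compl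
    refine this.mono ?_
    intro u _
    by_cases hU : u ∈ U
    · exact Or.inl (subset_closure hU)
    · exact Or.inr hU
  have h0 : ∀ u, h u ≠ 0 := by
    intro u
    by_cases hU : u ∈ U
    · rw [hcl u (subset_closure hU)]
      exact div_ne_zero (Complex.exp_ne_zero _) (hk0 u (subset_closure hU))
    · simp only [h, hU, if_false]
      apply zpow_ne_zero
      rw [sub_ne_zero]
      rintro rfl
      exact hU hx
  obtain ⟨R, hR⟩ := hUb.subset_ball x
  have hRpos : 0 < R := by simpa using hR hx
  apply no_log h hc h0 x c R hRpos
  intro u hu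
  have : u ∉ U := fun hU => by
    have := hR hU
    rw [mem_ball] at this
    linarith
  simp [h, this]

lemma exists_log (A : Set ℂ) (hA : IsClosed A) (W : Set ℂ) (hW : IsPreconnected W)
    (hWA : Disjoint W A) {x y : ℂ} (hx : x ∈ W) (hy : y ∈ W) :
    ∃ g : ℂ → ℂ, ContinuousOn g A ∧ ∀ u ∈ A, Complex.exp (g u) = (u - x) / (u - y) := by
  have ne : ∀ w ∈ W, ∀ u ∈ A, u - w ≠ 0 := fun w hw u hu h =>
    Set.disjoint_left.1 hWA hw (by rwa [← sub_eq_zero.1 h])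
  refine hW.induction₂ (fun x y => ∃ g : ℂ → ℂ, ContinuousOn g A ∧
    ∀ u ∈ A, Complex.exp (g u) = (u - x) / (u - y)) ?_ ?_ ?_ hx hy
  · intro x hx
    have hxA : x ∉ A := Set.disjoint_left.1 hWA hx
    obtain ⟨r, hr, hb⟩ := Metric.isOpen_iff.1 hA.isOpen_compl x hxA
    have : ball x (r/2) ∈ 𝓝[W] x := mem_nhdsWithin_of_mem_nhds (ball_mem_nhds x (by positivity))
    filter_upwards [this, self_mem_nhdsWithin] with y hy hyW
    have hn : ∀ u ∈ A, r ≤ dist u x := fun u hu => by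
      by_contra! h
      exact hb h hu
    have hs : ∀ u ∈ A, (u - x) / (u - y) ∈ Complex.slitPlane := by
      intro u hu
      suffices h : ‖(u - x) / (u - y) - 1‖ < 1 by
        simpa using Complex.mem_slitPlane_of_norm_lt_one h
      have h1 := ne y hyW u hu
      have : (u - x) / (u - y) - 1 = (y - x) / (u - y) := by field_simp; ring
      rw [this, norm_div, div_lt_one (norm_pos_iff.2 h1), ← dist_eq_norm, ← dist_eq_norm]
      have := hn u hu
      have := dist_triangle u y x
      rw [mem_ball] at hy
      linarith
    refine ⟨fun u => Complex.log ((u - x) / (u - y)), ?_, ?_⟩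
    · apply ContinuousOn.clog _ hs
      exact ContinuousOn.div (by fun_prop) (by fun_prop) (ne y hyW)
    · intro u hu
      exact Complex.exp_log (div_ne_zero (ne x hx u hu) (ne y hyW u hu))
  · rintro x y z hx hy hz ⟨g, hg, hge⟩ ⟨g', hg', hge'⟩
    refine ⟨fun u => g u + g' u, hg.add hg', fun u hu => ?_⟩
    have := ne y hy u hu
    rw [Complex.exp_add, hge u hu, hge' u hu]
    field_simp
  · rintro x y hx hy ⟨g, hg, hge⟩
    refine ⟨fun u => - g u, hg.neg, fun u hu => ?_⟩
    rw [Complex.exp_neg, hge u hu, inv_div]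

lemma cover (P : Set ℂ) [LocallyConnectedSpace P] (O S : Set ℂ) (hO : IsOpen O)
    (hS : IsCompact S) (hSP : S ⊆ P) (hSO : S ⊆ O) :
    ∃ T : Finset ℂ, ∀ s ∈ S, ∃ t ∈ T, ∃ D ⊆ P ∩ O, IsPreconnected D ∧ s ∈ D ∧ t ∈ D := by
  have hSp : IsCompact ((↑) ⁻¹' S : Set P) := by
    rw [Topology.IsEmbedding.subtypeVal.isCompact_iff]
    rwa [Subtype.image_preimage_coe, inter_eq_right.2 hSP]
  have hOp : IsOpen ((↑) ⁻¹' O : Set P) := hO.preimage continuous_subtype_val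
  obtain ⟨T, hT, hT'⟩ := hSp.elim_nhds_subcover
    (fun s => connectedComponentIn ((↑) ⁻¹' O : Set P) s) (fun s hs =>
      connectedComponentIn_mem_nhds (hOp.mem_nhds (hSO hs)))
  classical
  refine ⟨T.image (↑), fun s hs => ?_⟩
  have : (⟨s, hSP hs⟩ : P) ∈ ((↑) ⁻¹' S : Set P) := hs
  have := hT' this
  simp only [mem_iUnion] at this
  obtain ⟨t, htT, ht⟩ := this
  refine ⟨t, Finset.mem_image_of_mem _ htT, (↑) '' connectedComponentIn ((↑) ⁻¹' O : Set P) t,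
    ?_, ?_, ?_, ?_⟩
  · rintro _ ⟨u, hu, rfl⟩
    exact ⟨u.2, (connectedComponentIn_subset ((↑) ⁻¹' O : Set P) t) hu⟩
  · exact isPreconnected_connectedComponentIn.image _ continuous_subtype_val.continuousOn
  · exact ⟨_, ht, rfl⟩
  · exact ⟨t, mem_connectedComponentIn (hSO (hT t htT)), rfl⟩

end Acc

namespace Acc

lemma comp_frontier {X : Type*} [TopologicalSpace X] [LocallyConnectedSpace X]
    {F : Set X} (hF : IsOpen F) (x : X) :
    closure (connectedComponentIn F x) \ connectedComponentIn F x ⊆ Fᶜ := by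
  rintro q ⟨hq, hq'⟩ hqF
  have ho : IsOpen (connectedComponentIn F q) := hF.connectedComponentIn
  obtain ⟨y, hy1, hy2⟩ := mem_closure_iff.1 hq _ ho (mem_connectedComponentIn hqF)
  rw [connectedComponentIn_eq hy2, ← connectedComponentIn_eq hy1] at hq'
  exact hq' (mem_connectedComponentIn hqF)

lemma finite_comps (P V : Set ℂ) (hPc : IsCompact P) [LocallyConnectedSpace P]
    (hVo : IsOpen V) (hVc : IsPreconnected V) (hVP : Disjoint V P) (hfr : closure V \ V ⊆ P)
    (z : ℂ) (δ ε : ℝ) (hδ : 0 < δ) (hδε : δ < ε) :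
    ((fun x => connectedComponentIn (V ∩ ball z ε) x) '' (V ∩ ball z δ)).Finite := by
  classical
  by_contra hinf
  have hinf : ((fun x => connectedComponentIn (V ∩ ball z ε) x) '' (V ∩ ball z δ)).Infinite := hinf
  set F := V ∩ ball z ε with hFdef
  have hFo : IsOpen F := hVo.inter isOpen_ball
  -- a sequence of points in distinct components
  obtain ⟨x, hxm, hxd⟩ : ∃ x : ℕ → ℂ, (∀ i, x i ∈ V ∩ ball z δ) ∧
      ∀ i j, i ≠ j → connectedComponentIn F (x i) ≠ connectedComponentIn F (x j) := by
    let e := hinf.natEmbedding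
    have : ∀ i, ∃ y ∈ V ∩ ball z δ, connectedComponentIn F y = (e i : Set ℂ) := fun i => (e i).2
    choose x hx hx' using this
    refine ⟨x, hx, fun i j hij h => hij (e.injective (Subtype.ext ?_))⟩
    rw [← hx', ← hx', h]
  have hxF : ∀ i, x i ∈ F := fun i => ⟨(hxm i).1, ball_subset_ball hδε.le (hxm i).2⟩
  obtain ⟨ρ, hρ1, hρ2⟩ := exists_between hδε
  let O : Set ℂ := {u | δ < dist u z ∧ dist u z < ε}
  have hO : IsOpen O := (isOpen_lt continuous_const (continuous_id.dist continuous_const)).inter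
    (isOpen_lt (continuous_id.dist continuous_const) continuous_const)
  obtain ⟨T, hT⟩ := cover P O (P ∩ sphere z ρ) hO (hPc.inter_right isClosed_sphere)
    inter_subset_left (by
      rintro u ⟨-, hu⟩
      rw [mem_sphere] at hu
      exact ⟨by rw [hu]; exact hρ1, by rw [hu]; exact hρ2⟩)
  set b := x 0 with hb
  have hg : ∀ j : ℕ, ∃ g : ℂ → ℂ, ContinuousOn g (ball z δ)ᶜ ∧
      ∀ u ∈ (ball z δ)ᶜ, Complex.exp (g u) = (u - x j) / (u - b) := fun j =>
    exists_log _ isOpen_ball.isClosed_compl (ball z δ) (convex_ball z δ).isPreconnected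
      disjoint_compl_right (hxm j).2 (hxm 0).2
  have hh : ∀ j : ℕ, ∃ h : ℂ → ℂ, ContinuousOn h P ∧
      ∀ u ∈ P, Complex.exp (h u) = (u - x j) / (u - b) := fun j =>
    exists_log _ hPc.isClosed V hVc hVP (hxm j).1 (hxm 0).1
  choose g hgc hge using hg
  choose h hhc hhe using hh
  have hPO : P ∩ O ⊆ (ball z δ)ᶜ := by
    rintro u ⟨-, hu1, -⟩ hu2
    rw [mem_ball] at hu2
    linarith
  have hexp : ∀ j, ∀ u ∈ P ∩ O, Complex.exp (g j u - h j u) = 1 := by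
    intro j u hu
    rw [Complex.exp_sub, hge j u (hPO hu), hhe j u hu.1, ← hhe j u hu.1,
      div_self (Complex.exp_ne_zero _)]
  have hn : ∀ j u, ∃ n : ℤ, u ∈ P ∩ O → g j u - h j u = n * (2 * Real.pi * Complex.I) := by
    intro j u
    by_cases hu : u ∈ P ∩ O
    · obtain ⟨n, hn⟩ := Complex.exp_eq_one_iff.1 (hexp j u hu)
      exact ⟨n, fun _ => hn⟩
    · exact ⟨0, fun h => absurd h hu⟩
  choose n hn using hn
  let v : Fin (T.card + 1) → (T → ℤ) := fun j t => n (j + 1) t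
  have hdep : ¬ LinearIndependent ℤ v := by
    intro hli
    have := hli.fintype_card_le_finrank
    simp at this
  obtain ⟨c, hc, j, hcj⟩ := Fintype.not_linearIndependent_iff.1 hdep
  have hcT : ∀ t ∈ T, ∑ i, c i * n (i + 1) t = 0 := by
    intro t ht
    have := congrFun hc ⟨t, ht⟩
    simpa [v] using this
  have hag : ∀ s ∈ P ∩ sphere z ρ,
      ∑ i : Fin (T.card + 1), (c i : ℂ) * g (i + 1) s = ∑ i : Fin (T.card + 1), (c i : ℂ) * h (i + 1) s := by
    intro s hs
    obtain ⟨t, htT, D, hD, hDc, hsD, htD⟩ := hT s hs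
    rw [← sub_eq_zero, ← Finset.sum_sub_distrib]
    have : ∀ i : Fin (T.card + 1), (c i : ℂ) * g (i + 1) s - c i * h (i + 1) s =
        ((c i * n (i + 1) t : ℤ) : ℂ) * (2 * Real.pi * Complex.I) := by
      intro i
      have := exp_const hDc (φ := fun u => g (i + 1) u - h (i + 1) u)
        (((hgc _).mono (hD.trans hPO)).sub ((hhc _).mono (hD.trans inter_subset_left)))
        (fun u hu => hexp _ u (hD hu)) hsD htD
      rw [hn _ t (hD htD)] at this
      push_cast
      rw [← mul_sub, this]; ring
    rw [Finset.sum_congr rfl (fun i _ => this i), ← Finset.sum_mul, ← Int.cast_sum, hcT t htT]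
    simp
  let G : ℂ → ℂ := fun u => ∑ i : Fin (T.card + 1), (c i : ℂ) * g (i + 1) u
  let H : ℂ → ℂ := fun u => ∑ i : Fin (T.card + 1), (c i : ℂ) * h (i + 1) u
  let L : ℂ → ℂ := fun u => if dist u z < ρ then H u else G u
  have hball : (ball z ρ)ᶜ ⊆ (ball z δ)ᶜ := compl_subset_compl.2 (ball_subset_ball hρ1.le)
  have hGc : ContinuousOn G (ball z ρ)ᶜ :=
    continuousOn_finsetSum _ fun i _ => continuousOn_const.mul ((hgc _).mono hball)
  have hHc : ContinuousOn H P :=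
    continuousOn_finsetSum _ fun i _ => continuousOn_const.mul (hhc _)
  have hL1 : ContinuousOn L (P ∩ closedBall z ρ) := by
    refine (hHc.mono inter_subset_left).congr ?_
    rintro u ⟨hu, hu'⟩
    simp only [L]
    split_ifs with hlt
    · rfl
    · exact hag u ⟨hu, le_antisymm hu' (not_lt.1 hlt)⟩
  have hL2 : ContinuousOn L (ball z ρ)ᶜ := by
    refine hGc.congr ?_
    intro u hu
    simp only [L]
    exact if_neg hu
  have hLc : ContinuousOn L ((P ∩ closedBall z ρ) ∪ (ball z ρ)ᶜ) :=
    hL1.union_of_isClosed hL2 (hPc.isClosed.inter isClosed_closedBall) isOpen_ball.isClosed_compl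
  have hLe : ∀ u ∈ (P ∩ closedBall z ρ) ∪ (ball z ρ)ᶜ,
      Complex.exp (L u) = ∏ i : Fin (T.card + 1), ((u - x (i + 1)) / (u - b)) ^ c i := by
    intro u hu
    simp only [L]
    split_ifs with hlt
    · have huP : u ∈ P := by
        rcases hu with hu | hu
        · exact hu.1
        · exact absurd hlt hu
      simp only [H]
      rw [Complex.exp_sum]
      exact Finset.prod_congr rfl fun i _ => by rw [Complex.exp_int_mul, hhe _ u huP]
    · simp only [G]
      rw [Complex.exp_sum]
      exact Finset.prod_congr rfl fun i _ => by rw [Complex.exp_int_mul, hge _ u (hball hlt)]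
  -- apply the Borsuk lemma to the component of `x (j+1)`
  set U := connectedComponentIn F (x (j + 1)) with hU
  have hUF : U ⊆ F := connectedComponentIn_subset _ _
  have hfrU : closure U \ U ⊆ (P ∩ closedBall z ρ) ∪ (ball z ρ)ᶜ := by
    intro q hq
    have hqF : q ∉ F := comp_frontier hFo _ hq
    by_cases hqb : q ∈ ball z ρ
    · left
      refine ⟨?_, ball_subset_closedBall hqb⟩
      apply hfr
      refine ⟨closure_mono (hUF.trans inter_subset_left) hq.1, fun hqV => hqF ⟨hqV, ?_⟩⟩
      exact ball_subset_ball hρ2.le hqb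
    · exact Or.inr hqb
  have hnot : ∀ i, i ≠ (j : ℕ) + 1 → x i ∉ closure U := by
    intro i hi hmem
    by_cases hiU : x i ∈ U
    · exact hxd _ _ hi.symm (connectedComponentIn_eq hiU)
    · exact comp_frontier hFo _ ⟨hmem, hiU⟩ (hxF i)
  have hne : ∀ i, i ≠ (j : ℕ) + 1 → ∀ u ∈ closure U, u - x i ≠ 0 := by
    intro i hi u hu h0
    rw [sub_eq_zero] at h0
    exact hnot i hi (h0 ▸ hu)
  have hneb : ∀ u ∈ closure U, u - b ≠ 0 := hne 0 (by omega)
  let k : ℂ → ℂ := fun u => ((u - b) ^ c j)⁻¹ *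
    ∏ i ∈ Finset.univ.erase j, ((u - x (i + 1)) / (u - b)) ^ c i
  have hij : ∀ i ∈ Finset.univ.erase j, (i : ℕ) + 1 ≠ (j : ℕ) + 1 := by
    intro i hi h0
    exact (Finset.mem_erase.1 hi).1 (Fin.ext (by omega))
  apply hcj
  refine borsuk U hFo.connectedComponentIn
    ((isBounded_ball (x := z) (r := ε)).subset (hUF.trans inter_subset_right)) (x (j + 1))
    (mem_connectedComponentIn (hxF _)) (c j) k L ?_ ?_ (hLc.mono hfrU) ?_
  · apply ContinuousOn.mul
    · apply ContinuousOn.inv₀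
      · exact ContinuousOn.zpow₀ (by fun_prop) _ fun u hu => Or.inl (hneb u hu)
      · exact fun u hu => zpow_ne_zero _ (hneb u hu)
    · apply continuousOn_finsetProd
      intro i hi
      apply ContinuousOn.zpow₀
      · exact ContinuousOn.div (by fun_prop) (by fun_prop) hneb
      · exact fun u hu => Or.inl (div_ne_zero (hne _ (hij i hi) u hu) (hneb u hu))
  · intro u hu
    refine mul_ne_zero (inv_ne_zero (zpow_ne_zero _ (hneb u hu))) ?_
    rw [Finset.prod_ne_zero_iff]
    intro i hi
    exact zpow_ne_zero _ (div_ne_zero (hne _ (hij i hi) u hu) (hneb u hu))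
  · intro u hu
    rw [hLe u (hfrU hu), ← Finset.mul_prod_erase _ _ (Finset.mem_univ j), div_zpow]
    simp only [k]
    ring

lemma exists_comp (P V : Set ℂ) (hPc : IsCompact P) [LocallyConnectedSpace P]
    (hVo : IsOpen V) (hVc : IsPreconnected V) (hVP : Disjoint V P) (hfr : closure V \ V ⊆ P)
    (z : ℂ) (ε : ℝ) (hε : 0 < ε) (S : Set ℂ) (hSV : S ⊆ V) (hz : z ∈ closure S) :
    ∃ x ∈ S, x ∈ ball z ε ∧ z ∈ closure (connectedComponentIn (V ∩ ball z ε) x) := by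
  have hfin := finite_comps P V hPc hVo hVc hVP hfr z (ε / 2) ε (by linarith) (by linarith)
  have hfin' : ((fun x => connectedComponentIn (V ∩ ball z ε) x) '' (S ∩ ball z (ε / 2))).Finite :=
    hfin.subset (image_mono (inter_subset_inter_left _ hSV))
  have hz' : z ∈ closure (S ∩ ball z (ε / 2)) := by
    rw [mem_closure_iff_nhds] at hz ⊢
    intro t ht
    obtain ⟨y, hy, hyS⟩ := hz (t ∩ ball z (ε / 2)) (inter_mem ht (ball_mem_nhds _ (by linarith)))
    exact ⟨y, hy.1, hyS, hy.2⟩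
  have hsub : S ∩ ball z (ε / 2) ⊆
      ⋃₀ ((fun x => connectedComponentIn (V ∩ ball z ε) x) '' (S ∩ ball z (ε / 2))) := by
    intro y hy
    exact ⟨_, ⟨y, hy, rfl⟩, mem_connectedComponentIn
      ⟨hSV hy.1, ball_subset_ball (by linarith) hy.2⟩⟩
  have := closure_mono hsub hz'
  rw [hfin'.closure_sUnion] at this
  simp only [mem_iUnion] at this
  obtain ⟨C, ⟨y, hy, rfl⟩, hzC⟩ := this
  exact ⟨y, hy.1, ball_subset_ball (by linarith) hy.2, hzC⟩

end Acc

namespace Acc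

lemma inf_concat (V : Set ℂ) (z : ℂ) (p : ℕ → ℂ)
    (hp : ∀ n : ℕ, JoinedIn (V ∩ ball z (1 / ((n : ℝ) + 1))) (p n) (p (n + 1))) :
    JoinedIn (insert z V) (p 0) z := by
  choose σ hσ using hp
  let FN : ℕ → ℝ → ℂ := fun N t => p 0 + ∑ n ∈ Finset.range N, ((σ n).extend (t - n) - p n)
  have hFNc : ∀ N, Continuous (FN N) := fun N => by
    refine continuous_const.add (continuous_finsetSum _ fun n _ => ?_)
    exact ((σ n).continuous_extend.comp (by fun_prop)).sub continuous_const
  have hsucc : ∀ N t, FN (N + 1) t = FN N t + ((σ N).extend (t - N) - p N) := fun N t => by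
    simp only [FN]
    rw [Finset.sum_range_succ, add_assoc]
  have hstab : ∀ N M : ℕ, N ≤ M → ∀ t : ℝ, t ≤ N → FN M t = FN N t := by
    intro N M hNM t ht
    induction M, hNM using Nat.le_induction with
    | base => rfl
    | succ M hM ih =>
      rw [hsucc, ih, Path.extend_of_le_zero, sub_self, add_zero]
      have : (N : ℝ) ≤ M := by exact_mod_cast hM
      linarith
  have htel : ∀ N : ℕ, ∀ t : ℝ, (N : ℝ) ≤ t → FN N t = p N := by
    intro N
    induction N with
    | zero => intro t _; simp [FN]
    | succ N ih =>
      intro t ht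
      push_cast at ht
      rw [hsucc, ih t (by linarith), Path.extend_of_one_le _ (by linarith)]
      ring
  let F : ℝ → ℂ := fun t => FN (⌊t⌋₊ + 1) t
  have hFM : ∀ M : ℕ, ∀ t : ℝ, t < M → 0 ≤ t → F t = FN M t := by
    intro M t ht h0
    refine (hstab (⌊t⌋₊ + 1) M ?_ t ?_).symm
    · exact Nat.succ_le_of_lt ((Nat.floor_lt h0).2 ht)
    · push_cast; exact (Nat.lt_floor_add_one t).le
  have hFmem : ∀ t : ℝ, 0 ≤ t → F t ∈ V ∩ ball z (1 / ((⌊t⌋₊ : ℝ) + 1)) := by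
    intro t h0
    have h1 := Nat.floor_le h0
    have h2 := Nat.lt_floor_add_one t
    have : F t = (σ ⌊t⌋₊).extend (t - ⌊t⌋₊) := by
      simp only [F]
      rw [hsucc, htel _ _ h1]; ring
    rw [this, Path.extend_apply _ ⟨by linarith, by linarith⟩]
    exact hσ _ _
  have hFc : ContinuousOn F (Ici 0) := by
    intro t ht
    obtain ⟨M, hM⟩ := exists_nat_gt t
    have : F =ᶠ[𝓝[Ici 0] t] FN M := by
      filter_upwards [self_mem_nhdsWithin, mem_nhdsWithin_of_mem_nhds (Iio_mem_nhds hM)] with s hs hs'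
      exact hFM M s hs' hs
    exact ((hFNc M).continuousAt.continuousWithinAt).congr_of_eventuallyEq this (hFM M t hM ht)
  let f : ℝ → ℂ := fun t => if t < 1 then F (t / (1 - t)) else z
  have hnn : ∀ t : ℝ, 0 ≤ t → t < 1 → 0 ≤ t / (1 - t) := fun t h0 h1 =>
    div_nonneg h0 (by linarith)
  refine JoinedIn.ofLine (f := f) ?_ ?_ ?_ ?_
  · intro t ht
    rcases lt_or_eq_of_le ht.2 with h1 | h1
    · have : ContinuousWithinAt (fun t => F (t / (1 - t))) (Icc 0 1 ∩ Iio 1) t := by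
        refine ContinuousWithinAt.comp (g := F) (f := fun t : ℝ => t / (1 - t)) (t := Ici (0 : ℝ))
          (hFc _ (hnn t ht.1 h1)) ?_ ?_
        · have h2 : 1 - t ≠ 0 := by linarith
          exact (ContinuousAt.div (by fun_prop) (by fun_prop) h2).continuousWithinAt
        · intro s hs
          exact hnn s hs.1.1 hs.2
      rw [continuousWithinAt_inter (Iio_mem_nhds h1)] at this
      refine this.congr_of_eventuallyEq ?_ (by simp [f, h1])
      filter_upwards [mem_nhdsWithin_of_mem_nhds (Iio_mem_nhds h1)] with s hs
      have hs' : s < 1 := hs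
      simp [f, hs']
    · subst h1
      rw [ContinuousWithinAt, Metric.tendsto_nhds]
      intro ε hε
      obtain ⟨N, hN⟩ := exists_nat_one_div_lt hε
      have hpos : (0 : ℝ) < 1 / ((N : ℝ) + 1) := by positivity
      filter_upwards [self_mem_nhdsWithin,
        mem_nhdsWithin_of_mem_nhds (Ioi_mem_nhds (show 1 - 1 / ((N : ℝ) + 1) < 1 by linarith))]
        with s hs hs'
      have hs'' : 1 - 1 / ((N : ℝ) + 1) < s := hs'
      by_cases hs1 : s < 1
      · simp only [f, hs1, if_true, lt_irrefl, if_false]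
        have hb := (hFmem _ (hnn s hs.1 hs1)).2
        rw [mem_ball] at hb
        refine hb.trans_le (le_trans ?_ hN.le)
        have : (N : ℝ) ≤ s / (1 - s) := by
          rw [le_div_iff₀ (by linarith)]
          have h3 : (1 - s) * ((N : ℝ) + 1) < 1 := by
            rw [← lt_div_iff₀ (by positivity)]; linarith
          nlinarith
        have : N ≤ ⌊s / (1 - s)⌋₊ := Nat.le_floor this
        have : (N : ℝ) ≤ ⌊s / (1 - s)⌋₊ := by exact_mod_cast this
        gcongr
      · simp [f, hs1, hε]
  · have : F 0 = p 0 := by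
      rw [hFM 1 0 (by norm_num) le_rfl, hstab 0 1 (by norm_num) 0 (by norm_num), htel 0 0 (by norm_num)]
    simp [f, this]
  · simp [f]
  · rintro _ ⟨t, ht, rfl⟩
    by_cases h1 : t < 1
    · simp only [f, h1, if_true]
      exact Or.inr (hFmem _ (hnn t ht.1 h1)).1
    · simp [f, h1]

lemma joined (P V : Set ℂ) (hPc : IsCompact P) [LocallyConnectedSpace P]
    (hVo : IsOpen V) (hVc : IsPreconnected V) (hVP : Disjoint V P) (hfr : closure V \ V ⊆ P)
    (w z : ℂ) (hw : w ∈ V) (hz : z ∈ closure V) : JoinedIn (insert z V) w z := by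
  let K : ℕ → ℂ → Set ℂ := fun n x => connectedComponentIn (V ∩ ball z (1 / ((n : ℝ) + 1))) x
  have key : ∀ n : ℕ, ∀ S ⊆ V, z ∈ closure S → ∃ x ∈ S, x ∈ V ∩ ball z (1 / ((n : ℝ) + 1)) ∧
      z ∈ closure (K n x) := by
    intro n S hS hzS
    obtain ⟨x, hx, hxb, hxz⟩ := exists_comp P V hPc hVo hVc hVP hfr z (1 / ((n : ℝ) + 1))
      (by positivity) S hS hzS
    exact ⟨x, hx, ⟨hS hx, hxb⟩, hxz⟩
  have hKV : ∀ n x, K n x ⊆ V := fun n x =>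
    (connectedComponentIn_subset _ _).trans inter_subset_left
  obtain ⟨x0, hx0V, hx0, hx0'⟩ := key 0 V subset_rfl hz
  have step : ∀ n : ℕ, ∀ x : ℂ, ∃ y : ℂ, (z ∈ closure (K n x)) →
      y ∈ K n x ∧ y ∈ V ∩ ball z (1 / (((n + 1 : ℕ) : ℝ) + 1)) ∧ z ∈ closure (K (n + 1) y) := by
    intro n x
    by_cases h : z ∈ closure (K n x)
    · obtain ⟨y, hy⟩ := key (n + 1) (K n x) (hKV n x) h
      exact ⟨y, fun _ => hy⟩
    · exact ⟨0, fun h' => absurd h' h⟩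
  choose nx hnx using step
  let p : ℕ → ℂ := fun n => Nat.rec x0 (fun n x => nx n x) n
  have hpn : ∀ n, p (n + 1) = nx n (p n) := fun n => rfl
  have hp : ∀ n : ℕ, p n ∈ V ∩ ball z (1 / ((n : ℝ) + 1)) ∧ z ∈ closure (K n (p n)) := by
    intro n
    induction n with
    | zero => exact ⟨hx0, hx0'⟩
    | succ n ih => exact (hnx n (p n) ih.2).2
  have hj := inf_concat V z p (by
    intro n
    have ho : IsOpen (K n (p n)) := (hVo.inter isOpen_ball).connectedComponentIn
    have hmem : p n ∈ K n (p n) := mem_connectedComponentIn (hp n).1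
    have hc : IsConnected (K n (p n)) := ⟨⟨_, hmem⟩, isPreconnected_connectedComponentIn⟩
    have hpc := ho.isConnected_iff_isPathConnected.1 hc
    exact (hpc.joinedIn _ hmem _ (hnx n (p n) (hp n).2).1).mono (connectedComponentIn_subset _ _))
  have hVpc := hVo.isConnected_iff_isPathConnected.1 ⟨⟨w, hw⟩, hVc⟩
  exact ((hVpc.joinedIn _ hw _ hx0V).mono (subset_insert _ _)).trans hj

end Acc

namespace Acc

/-- closed sets whose gaps can be collapsed -/
def Collapse {X : Type*} (γ : ℝ → X) (C : Set ℝ) : Prop :=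
  IsClosed C ∧ C ⊆ Icc 0 1 ∧ (0 : ℝ) ∈ C ∧ (1 : ℝ) ∈ C ∧
    ∀ s ∈ C, ∀ t ∈ C, s < t → (∀ u ∈ C, ¬ (s < u ∧ u < t)) → γ s = γ t

lemma exists_minimal {X : Type*} [MetricSpace X] (γ : ℝ → X) (hγ : Continuous γ) :
    ∃ C, Collapse γ C ∧ ∀ s ∈ C, ∀ t ∈ C, s < t → γ s = γ t → ∀ u ∈ C, ¬ (s < u ∧ u < t) := by
  obtain ⟨C, -, hC⟩ := zorn_superset_nonempty {C | Collapse γ C} (by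
    intro c hcS hchain hne
    obtain ⟨C0, hC0⟩ := hne
    have hcl : ∀ D ∈ c, IsClosed D := fun D hD => (hcS hD).1
    refine ⟨⋂₀ c, ⟨isClosed_sInter hcl, ?_, ?_, ?_, ?_⟩, fun s hs => sInter_subset_of_mem hs⟩
    · exact (sInter_subset_of_mem hC0).trans (hcS hC0).2.1
    · exact fun D hD => (hcS hD).2.2.1
    · exact fun D hD => (hcS hD).2.2.2.1
    · intro s hs t ht hst hgap
      -- for every small η there is a gap of some member approximating (s,t)
      have key : ∀ η : ℝ, 0 < η → s + η < t - η → ∃ a b, a ∈ Icc s (s + η) ∧ b ∈ Icc (t - η) t ∧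
          γ a = γ b := by
        intro η hη hη2
        obtain ⟨D, hDc, hD⟩ : ∃ D ∈ c, Icc (s + η) (t - η) ∩ D = ∅ := by
          by_contra! hcon
          have : Nonempty c := ⟨⟨C0, hC0⟩⟩
          have := IsCompact.nonempty_iInter_of_directed_nonempty_isCompact_isClosed
            (fun D : c => Icc (s + η) (t - η) ∩ (D : Set ℝ)) (by
              intro D E
              rcases hchain.total D.2 E.2 with h | h
              · exact ⟨D, subset_rfl, inter_subset_inter_right _ h⟩
              · exact ⟨E, inter_subset_inter_right _ h, subset_rfl⟩)
            (fun D => hcon D D.2)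
            (fun D => isCompact_Icc.inter_right (hcl D D.2))
            (fun D => isClosed_Icc.inter (hcl D D.2))
          obtain ⟨u, hu⟩ := this
          rw [mem_iInter] at hu
          have h1 := (hu ⟨C0, hC0⟩).1
          exact hgap u (fun D hD => (hu ⟨D, hD⟩).2) ⟨by linarith [h1.1], by linarith [h1.2]⟩
        obtain ⟨hDcl, -, -, -, hDg⟩ := hcS hDc
        obtain ⟨a, ⟨haD, ha⟩, hamax⟩ := (isCompact_Icc.inter_left hDcl).exists_isGreatest
          (s := D ∩ Icc s (s + η)) ⟨s, hs D hDc, ⟨le_rfl, by linarith⟩⟩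
        obtain ⟨b, ⟨hbD, hb⟩, hbmin⟩ := (isCompact_Icc.inter_left hDcl).exists_isLeast
          (s := D ∩ Icc (t - η) t) ⟨t, ht D hDc, ⟨by linarith, le_rfl⟩⟩
        refine ⟨a, b, ha, hb, hDg a haD b hbD (by linarith [ha.2, hb.1]) ?_⟩
        rintro u huD ⟨hau, hub⟩
        by_cases h1 : u ≤ s + η
        · exact absurd (hamax ⟨huD, by linarith [ha.1], h1⟩) (not_le.2 hau)
        · by_cases h2 : t - η ≤ u
          · exact absurd (hbmin ⟨huD, h2, by linarith [hb.2]⟩) (not_le.2 hub)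
          · have : u ∈ Icc (s + η) (t - η) ∩ D := ⟨⟨by linarith, by linarith⟩, huD⟩
            rw [hD] at this
            exact this
      by_contra hne
      have hd : 0 < dist (γ s) (γ t) := dist_pos.2 hne
      obtain ⟨δ1, hδ1, h1⟩ := Metric.continuous_iff.1 hγ s _ (half_pos hd)
      obtain ⟨δ2, hδ2, h2⟩ := Metric.continuous_iff.1 hγ t _ (half_pos hd)
      let η := min (min (δ1 / 2) (δ2 / 2)) ((t - s) / 3)
      have hη1 : η ≤ δ1 / 2 := (min_le_left _ _).trans (min_le_left _ _)
      have hη2 : η ≤ δ2 / 2 := (min_le_left _ _).trans (min_le_right _ _)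
      have hη3 : η ≤ (t - s) / 3 := min_le_right _ _
      have hη : 0 < η := lt_min (lt_min (by linarith) (by linarith)) (by linarith)
      obtain ⟨a, b, ha, hb, hab⟩ := key η hη (by linarith)
      have e1 := h1 a (by rw [Real.dist_eq, abs_lt]; constructor <;> linarith [ha.1, ha.2])
      have e2 := h2 b (by rw [Real.dist_eq, abs_lt]; constructor <;> linarith [hb.1, hb.2])
      rw [hab] at e1
      have := dist_triangle_left (γ s) (γ t) (γ b)
      linarith) (Icc 0 1) (by
    refine ⟨isClosed_Icc, subset_rfl, by simp, by simp, ?_⟩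
    intro s hs t ht hst hgap
    exact absurd ⟨by linarith, by linarith⟩
      (hgap ((s + t) / 2) ⟨by linarith [hs.1, ht.1], by linarith [hs.2, ht.2]⟩))
  refine ⟨C, hC.prop, ?_⟩
  intro s hs t ht hst he u hu hsut
  obtain ⟨hcl, hI, h0, h1, hg⟩ := hC.prop
  have hC' : Collapse γ (C \ Ioo s t) := by
    refine ⟨hcl.sdiff isOpen_Ioo, sdiff_subset.trans hI, ⟨h0, fun h => ?_⟩, ⟨h1, fun h => ?_⟩, ?_⟩
    · linarith [h.1, (hI hs).1]
    · linarith [h.2, (hI ht).2]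
    · rintro a ⟨ha, ha'⟩ b ⟨hb, hb'⟩ hab hgap
      by_cases hbs : b ≤ s
      · exact hg a ha b hb hab fun v hv hv' => hgap v ⟨hv, fun h => by linarith [h.1]⟩ hv'
      by_cases hta : t ≤ a
      · exact hg a ha b hb hab fun v hv hv' => hgap v ⟨hv, fun h => by linarith [h.2]⟩ hv'
      have has : a ≤ s := by
        by_contra h
        exact ha' ⟨by linarith, by linarith⟩
      have htb : t ≤ b := by
        by_contra h
        exact hb' ⟨by linarith, by linarith⟩
      have has' : a = s := by
        by_contra h
        exact hgap s ⟨hs, fun h => lt_irrefl _ h.1⟩ ⟨lt_of_le_of_ne has h, by linarith⟩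
      have htb' : t = b := by
        by_contra h
        exact hgap t ⟨ht, fun h => lt_irrefl _ h.2⟩ ⟨by linarith, lt_of_le_of_ne htb h⟩
      rw [has', ← htb', he]
  have := hC.le_of_le hC' sdiff_subset
  exact (this hu).2 hsut

lemma monotone_path {X : Type*} [MetricSpace X] (γ : ℝ → X) (hγ : Continuous γ) :
    ∃ β : ℝ → X, Continuous β ∧ β 0 = γ 0 ∧ β 1 = γ 1 ∧ (∀ t, β t ∈ γ '' Icc 0 1) ∧
      ∀ s t, s ≤ t → β s = β t → ∀ u ∈ Icc s t, β u = β s := by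
  obtain ⟨C, ⟨hcl, hI, h0, h1, hg⟩, hmin⟩ := exists_minimal γ hγ
  let c : ℝ → ℝ := fun t => sSup (C ∩ Iic t)
  have hbdd : ∀ t, BddAbove (C ∩ Iic t) := fun t => ⟨t, fun u hu => hu.2⟩
  have hneg : ∀ t, t < 0 → c t = 0 := by
    intro t ht
    have : C ∩ Iic t = ∅ := by
      ext u
      simp only [mem_inter_iff, mem_Iic, mem_empty_iff_false, iff_false, not_and, not_le]
      intro hu
      linarith [(hI hu).1]
    simp [c, this]
  have hmem : ∀ t, 0 ≤ t → c t ∈ C ∩ Iic t := fun t ht =>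
    (hcl.inter isClosed_Iic).csSup_mem ⟨0, h0, ht⟩ (hbdd t)
  have hcC : ∀ t, c t ∈ C := by
    intro t
    rcases lt_or_ge t 0 with h | h
    · rw [hneg t h]; exact h0
    · exact (hmem t h).1
  have hle : ∀ t, ∀ u ∈ C, u ≤ t → u ≤ c t := fun t u hu hut => le_csSup (hbdd t) ⟨hu, hut⟩
  have hmono : Monotone c := by
    intro s t hst
    rcases lt_or_ge s 0 with h | h
    · rw [hneg s h]; exact (hI (hcC t)).1
    · exact hle t _ (hmem s h).1 ((hmem s h).2.trans hst)
  have hcid : ∀ t ∈ C, c t = t := fun t ht =>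
    le_antisymm (hmem t (hI ht).1).2 (hle t t ht le_rfl)
  have hceq : ∀ s t, s ≤ t → (∀ u ∈ C, ¬ (s < u ∧ u ≤ t)) → c s = c t := by
    intro s t hst h
    have : C ∩ Iic s = C ∩ Iic t := by
      ext u
      constructor
      · exact fun hu => ⟨hu.1, hu.2.trans hst⟩
      · refine fun hu => ⟨hu.1, ?_⟩
        by_contra h'
        exact h u hu.1 ⟨not_le.1 h', hu.2⟩
    simp only [c, this]
  refine ⟨fun t => γ (c t), ?_, ?_, ?_, fun t => ⟨c t, hI (hcC t), rfl⟩, ?_⟩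
  · rw [continuous_iff_continuousAt]
    intro t
    by_cases ht : t ∈ C
    · have hct := hcid t ht
      rw [continuousAt_iff_continuous_left_right]
      constructor
      · by_cases hacc : ∀ a < t, ∃ u ∈ C, a < u ∧ u < t
        · have : ContinuousWithinAt c (Iic t) t := by
            rw [ContinuousWithinAt, hct, tendsto_order]
            constructor
            · intro a ha
              obtain ⟨u, hu, hau, hut⟩ := hacc a ha
              filter_upwards [mem_nhdsWithin_of_mem_nhds (Ioi_mem_nhds hut)] with s hs
              exact hau.trans_le (hle s u hu (le_of_lt hs))
            · intro a ha
              filter_upwards [self_mem_nhdsWithin] with s hs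
              have := hmono hs
              linarith
          exact hγ.continuousAt.comp_continuousWithinAt this
        · push Not at hacc
          obtain ⟨a, hat, ha⟩ := hacc
          have hev : ∀ s, a < s → s < t → c s = c a := fun s has hst =>
            (hceq a s has.le fun u hu hu' => absurd (ha u hu hu'.1) (not_le.2 (hu'.2.trans_lt hst))).symm
          have hγa : γ (c a) = γ t := by
            have hcat : c a ≤ t := hct ▸ hmono hat.le
            rcases hcat.eq_or_lt with h | h
            · rw [h]
            · refine hg _ (hcC a) _ ht h ?_
              rintro u hu ⟨hu1, hu2⟩
              have : u ≤ a := by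
                by_contra h'
                linarith [ha u hu (not_le.1 h')]
              linarith [hle a u hu this]
          have : (fun _ => γ t) =ᶠ[𝓝[Iic t] t] fun s => γ (c s) := by
            filter_upwards [self_mem_nhdsWithin, mem_nhdsWithin_of_mem_nhds (Ioi_mem_nhds hat)]
              with s hs hs'
            rcases (show s ≤ t from hs).eq_or_lt with h | h
            · rw [h, hct]
            · rw [hev s hs' h, hγa]
          refine continuousWithinAt_const.congr_of_eventuallyEq this.symm ?_
          simp [hct]
      · have : ContinuousWithinAt c (Ici t) t := by
          rw [ContinuousWithinAt, hct, tendsto_order]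
          constructor
          · intro a ha
            filter_upwards [self_mem_nhdsWithin] with s hs
            have := hmono hs
            linarith
          · intro a ha
            filter_upwards [self_mem_nhdsWithin, mem_nhdsWithin_of_mem_nhds (Iio_mem_nhds ha)]
              with s hs hs'
            have h2 : t ≤ s := hs
            have h3 : s < a := hs'
            have := (hmem s ((hI ht).1.trans h2)).2
            exact lt_of_le_of_lt this h3
        exact hγ.continuousAt.comp_continuousWithinAt this
    · obtain ⟨r, hr, hb⟩ := Metric.isOpen_iff.1 hcl.isOpen_compl t ht
      have : (fun _ => γ (c t)) =ᶠ[𝓝 t] fun s => γ (c s) := by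
        filter_upwards [ball_mem_nhds t hr] with s hs
        rw [mem_ball, Real.dist_eq, abs_lt] at hs
        congr 1
        rcases le_total s t with h | h
        · refine (hceq s t h fun u hu hu' => hb ?_ hu).symm
          rw [mem_ball, Real.dist_eq, abs_lt]
          constructor <;> linarith [hu'.1, hu'.2]
        · refine hceq t s h fun u hu hu' => hb ?_ hu
          rw [mem_ball, Real.dist_eq, abs_lt]
          constructor <;> linarith [hu'.1, hu'.2]
      exact continuousAt_const.congr this
  · simp only [hcid 0 h0]
  · simp only [hcid 1 h1]
  · intro s t hst he u hu
    have h2 := hmono hu.1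
    have h3 := hmono hu.2
    rcases (hmono hst).eq_or_lt with h | h
    · simp only
      congr 1
      linarith
    · have := hmin _ (hcC s) _ (hcC t) h he (c u) (hcC u)
      rcases h2.eq_or_lt with h4 | h4
      · simp only [h4]
      · rcases h3.eq_or_lt with h5 | h5
        · simp only [h5]; exact he.symm
        · exact absurd ⟨h4, h5⟩ this

lemma exists_reparam {X : Type*} [MetricSpace X] (β : ℝ → X) (hβ : Continuous β)
    (hm : ∀ s t, s ≤ t → β s = β t → ∀ u ∈ Icc s t, β u = β s) :
    ∃ φ : ℝ → ℝ, Continuous φ ∧ Monotone φ ∧ ∀ s t, φ s = φ t ↔ β s = β t := by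
  let E : ℝ → ℝ → ℝ := fun q v => min 1 (dist (β q) (β v))
  have hE0 : ∀ q v, 0 ≤ E q v := fun q v => le_min zero_le_one dist_nonneg
  have hE1 : ∀ q v, E q v ≤ 1 := fun q v => min_le_left _ _
  have hEq : ∀ q, E q q = 0 := fun q => by simp [E]
  let M : ℝ → ℝ → ℝ := fun q t => sSup ((fun u => E q (q + u * max (t - q) 0)) '' Icc (0 : ℝ) 1)
  have hMc : ∀ q, Continuous (M q) := fun q => by
    refine IsCompact.continuous_sSup (f := fun t u => E q (q + u * max (t - q) 0)) isCompact_Icc ?_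
    simp only [E]
    fun_prop
  have hbdd : ∀ q t, BddAbove ((fun u => E q (q + u * max (t - q) 0)) '' Icc (0 : ℝ) 1) := by
    rintro q t
    refine ⟨1, ?_⟩
    rintro _ ⟨u, -, rfl⟩
    exact hE1 _ _
  have hMge : ∀ q t v, q ≤ v → v ≤ t → E q v ≤ M q t := by
    intro q t v hqv hvt
    refine le_csSup (hbdd q t) ⟨(v - q) / (t - q), ⟨?_, ?_⟩, ?_⟩
    · exact div_nonneg (by linarith) (by linarith)
    · exact div_le_one_of_le₀ (by linarith) (by linarith)
    · simp only
      rw [max_eq_left (by linarith)]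
      rcases (hqv.trans hvt).eq_or_lt with h | h
      · have : v = q := by linarith
        simp [this]
      · congr 1
        rw [div_mul_cancel₀ _ (by linarith)]; ring
  have hMle : ∀ q t B, (∀ v, q ≤ v → v ≤ max q t → E q v ≤ B) → M q t ≤ B := by
    intro q t B h
    refine csSup_le ⟨_, ⟨0, by simp, rfl⟩⟩ ?_
    rintro _ ⟨u, hu, rfl⟩
    apply h
    · nlinarith [hu.1, le_max_right (t - q) 0]
    · have : max q t = q + max (t - q) 0 := by
        rw [← max_add_add_left]; simp [max_comm]
      rw [this]
      nlinarith [hu.2, le_max_right (t - q) 0]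
  have hM0 : ∀ q t, 0 ≤ M q t := by
    intro q t
    refine (hE0 q q).trans ?_
    exact le_csSup (hbdd q t) ⟨0, by simp, by simp⟩
  have hM1 : ∀ q t, M q t ≤ 1 := fun q t => hMle q t 1 fun v _ _ => hE1 q v
  have hMz : ∀ q t, t ≤ q → M q t = 0 := by
    intro q t h
    refine le_antisymm (hMle q t 0 fun v h1 h2 => ?_) (hM0 q t)
    rw [max_eq_left h] at h2
    rw [le_antisymm h2 h1, hEq]
  have hMmono : ∀ q, Monotone (M q) := by
    intro q s t hst
    rcases le_total s q with h | h
    · rw [hMz q s h]; exact hM0 q t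
    · refine hMle q s _ fun v h1 h2 => hMge q t v h1 ?_
      rw [max_eq_right h] at h2
      exact h2.trans hst
  have hMconst : ∀ q s t, s ≤ t → β s = β t → M q s = M q t := by
    intro q s t hst he
    refine le_antisymm (hMmono q hst) ?_
    refine hMle q t _ fun v h1 h2 => ?_
    rcases le_total t q with h | h
    · rw [max_eq_left h] at h2
      rw [le_antisymm h2 h1, hEq]; exact hM0 _ _
    · rw [max_eq_right h] at h2
      rcases le_total v s with h3 | h3
      · exact hMge q s v h1 h3
      · have hv := hm s t hst he v ⟨h3, h2⟩
        rcases le_total q s with h4 | h4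
        · have := hMge q s s h4 le_rfl
          simp only [E] at this ⊢
          rwa [hv]
        · have hq := hm s t hst he q ⟨h4, h⟩
          simp only [E]
          rw [hv, hq]
          simpa using hM0 q s
  let q : ℕ → ℝ := TopologicalSpace.denseSeq ℝ
  have hterm : ∀ n t, ‖(1 / 2 : ℝ) ^ n * M (q n) t‖ ≤ (1 / 2 : ℝ) ^ n := by
    intro n t
    rw [Real.norm_of_nonneg (mul_nonneg (by positivity) (hM0 _ _))]
    exact mul_le_of_le_one_right (by positivity) (hM1 _ _)
  have hsum : ∀ t, Summable fun n => (1 / 2 : ℝ) ^ n * M (q n) t := fun t =>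
    Summable.of_norm_bounded summable_geometric_two (fun n => hterm n t)
  let φ : ℝ → ℝ := fun t => ∑' n, (1 / 2 : ℝ) ^ n * M (q n) t
  have hle : ∀ s t, s ≤ t → ∀ n, (1 / 2 : ℝ) ^ n * M (q n) s ≤ (1 / 2 : ℝ) ^ n * M (q n) t :=
    fun s t hst n => mul_le_mul_of_nonneg_left (hMmono _ hst) (by positivity)
  have hφ : ∀ s t, s ≤ t → (φ s = φ t ↔ β s = β t) := by
    intro s t hst
    constructor
    · intro h
      by_contra hne
      have hlt : s < t := lt_of_le_of_ne hst fun h => hne (by rw [h])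
      have hev : ∀ᶠ v in 𝓝[>] s, v ∈ Ioo s t ∧ β v ≠ β t := by
        have h1 : ∀ᶠ v in 𝓝 s, β v ≠ β t := hβ.continuousAt.eventually_ne hne
        filter_upwards [Ioo_mem_nhdsGT hlt, mem_nhdsWithin_of_mem_nhds h1] with v h2 h3
        exact ⟨h2, h3⟩
      have hopen : IsOpen (Ioo s t ∩ {v | β v ≠ β t}) :=
        isOpen_Ioo.inter (isOpen_ne_fun hβ continuous_const)
      obtain ⟨v, hv⟩ := hev.exists
      obtain ⟨_, hn1, n, rfl⟩ := (TopologicalSpace.denseRange_denseSeq ℝ).inter_open_nonempty _ hopen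
        ⟨v, hv⟩
      have hqn : q n ∈ Ioo s t ∩ {v | β v ≠ β t} := hn1
      have : φ s < φ t := by
        refine Summable.tsum_lt_tsum (i := n) (hle s t hst) ?_ (hsum s) (hsum t)
        refine mul_lt_mul_of_pos_left ?_ (by positivity)
        rw [hMz _ _ hqn.1.1.le]
        refine lt_of_lt_of_le ?_ (hMge (q n) t t hqn.1.2.le le_rfl)
        exact lt_min one_pos (dist_pos.2 hqn.2)
      linarith
    · intro h
      simp only [φ]
      congr 1
      ext n
      rw [hMconst _ s t hst h]
  refine ⟨φ, ?_, ?_, ?_⟩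
  · exact continuous_tsum (fun n => continuous_const.mul (hMc _)) summable_geometric_two hterm
  · exact fun s t hst => Summable.tsum_le_tsum (hle s t hst) (hsum s) (hsum t)
  · intro s t
    rcases le_total s t with h | h
    · exact hφ s t h
    · rw [eq_comm, hφ t s h, eq_comm]

lemma exists_arc {X : Type*} [MetricSpace X] (γ : ℝ → X) (hγ : Continuous γ) (hne : γ 0 ≠ γ 1) :
    ∃ α : ℝ → X, Continuous α ∧ InjOn α (Icc 0 1) ∧ α 0 = γ 0 ∧ α 1 = γ 1 ∧
      ∀ t, α t ∈ γ '' Icc 0 1 := by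
  obtain ⟨β, hβ, hβ0, hβ1, hβr, hm⟩ := monotone_path γ hγ
  obtain ⟨φ, hφc, hφm, hφ⟩ := exists_reparam β hβ hm
  have h01 : φ 0 < φ 1 := by
    refine lt_of_le_of_ne (hφm zero_le_one) fun h => hne ?_
    rw [← hβ0, ← hβ1]; exact (hφ 0 1).1 h
  have hpos : 0 < φ 1 - φ 0 := by linarith
  let ψ : Icc (0 : ℝ) 1 → Icc (0 : ℝ) 1 := fun t => ⟨(φ t - φ 0) / (φ 1 - φ 0), by
    constructor
    · exact div_nonneg (by linarith [hφm t.2.1]) hpos.le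
    · exact div_le_one_of_le₀ (by linarith [hφm t.2.2]) hpos.le⟩
  have hψc : Continuous ψ := by
    refine Continuous.subtype_mk ?_ _
    fun_prop
  have hψs : Function.Surjective ψ := by
    intro y
    have := intermediate_value_Icc (zero_le_one (α := ℝ)) hφc.continuousOn
    obtain ⟨t, ht, hty⟩ := this (show φ 0 + y * (φ 1 - φ 0) ∈ Icc (φ 0) (φ 1) from
      ⟨by nlinarith [y.2.1], by nlinarith [y.2.2]⟩)
    refine ⟨⟨t, ht⟩, Subtype.ext ?_⟩
    simp only [ψ]
    rw [hty]
    field_simp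
    ring
  have hψ : ∀ s t, ψ s = ψ t ↔ β s = β t := by
    intro s t
    rw [← hφ, Subtype.ext_iff]
    simp only [ψ]
    rw [div_left_inj' hpos.ne', sub_left_inj]
  have hq : IsQuotientMap ψ := hψc.isClosedMap.isQuotientMap hψc hψs
  let α' : Icc (0 : ℝ) 1 → X := fun y => β ((Function.surjInv hψs y : Icc (0 : ℝ) 1) : ℝ)
  have hα' : ∀ t, α' (ψ t) = β t := fun t => (hψ _ _).1 (Function.surjInv_eq hψs (ψ t))
  have hα'c : Continuous α' := by
    rw [hq.continuous_iff]
    have : α' ∘ ψ = fun t : Icc (0 : ℝ) 1 => β t := funext hα'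
    rw [this]
    fun_prop
  have hψ0 : ψ ⟨0, by simp⟩ = ⟨0, by simp⟩ := by simp [ψ]
  have hψ1 : ψ ⟨1, by simp⟩ = ⟨1, by simp⟩ := by
    apply Subtype.ext
    simp only [ψ]
    exact div_self hpos.ne'
  refine ⟨IccExtend zero_le_one α', hα'c.Icc_extend', ?_, ?_, ?_, ?_⟩
  · intro s hs t ht h
    rw [IccExtend_of_mem _ _ hs, IccExtend_of_mem _ _ ht] at h
    have h2 := (hψ _ _).2 h
    rw [Function.surjInv_eq hψs, Function.surjInv_eq hψs] at h2
    exact congrArg Subtype.val h2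
  · rw [IccExtend_of_mem _ _ (by simp), ← hψ0, hα', hβ0]
  · rw [IccExtend_of_mem _ _ (by simp), ← hψ1, hα', hβ1]
  · intro t
    exact hβr _

end Acc

open Acc in
/-- Accessibility of boundary points of complementary components of a Peano continuum:
there is an arc from a point `w` of the component `V` to a boundary point `z`,
lying in `V` except for the endpoint `z`. -/
theorem stmt_6 (P : Set (ℝ × ℝ)) (hPc : IsCompact P) (hPconn : IsConnected P)
    (hPlc : LocallyConnectedSpace P)
    (V : Set (ℝ × ℝ)) (hV : ∃ p ∈ Pᶜ, V = connectedComponentIn Pᶜ p)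
    (w : ℝ × ℝ) (hw : w ∈ V) (z : ℝ × ℝ) (hz : z ∈ closure V \ V) :
    ∃ γ : ℝ → ℝ × ℝ, ContinuousOn γ (Set.Icc 0 1) ∧ Set.InjOn γ (Set.Icc 0 1) ∧
      γ 0 = w ∧ γ 1 = z ∧ γ '' Set.Ico 0 1 ⊆ V := by
  obtain ⟨p, hp, hVp⟩ := hV
  have hPo : IsOpen Pᶜ := hPc.isClosed.isOpen_compl
  have hVo : IsOpen V := hVp ▸ hPo.connectedComponentIn
  have hVc : IsPreconnected V := hVp ▸ isPreconnected_connectedComponentIn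
  have hVP : Disjoint V P := by
    rw [hVp]
    exact disjoint_compl_left.mono_left (connectedComponentIn_subset _ _)
  have hfr : closure V \ V ⊆ P := by
    have := comp_frontier hPo p
    rwa [← hVp, compl_compl] at this
  let e : ℝ × ℝ ≃ₜ ℂ := Complex.equivRealProdCLM.symm.toHomeomorph
  have : LocallyConnectedSpace (e '' P) :=
    (e.image P).symm.isOpenEmbedding.locallyConnectedSpace
  have hj := joined (e '' P) (e '' V) (hPc.image e.continuous) (e.isOpenMap _ hVo)
    (hVc.image _ e.continuous.continuousOn)
    ((disjoint_image_iff e.injective).2 hVP)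
    (by rw [← e.image_closure, ← image_sdiff e.injective]; exact image_mono hfr)
    (e w) (e z) (mem_image_of_mem _ hw) (by rw [← e.image_closure]; exact mem_image_of_mem _ hz.1)
  obtain ⟨σ, hσ⟩ := hj
  obtain ⟨α, hαc, hαi, hα0, hα1, hαr⟩ := exists_arc σ.extend σ.continuous_extend (by
    rw [Path.extend_zero, Path.extend_one]
    intro h
    have := e.injective h
    exact hz.2 (this ▸ hw))
  rw [Path.extend_zero] at hα0
  rw [Path.extend_one] at hα1
  refine ⟨fun t => e.symm (α t), (e.symm.continuous.comp hαc).continuousOn, ?_, ?_, ?_, ?_⟩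
  · intro s hs t ht h
    exact hαi hs ht (e.symm.injective h)
  · simp [hα0]
  · simp [hα1]
  · rintro _ ⟨t, ht, rfl⟩
    obtain ⟨s, hs, hst⟩ := hαr t
    rw [Path.extend_apply _ hs] at hst
    have hmem := hσ ⟨s, hs⟩
    rw [hst] at hmem
    rcases hmem with h | ⟨v, hv, hve⟩
    · exfalso
      rw [← hα1] at h
      have := hαi ⟨ht.1, ht.2.le⟩ ⟨zero_le_one, le_rfl⟩ h
      linarith [ht.2]
    · simp only [← hve, e.symm_apply_apply]
      exact hv
end

section
/- Let P be a Peano continuum in ℝ² and V a connected component of ℝ² \ P. For any two distinct points z, z' ∈ ∂V, there exists an arc Γ with endpoint set {z, z'} such that the interior of Γ (the arc minus its two endpoints) is contained in V. -/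
open Set Metric Topology

namespace PeanoAcc

/-- `w - x` has a continuous logarithm on `K`. -/
def HasLog (K : Set ℂ) (x : ℂ) : Prop :=
  ∃ f : ℂ → ℂ, ContinuousOn f K ∧ ∀ w ∈ K, Complex.exp (f w) = w - x

lemma const_of_exp_eq_one {X : Type*} [TopologicalSpace X] {K : Set X} (hK : IsPreconnected K)
    {g : X → ℂ} (hg : ContinuousOn g K) (h1 : ∀ w ∈ K, Complex.exp (g w) = 1) :
    ∃ n : ℤ, ∀ w ∈ K, g w = n * (2 * Real.pi * Complex.I) := by
  rcases K.eq_empty_or_nonempty with rfl | ⟨w₀, hw₀⟩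
  · exact ⟨0, by simp⟩
  obtain ⟨n, hn⟩ := Complex.exp_eq_one_iff.1 (h1 w₀ hw₀)
  refine ⟨n, fun w hw => ?_⟩
  rw [← hn]
  have hd : IsDiscrete ((AddSubgroup.zmultiples (2 * Real.pi * Complex.I) : AddSubgroup ℂ) : Set ℂ) :=
    ⟨NormedSpace.discreteTopology_zmultiples _⟩
  refine hK.constant_of_mapsTo hd hg (fun w hw => ?_) hw hw₀
  obtain ⟨m, hm⟩ := Complex.exp_eq_one_iff.1 (h1 w hw)
  exact ⟨m, by simp [hm]⟩

lemma hasLog_of_far {K : Set ℂ} {c : ℂ} {r : ℝ} (hr : 0 ≤ r) (hK : K ⊆ closedBall c r) {y : ℂ}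
    (hy : r < dist y c) : HasLog K y := by
  have hcy : c - y ≠ 0 := by
    intro h
    have : c = y := sub_eq_zero.1 h
    subst this
    simp at hy
    linarith
  have hsl : ∀ w ∈ K, (w - y) / (c - y) ∈ Complex.slitPlane := by
    intro w hw
    have : (w - y) / (c - y) = 1 + (w - c) / (c - y) := by field_simp; ring
    rw [this]
    apply Complex.mem_slitPlane_of_norm_lt_one
    rw [norm_div, div_lt_one (norm_pos_iff.2 hcy), ← dist_eq_norm, ← dist_eq_norm, dist_comm c y]
    exact lt_of_le_of_lt (hK hw) hy
  refine ⟨fun w => Complex.log ((w - y) / (c - y)) + Complex.log (c - y), ?_, fun w hw => ?_⟩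
  · exact ContinuousOn.add (ContinuousOn.clog (by fun_prop) hsl) continuousOn_const
  · rw [Complex.exp_add, Complex.exp_log (Complex.slitPlane_ne_zero (hsl w hw)), Complex.exp_log hcy]
    field_simp

lemma hasLog_near {K : Set ℂ} {a b : ℂ} (h : ∀ w ∈ K, ‖a - b‖ < ‖w - a‖) :
    HasLog K a ↔ HasLog K b := by
  have hne : ∀ w ∈ K, w - a ≠ 0 := fun w hw h0 => by
    have := h w hw
    rw [h0, norm_zero] at this
    exact absurd this (not_lt.2 (norm_nonneg _))
  have hsl : ∀ w ∈ K, (w - b) / (w - a) ∈ Complex.slitPlane := by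
    intro w hw
    have h0 := hne w hw
    have : (w - b) / (w - a) = 1 + (a - b) / (w - a) := by field_simp; ring
    rw [this]
    apply Complex.mem_slitPlane_of_norm_lt_one
    rw [norm_div, div_lt_one (norm_pos_iff.2 h0)]
    exact h w hw
  have hc : ContinuousOn (fun w => Complex.log ((w - b) / (w - a))) K :=
    ContinuousOn.clog (ContinuousOn.div (by fun_prop) (by fun_prop) hne) hsl
  constructor
  · rintro ⟨f, hf, hfe⟩
    refine ⟨fun w => f w + Complex.log ((w - b) / (w - a)), hf.add hc, fun w hw => ?_⟩
    have h0 := hne w hw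
    rw [Complex.exp_add, Complex.exp_log (Complex.slitPlane_ne_zero (hsl w hw)), hfe w hw]
    field_simp
  · rintro ⟨f, hf, hfe⟩
    refine ⟨fun w => f w - Complex.log ((w - b) / (w - a)), hf.sub hc, fun w hw => ?_⟩
    have h0 := hne w hw
    have h1 := Complex.slitPlane_ne_zero (hsl w hw)
    have h2 : w - b ≠ 0 := fun h => h1 (by simp [h])
    rw [Complex.exp_sub, Complex.exp_log h1, hfe w hw]
    field_simp

/-- Moving the base point inside a connected set off `K`. -/
lemma hasLog_transfer {K C : Set ℂ} (hK : IsCompact K) (hC : IsPreconnected C)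
    (hd : Disjoint C K) {x y : ℂ} (hx : x ∈ C) (hy : y ∈ C) (h : HasLog K y) : HasLog K x := by
  classical
  have key : decide (HasLog K x) = decide (HasLog K y) := by
    refine hC.constant_of_mapsTo (T := (univ : Set Bool)) (f := fun a => decide (HasLog K a))
      ⟨inferInstance⟩ ?_ (mapsTo_univ _ _) hx hy
    intro a ha
    have haK : a ∈ Kᶜ := fun h => hd.le_bot ⟨ha, h⟩
    obtain ⟨ε, hε, hb⟩ := Metric.isOpen_iff.1 hK.isClosed.isOpen_compl a haK
    refine ContinuousAt.continuousWithinAt ?_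
    refine (continuousAt_const (y := decide (HasLog K a))).congr ?_
    filter_upwards [ball_mem_nhds a hε] with b hb'
    have := hasLog_near (K := K) (a := a) (b := b) (fun w hw => by
      have h1 : ε ≤ dist w a := by
        by_contra h
        exact hb (mem_ball.2 (not_le.1 h)) hw
      rw [← dist_eq_norm, ← dist_eq_norm, dist_comm a b]
      exact lt_of_lt_of_le hb' h1)
    simp [this]
  simpa [h] using key

lemma no_log_circle {L : ℂ → ℂ} (hL : Continuous L) {x : ℂ} {R : ℝ} (hR : 0 < R) {k : ℤ}
    (h : ∀ w ∈ sphere x R, Complex.exp (L w) = (w - x) ^ k) : k = 0 := by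
  have key := const_of_exp_eq_one (X := ℝ) (K := univ) isPreconnected_univ
    (g := fun θ => L (circleMap x R θ) - k * (θ * Complex.I) - k * Real.log R) (by fun_prop) (by
      intro θ _
      have h1 := h (circleMap x R θ) (circleMap_mem_sphere x hR.le θ)
      have hR' : (R:ℂ) ≠ 0 := by exact_mod_cast hR.ne'
      rw [Complex.exp_sub, Complex.exp_sub, h1, Complex.exp_int_mul, Complex.exp_int_mul,
        Complex.ofReal_log hR.le, Complex.exp_log hR']
      simp only [circleMap, add_sub_cancel_left, mul_zpow]
      have := Complex.exp_ne_zero (θ * Complex.I)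
      field_simp)
  obtain ⟨n, hn⟩ := key
  have h0 := hn 0 trivial
  have h1 := hn (2 * Real.pi) trivial
  simp only [circleMap, Complex.ofReal_zero, zero_mul, Complex.exp_zero, mul_zero, mul_one, sub_zero] at h0
  simp only [circleMap] at h1
  push_cast at h1
  rw [Complex.exp_two_pi_mul_I] at h1
  rw [mul_one] at h1
  have h2 : (k:ℂ) * (2 * Real.pi * Complex.I) = 0 := by linear_combination h0 - h1
  have := Complex.two_pi_I_ne_zero
  simpa [this] using h2

lemma no_log {ι : Type*} [Fintype ι] [DecidableEq ι] {M : Set ℂ} (hM : IsClosed M)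
    {U : ι → Set ℂ} {x : ι → ℂ} (hUo : ∀ i, IsOpen (U i)) (hUb : ∀ i, Bornology.IsBounded (U i))
    (hUf : ∀ i, frontier (U i) ⊆ M) (hUM : ∀ i, Disjoint (U i) M) (hx : ∀ i, x i ∈ U i)
    (hdisj : ∀ i j, i ≠ j → Disjoint (U i) (U j)) {F : ℂ → ℂ} (hF : ContinuousOn F M)
    {k : ι → ℤ} (hexp : ∀ w ∈ M, Complex.exp (F w) = ∏ i, (w - x i) ^ (k i)) (j : ι) :
    k j = 0 := by
  classical
  obtain ⟨G, hG⟩ := ContinuousMap.exists_restrict_eq hM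
    ⟨M.domRestrict F, continuousOn_iff_continuous_domRestrict.1 hF⟩
  have hGF : ∀ w ∈ M, G w = F w := fun w hw => by
    have := congrArg (fun f => f ⟨w, hw⟩) hG
    simpa using this
  have hcl : ∀ w ∈ closure (U j), w ∈ U j ∨ w ∈ M := fun w hw => by
    by_cases h : w ∈ U j
    · exact Or.inl h
    · exact Or.inr (hUf j ⟨hw, by rwa [(hUo j).interior_eq]⟩)
  have hne : ∀ w ∈ closure (U j), ∀ i, i ≠ j → w - x i ≠ 0 := by
    intro w hw i hij h
    rw [sub_eq_zero] at h
    subst h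
    rcases hcl _ hw with h | h
    · exact (hdisj i j hij).le_bot ⟨hx i, h⟩
    · exact (hUM i).le_bot ⟨hx i, h⟩
  let A : ℂ → ℂ := fun w => Complex.exp (G w) * ∏ i ∈ Finset.univ.erase j, (w - x i) ^ (- k i)
  let B : ℂ → ℂ := fun w => (w - x j) ^ (k j)
  have hAB : ∀ w ∈ M, A w = B w := by
    intro w hw
    have hwi : ∀ i, w - x i ≠ 0 := fun i h => by
      rw [sub_eq_zero] at h
      subst h
      exact (hUM i).le_bot ⟨hx i, hw⟩
    simp only [A, B, hGF w hw, hexp w hw]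
    rw [← Finset.mul_prod_erase _ _ (Finset.mem_univ j), mul_assoc, ← Finset.prod_mul_distrib,
      Finset.prod_eq_one, mul_one]
    intro i _
    rw [← zpow_add₀ (hwi i)]; simp
  let h : ℂ → ℂ := (U j).piecewise A B
  have hhc : Continuous h := by
    refine continuous_piecewise (fun w hw => hAB w (hUf j hw)) ?_ ?_
    · refine ContinuousOn.mul (by fun_prop) (continuousOn_finsetProd _ fun i hi => ?_)
      refine ContinuousOn.zpow₀ (by fun_prop) _ fun w hw => Or.inl (hne w hw i (Finset.ne_of_mem_erase hi))
    · refine ContinuousOn.zpow₀ (by fun_prop) _ fun w hw => Or.inl ?_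
      rw [(hUo j).isClosed_compl.closure_eq] at hw
      intro h
      rw [sub_eq_zero] at h
      subst h
      exact hw (hx j)
  have hh0 : ∀ w, h w ≠ 0 := by
    intro w
    by_cases hw : w ∈ U j
    · simp only [h, piecewise_eq_of_mem _ _ _ hw, A]
      refine mul_ne_zero (Complex.exp_ne_zero _) (Finset.prod_ne_zero_iff.2 fun i hi => ?_)
      exact zpow_ne_zero _ (hne w (subset_closure hw) i (Finset.ne_of_mem_erase hi))
    · simp only [h, piecewise_eq_of_notMem _ _ _ hw, B]
      refine zpow_ne_zero _ fun h => hw ?_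
      rw [sub_eq_zero] at h
      subst h
      exact hx j
  obtain ⟨L, hLc, hL⟩ := Complex.exists_continuousOn_eqOn_exp_comp (U := (univ : Set ℂ))
    (by
      have : ContractibleSpace (univ : Set ℂ) := convex_univ.contractibleSpace univ_nonempty
      exact SimplyConnectedSpace.ofContractible _) isOpen_univ hhc.continuousOn (by simpa using hh0)
  obtain ⟨R, hR⟩ := (hUb j).subset_ball (x j)
  have hRp : 0 < R := by
    have := hR (hx j)
    simpa using this
  refine no_log_circle (continuousOn_univ.1 hLc) hRp (x := x j) fun w hw => ?_
  have : w ∉ U j := fun h' => by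
    have := hR h'
    rw [mem_ball] at this
    rw [mem_sphere] at hw
    linarith
  have h2 := hL (mem_univ w)
  simp only [Function.comp] at h2
  rw [h2]
  simp only [h, piecewise_eq_of_notMem _ _ _ this, B]

end PeanoAcc
open Set Metric Topology

namespace PeanoAcc

/-- Property S for compact sets: finite covers by small subcontinua. -/
def SmallCover (M : Set ℂ) : Prop :=
  ∀ d : ℝ, 0 < d → ∃ (ι : Type) (_ : Fintype ι) (K : ι → Set ℂ),
    (∀ i, IsCompact (K i) ∧ IsConnected (K i) ∧ ∃ c, K i ⊆ closedBall c d) ∧ ⋃ i, K i = M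

lemma SmallCover.union {M N : Set ℂ} (hM : SmallCover M) (hN : SmallCover N) :
    SmallCover (M ∪ N) := by
  intro d hd
  obtain ⟨ι, _, K, hK, rfl⟩ := hM d hd
  obtain ⟨κ, _, L, hL, rfl⟩ := hN d hd
  refine ⟨ι ⊕ κ, inferInstance, Sum.elim K L, ?_, ?_⟩
  · rintro (i | i)
    · exact hK i
    · exact hL i
  · rw [iUnion_sum]; rfl

lemma smallCover_range {X : Type} [TopologicalSpace X] [CompactSpace X] [LocallyConnectedSpace X]
    {f : X → ℂ} (hf : Continuous f) : SmallCover (range f) := by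
  intro d hd
  have h1 : ∀ x : X, ∃ V : Set X, V ⊆ f ⁻¹' ball (f x) d ∧ IsOpen V ∧ x ∈ V ∧ IsConnected V :=
    fun x => locallyConnectedSpace_iff_subsets_isOpen_isConnected.1 inferInstance x _
      (hf.continuousAt.preimage_mem_nhds (ball_mem_nhds _ hd))
  choose V hV hVo hxV hVc using h1
  obtain ⟨t, ht⟩ := isCompact_univ.elim_finite_subcover V hVo
    (fun x _ => mem_iUnion.2 ⟨x, hxV x⟩)
  refine ⟨t, inferInstance, fun x => f '' closure (V x), fun x => ⟨?_, ?_, f x, ?_⟩, ?_⟩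
  · exact isClosed_closure.isCompact.image hf
  · exact (hVc x).closure.image _ hf.continuousOn
  · rw [image_subset_iff]
    exact closure_minimal ((hV x).trans (preimage_mono ball_subset_closedBall))
      (isClosed_closedBall.preimage hf)
  · apply Subset.antisymm
    · exact iUnion_subset fun x => image_subset_range _ _
    · rintro _ ⟨y, rfl⟩
      obtain ⟨x, hx, hy⟩ := mem_iUnion₂.1 (ht (mem_univ y))
      exact mem_iUnion.2 ⟨⟨x, hx⟩, mem_image_of_mem _ (subset_closure hy)⟩

lemma smallCover_of_locallyConnected {P : Set ℂ} (hP : IsCompact P) (h : LocallyConnectedSpace P) :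
    SmallCover P := by
  have := isCompact_iff_compactSpace.1 hP
  simpa using smallCover_range (X := P) continuous_subtype_val

lemma smallCover_sphere (z : ℂ) {ε : ℝ} (hε : 0 < ε) : SmallCover (sphere z ε) := by
  have : LocallyConnectedSpace Circle :=
    ChartedSpace.locallyConnectedSpace (EuclideanSpace ℝ (Fin 1)) Circle
  have h2 := smallCover_range (X := Circle) (f := fun t => z + ε * (t : ℂ)) (by fun_prop)
  convert h2 using 1
  apply Subset.antisymm
  · intro w hw
    have hε' : (ε : ℂ) ≠ 0 := by exact_mod_cast hε.ne'
    refine ⟨⟨(w - z) / ε, ?_⟩, ?_⟩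
    · rw [mem_sphere, dist_eq_norm] at hw
      simp [Submonoid.unitSphere, hw, abs_of_pos hε, hε.ne']
    · simp only
      field_simp
      ring
  · rintro _ ⟨t, rfl⟩
    simp [abs_of_pos hε, Circle.norm_coe]

/-- Finiteness of big complementary components of a set with property S. -/
lemma finite_big {M : Set ℂ} (hS : SmallCover M) {d : ℝ} (hd : 0 < d)
    {U : ℕ → Set ℂ} {x y : ℕ → ℂ} (hUo : ∀ i, IsOpen (U i)) (hUb : ∀ i, Bornology.IsBounded (U i))
    (hUf : ∀ i, frontier (U i) ⊆ M) (hUM : ∀ i, Disjoint (U i) M) (hx : ∀ i, x i ∈ U i)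
    (hy : ∀ i, y i ∈ U i) (hUc : ∀ i, IsPreconnected (U i)) (hxy : ∀ i, d ≤ dist (x i) (y i))
    (hdisj : ∀ i j, i ≠ j → Disjoint (U i) (U j)) : False := by
  classical
  obtain ⟨ι, _, K, hK, hKM⟩ := hS (d / 10) (by positivity)
  have hM : IsClosed M := by
    rw [← hKM]
    exact isClosed_iUnion_of_finite fun i => (hK i).1.isClosed
  have hKsub : ∀ i, K i ⊆ M := fun i => hKM ▸ subset_iUnion K i
  have hlog : ∀ (n : ℕ) (L : Set ℂ) (c : ℂ), IsCompact L → L ⊆ M → L ⊆ closedBall c (3 * d / 10) →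
      HasLog L (x n) := by
    intro n L c hL hLM hLc
    have hdis : Disjoint (U n) L := (hUM n).mono_right hLM
    by_cases h1 : 3 * d / 10 < dist (x n) c
    · exact hasLog_of_far (by positivity) hLc h1
    · have h2 : 3 * d / 10 < dist (y n) c := by
        have := dist_triangle_right (x n) (y n) c
        have := hxy n
        linarith
      exact hasLog_transfer hL (hUc n) hdis (hx n) (hy n) (hasLog_of_far (by positivity) hLc h2)
  have hf : ∀ n i, HasLog (K i) (x n) := fun n i => by
    obtain ⟨h1, h2, c, h3⟩ := hK i
    exact hlog n _ c h1 (hKsub i) (h3.trans (closedBall_subset_closedBall (by linarith)))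
  choose f hfc hfe using hf
  have hc : ∀ n (p : ι × ι), ∃ m : ℤ, ∀ w ∈ K p.1 ∩ K p.2,
      f n p.1 w - f n p.2 w = m * (2 * Real.pi * Complex.I) := by
    rintro n ⟨i, j⟩
    by_cases hne : (K i ∩ K j).Nonempty
    swap
    · exact ⟨0, fun w hw => absurd ⟨w, hw⟩ hne⟩
    obtain ⟨w₀, hw₀⟩ := hne
    obtain ⟨hi1, hi2, ci, hi3⟩ := hK i
    obtain ⟨hj1, hj2, cj, hj3⟩ := hK j
    obtain ⟨g, hgc, hge⟩ := hlog n (K i ∪ K j) w₀ (hi1.union hj1)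
      (union_subset (hKsub i) (hKsub j)) (by
        intro w hw
        rw [mem_closedBall]
        rcases hw with hw | hw
        · have h1 := hi3 hw
          have h2 := hi3 hw₀.1
          rw [mem_closedBall] at h1 h2
          have := dist_triangle_right w w₀ ci
          linarith
        · have h1 := hj3 hw
          have h2 := hj3 hw₀.2
          rw [mem_closedBall] at h1 h2
          have := dist_triangle_right w w₀ cj
          linarith)
    have hone : ∀ l, K l ⊆ K i ∪ K j → ∃ m : ℤ, ∀ w ∈ K l,
        f n l w - g w = m * (2 * Real.pi * Complex.I) := by
      intro l hl
      refine const_of_exp_eq_one (hK l).2.1.isPreconnected ((hfc n l).sub (hgc.mono hl)) ?_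
      intro w hw
      have : w - x n ≠ 0 := by rw [← hfe n l w hw]; exact Complex.exp_ne_zero _
      rw [Complex.exp_sub, hfe n l w hw, hge w (hl hw), div_self this]
    obtain ⟨a, ha⟩ := hone i subset_union_left
    obtain ⟨b, hb⟩ := hone j subset_union_right
    refine ⟨a - b, fun w hw => ?_⟩
    have h1 := ha w hw.1
    have h2 := hb w hw.2
    push_cast
    linear_combination h1 - h2
  choose c hc using hc
  let N := Fintype.card (ι × ι) + 1
  have hdep : ¬ LinearIndependent ℤ (fun n : Fin N => c n) := by
    intro h
    have := h.fintype_card_le_finrank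
    rw [Module.finrank_fintype_fun_eq_card, Fintype.card_fin] at this
    omega
  obtain ⟨k, hk, n₀, hn₀⟩ := Fintype.not_linearIndependent_iff.1 hdep
  let T : ι → ℂ → ℂ := fun i w => ∑ n : Fin N, k n * f n i w
  have hT : ∀ i j, ∀ w ∈ K i ∩ K j, T i w = T j w := by
    intro i j w hw
    rw [← sub_eq_zero]
    simp only [T]
    rw [← Finset.sum_sub_distrib]
    have h1 := congrFun hk (i, j)
    simp only [Finset.sum_apply, Pi.smul_apply, smul_eq_mul, Pi.zero_apply] at h1
    have h2 : ((∑ n : Fin N, k n * c n (i, j) : ℤ) : ℂ) = 0 := by rw [h1]; simp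
    calc _ = ∑ n : Fin N, ((k n : ℂ) * c n (i, j)) * (2 * Real.pi * Complex.I) := by
          refine Finset.sum_congr rfl fun n _ => ?_
          rw [← mul_sub, hc n (i, j) w hw]; ring
      _ = 0 := by
          rw [← Finset.sum_mul]
          push_cast at h2
          rw [h2, zero_mul]
  let F : ℂ → ℂ := fun w => if h : ∃ i, w ∈ K i then T h.choose w else 0
  have hF : ∀ i, ∀ w ∈ K i, F w = T i w := by
    intro i w hw
    have h : ∃ i, w ∈ K i := ⟨i, hw⟩
    simp only [F, dif_pos h]
    exact hT _ _ w ⟨h.choose_spec, hw⟩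
  have hFc : ContinuousOn F M := by
    rw [← hKM]
    refine (locallyFinite_of_finite K).continuousOn_iUnion (fun i => (hK i).1.isClosed) fun i => ?_
    refine ContinuousOn.congr ?_ (hF i)
    exact continuousOn_finsetSum _ fun n _ => continuousOn_const.mul (hfc n i)
  refine hn₀ (no_log (ι := Fin N) (M := M) hM (U := fun n => U n) (x := fun n => x n)
    (fun i => hUo i) (fun i => hUb i) (fun i => hUf i) (fun i => hUM i) (fun i => hx i)
    (fun i j hij => hdisj i j (fun h => hij (Fin.ext h))) hFc (k := k) ?_ n₀)
  intro w hw
  rw [← hKM] at hw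
  obtain ⟨i, hi⟩ := mem_iUnion.1 hw
  rw [hF i w hi, Complex.exp_sum]
  refine Finset.prod_congr rfl fun n _ => ?_
  rw [Complex.exp_int_mul, hfe n i w hi]

end PeanoAcc
open Set Metric Topology

namespace PeanoAcc

lemma mem_comp_of_mem_closure {O : Set ℂ} (hO : IsOpen O) {x y : ℂ}
    (hy : y ∈ closure (connectedComponentIn O x)) (hyO : y ∈ O) : y ∈ connectedComponentIn O x := by
  have h1 : connectedComponentIn O y ∈ 𝓝 y :=
    (hO.connectedComponentIn).mem_nhds (mem_connectedComponentIn hyO)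
  obtain ⟨w, hw1, hw2⟩ := mem_closure_iff_nhds.1 hy _ h1
  rw [connectedComponentIn_eq hw2, ← connectedComponentIn_eq hw1]
  exact mem_connectedComponentIn hyO

lemma comp_eq_of_meet {O : Set ℂ} {x y w : ℂ} (h1 : w ∈ connectedComponentIn O x)
    (h2 : w ∈ connectedComponentIn O y) : connectedComponentIn O x = connectedComponentIn O y := by
  rw [connectedComponentIn_eq h1, connectedComponentIn_eq h2]

lemma local_finite {P V : Set ℂ} (hP : SmallCover P) (hVo : IsOpen V) (hVc : IsConnected V)
    (hVP : closure V \ V ⊆ P) (hdis : Disjoint V P) (z : ℂ) {δ ε : ℝ} (hδ : 0 < δ) (hε : δ < ε) :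
    {C | ∃ x ∈ V ∩ ball z δ, C = connectedComponentIn (V ∩ ball z ε) x}.Finite := by
  set O := V ∩ ball z ε with hOdef
  have hO : IsOpen O := hVo.inter isOpen_ball
  by_contra hinf
  have hinf : Set.Infinite _ := hinf
  let e := hinf.natEmbedding
  have he : ∀ n, ∃ x ∈ V ∩ ball z δ, (e n : Set ℂ) = connectedComponentIn O x := fun n => (e n).2
  choose x hx hex using he
  have hxO : ∀ n, x n ∈ O := fun n => ⟨(hx n).1, ball_subset_ball hε.le (hx n).2⟩
  have hdisj : ∀ i j, i ≠ j → Disjoint (connectedComponentIn O (x i)) (connectedComponentIn O (x j)) := by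
    intro i j hij
    rw [Set.disjoint_left]
    intro w h1 h2
    have := comp_eq_of_meet h1 h2
    rw [← hex, ← hex] at this
    exact hij (e.injective (Subtype.ext this))
  have hy : ∀ n, ∃ y ∈ connectedComponentIn O (x n), (ε - δ) / 2 ≤ dist (x n) y := by
    intro n
    by_contra hcon
    push Not at hcon
    -- then the component is all of V
    have hall : V ⊆ connectedComponentIn O (x n) := by
      refine hVc.isPreconnected.subset_of_closure_inter_subset hO.connectedComponentIn
        ⟨x n, (hx n).1, mem_connectedComponentIn (hxO n)⟩ ?_
      rintro w ⟨hw, hwV⟩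
      refine mem_comp_of_mem_closure hO hw ⟨hwV, ?_⟩
      have h1 : w ∈ closedBall (x n) ((ε - δ) / 2) := by
        refine closure_minimal ?_ isClosed_closedBall hw
        intro v hv
        rw [mem_closedBall, dist_comm]
        exact (hcon v hv).le
      have h2 := (hx n).2
      rw [mem_ball] at h2 ⊢
      rw [mem_closedBall] at h1
      have := dist_triangle w (x n) z
      linarith
    exact (hdisj n (n + 1) (by omega)).le_bot ⟨hall (hx (n + 1)).1, mem_connectedComponentIn (hxO _)⟩
  choose y hy hxy using hy
  refine finite_big (M := P ∪ sphere z ε) (hP.union (smallCover_sphere z (hδ.trans hε)))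
    (d := (ε - δ) / 2) (by linarith) (U := fun n => connectedComponentIn O (x n)) (x := x) (y := y)
    (fun n => hO.connectedComponentIn)
    (fun n => isBounded_ball.subset ((connectedComponentIn_subset O (x n)).trans inter_subset_right))
    ?_ ?_ (fun n => mem_connectedComponentIn (hxO n)) hy (fun n => isPreconnected_connectedComponentIn)
    hxy hdisj
  · intro n w hw
    have hsub := connectedComponentIn_subset O (x n)
    have hwO : w ∉ O := fun h => hw.2 (by
      rw [hO.connectedComponentIn.interior_eq]
      exact mem_comp_of_mem_closure hO hw.1 h)
    have h1 : w ∈ closure V := closure_mono (hsub.trans inter_subset_left) hw.1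
    have h2 : w ∈ closedBall z ε :=
      closure_minimal (hsub.trans (inter_subset_right.trans ball_subset_closedBall)) isClosed_closedBall hw.1
    by_cases hwV : w ∈ V
    · right
      have h3 : w ∉ ball z ε := fun h => hwO ⟨hwV, h⟩
      rw [mem_ball, not_lt] at h3
      exact le_antisymm h2 h3
    · exact Or.inl (hVP ⟨h1, hwV⟩)
  · intro n
    rw [Set.disjoint_left]
    intro w hw hw2
    have hwO := connectedComponentIn_subset _ _ hw
    rcases hw2 with h | h
    · exact hdis.le_bot ⟨hwO.1, h⟩
    · have h3 := hwO.2
      rw [mem_ball] at h3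
      rw [mem_sphere] at h
      linarith

lemma exists_next {P V : Set ℂ} (hP : SmallCover P) (hVo : IsOpen V) (hVc : IsConnected V)
    (hVP : closure V \ V ⊆ P) (hdis : Disjoint V P) (z : ℂ) {C : Set ℂ} {s : ℝ} (hs : 0 < s)
    (hCV : C ⊆ V) (hCabs : ∀ D, IsPreconnected D → D ⊆ V ∩ ball z s → (D ∩ C).Nonempty → D ⊆ C) (hz : z ∈ closure C) :
    ∃ x ∈ V ∩ ball z s, connectedComponentIn (V ∩ ball z s) x ⊆ C ∧
      z ∈ closure (connectedComponentIn (V ∩ ball z s) x) := by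
  have hfin := local_finite hP hVo hVc hVP hdis z (half_pos hs) (half_lt_self hs)
  set 𝓕 := {D | ∃ x ∈ V ∩ ball z (s / 2), D = connectedComponentIn (V ∩ ball z s) x} with h𝓕
  have hfin2 : (𝓕 ∩ {D | (D ∩ C).Nonempty}).Finite := hfin.subset inter_subset_left
  have h1 : z ∈ closure (⋃₀ (𝓕 ∩ {D | (D ∩ C).Nonempty})) := by
    have h2 : z ∈ closure (ball z (s / 2) ∩ C) :=
      isOpen_ball.inter_closure ⟨mem_ball_self (half_pos hs), hz⟩
    refine closure_mono ?_ h2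
    rintro w ⟨hw1, hw2⟩
    have hwO : w ∈ V ∩ ball z s := ⟨hCV hw2, ball_subset_ball (by linarith) hw1⟩
    exact ⟨_, ⟨⟨w, ⟨hCV hw2, hw1⟩, rfl⟩, ⟨w, mem_connectedComponentIn hwO, hw2⟩⟩,
      mem_connectedComponentIn hwO⟩
  rw [hfin2.closure_sUnion] at h1
  obtain ⟨D, ⟨⟨x, hx, rfl⟩, ⟨w, hwD, hwC⟩⟩, hzD⟩ := mem_iUnion₂.1 h1
  refine ⟨x, ⟨hx.1, ball_subset_ball (by linarith) hx.2⟩, ?_, hzD⟩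
  exact hCabs _ isPreconnected_connectedComponentIn (connectedComponentIn_subset _ _) ⟨w, hwD, hwC⟩

/-- Infinite concatenation of paths. -/
lemma joined_of_seq {V : Set ℂ} {z : ℂ} {D : ℕ → Set ℂ} (hDV : ∀ n, D n ⊆ V)
    (hDz : ∀ ε > 0, ∃ N, ∀ n ≥ N, D n ⊆ ball z ε) {x : ℕ → ℂ}
    (hj : ∀ n, JoinedIn (D n) (x n) (x (n + 1))) : JoinedIn (insert z V) (x 0) z := by
  choose p hp using hj
  let q : ℕ → ℝ → ℂ := fun n t => (p n).extend (t - n)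
  have hqD : ∀ n t, q n t ∈ D n := by
    intro n t
    simp only [q, Path.extend, IccExtend]
    exact hp n _
  have hqc : ∀ n, Continuous (q n) := fun n => (p n).continuous_extend.comp (by fun_prop)
  let G : ℝ → ℂ := fun t => q ⌊t⌋₊ t
  have hG : ∀ n : ℕ, ∀ t ∈ Icc (n:ℝ) (n + 1), G t = q n t := by
    rintro n t ⟨h1, h2⟩
    rcases h2.lt_or_eq with h2 | rfl
    · have : ⌊t⌋₊ = n := by
        rw [Nat.floor_eq_iff (le_trans (Nat.cast_nonneg _) h1)]
        exact ⟨h1, h2⟩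
      simp only [G, this]
    · have : ⌊(n:ℝ) + 1⌋₊ = n + 1 := by exact_mod_cast Nat.floor_natCast (R := ℝ) (n + 1)
      simp only [G, this, q]
      simp
      rw [this]
  have hGc : ContinuousOn G (Ici 0) := by
    have hU : Ici (0:ℝ) ⊆ ⋃ n : ℕ, Icc (n:ℝ) (n + 1) := by
      intro t ht
      exact mem_iUnion.2 ⟨⌊t⌋₊, Nat.floor_le ht, (Nat.lt_floor_add_one t).le⟩
    refine ContinuousOn.mono ?_ hU
    refine LocallyFinite.continuousOn_iUnion ?_ (fun n => isClosed_Icc) ?_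
    · intro t
      refine ⟨Iio (t + 1), Iio_mem_nhds (by linarith), ?_⟩
      refine (Set.finite_Iic ⌈t + 1⌉₊).subset ?_
      rintro n ⟨w, hw1, hw2⟩
      have : (n:ℝ) ≤ ⌈t + 1⌉₊ := (hw1.1.trans (le_of_lt hw2)).trans (Nat.le_ceil _)
      exact_mod_cast this
    · intro n
      exact (hqc n).continuousOn.congr (hG n)
  let h : ℝ → ℂ := fun s => if s < 1 then G (s / (1 - s)) else z
  have hh : ∀ s, s < 1 → h s = G (s / (1 - s)) := fun s hs => if_pos hs
  refine JoinedIn.ofLine (f := h) ?_ ?_ ?_ ?_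
  · rintro s ⟨hs0, hs1⟩
    rcases hs1.lt_or_eq with hs1 | rfl
    · have hc : ContinuousOn (fun s : ℝ => G (s / (1 - s))) (Ico 0 1) := by
        refine hGc.comp (ContinuousOn.div (by fun_prop) (by fun_prop) ?_) ?_
        · intro s hs; have := hs.2; linarith
        · intro s hs
          have := hs.2
          exact div_nonneg hs.1 (by linarith)
      have h1 : ContinuousWithinAt h (Ico 0 1) s :=
        (hc s ⟨hs0, hs1⟩).congr (fun t ht => hh t ht.2) (hh s hs1)
      refine h1.mono_of_mem_nhdsWithin ?_
      rw [mem_nhdsWithin]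
      exact ⟨Iio 1, isOpen_Iio, hs1, fun t ht => ⟨ht.2.1, ht.1⟩⟩
    · rw [Metric.continuousWithinAt_iff]
      intro ε hε
      obtain ⟨N, hN⟩ := hDz ε hε
      have h1z : h 1 = z := if_neg (lt_irrefl _)
      refine ⟨1 / (N + 1), by positivity, fun s hs hsd => ?_⟩
      rw [h1z]
      rcases hs.2.lt_or_eq with hs1 | rfl
      · rw [hh s hs1]
        refine hN ⌊s / (1 - s)⌋₊ ?_ (hqD _ _)
        apply Nat.le_floor
        rw [le_div_iff₀ (by linarith)]
        rw [Real.dist_eq, abs_sub_comm, abs_of_pos (by linarith), lt_div_iff₀ (by positivity)] at hsd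
        linarith
      · rwa [h1z, dist_self]
  · rw [hh 0 one_pos]
    simp [G, q]
  · exact if_neg (lt_irrefl _)
  · rintro _ ⟨s, hs, rfl⟩
    by_cases hs1 : s < 1
    · rw [hh s hs1]
      exact Or.inr (hDV _ (hqD _ _))
    · exact Or.inl (if_neg hs1)

lemma accessible {P V : Set ℂ} (hP : SmallCover P) (hVo : IsOpen V) (hVc : IsConnected V)
    (hVP : closure V \ V ⊆ P) (hdis : Disjoint V P) {z : ℂ} (hz : z ∈ closure V) :
    ∃ x ∈ V, JoinedIn (insert z V) x z := by
  let r : ℕ → ℝ := fun n => 1 / ((n:ℝ) + 1)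
  have hr : ∀ n, 0 < r n := fun n => by positivity
  have hrm : ∀ n, r (n + 1) ≤ r n := fun n => by
    simp only [r]
    push_cast
    apply one_div_le_one_div_of_le <;> linarith [Nat.cast_nonneg (α := ℝ) n]
  let Cc : ℕ → ℂ → Set ℂ := fun n x => connectedComponentIn (V ∩ ball z (r n)) x
  let Q : ℕ → ℂ → Prop := fun n x => x ∈ V ∩ ball z (r n) ∧ z ∈ closure (Cc n x)
  have hstep : ∀ n x, Q n x → ∃ y, Q (n + 1) y ∧ Cc (n + 1) y ⊆ Cc n x := by
    rintro n x ⟨h1, h2⟩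
    obtain ⟨y, hy, hyC, hyz⟩ := exists_next hP hVo hVc hVP hdis z (hr (n + 1))
      (C := Cc n x) ((connectedComponentIn_subset _ _).trans inter_subset_left) (by
        rintro D hD hDs ⟨w, hwD, hwC⟩
        simp only [Cc] at hwC ⊢
        rw [connectedComponentIn_eq hwC]
        exact hD.subset_connectedComponentIn hwD
          (hDs.trans (inter_subset_inter_right _ (ball_subset_ball (hrm n))))) h2
    exact ⟨y, ⟨hy, hyz⟩, hyC⟩
  have hbase : ∃ x, Q 0 x := by
    obtain ⟨y, hy, -, hyz⟩ := exists_next hP hVo hVc hVP hdis z (hr 0) subset_rfl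
      (fun D _ hD _ => hD.trans inter_subset_left) hz
    exact ⟨y, hy, hyz⟩
  obtain ⟨x₀, hx₀⟩ := hbase
  choose! F hF1 hF2 using hstep
  let x : ℕ → ℂ := fun n => Nat.rec x₀ (fun n y => F n y) n
  have hxQ : ∀ n, Q n (x n) := by
    intro n
    induction n with
    | zero => exact hx₀
    | succ n ih => exact hF1 n _ ih
  have hxs : ∀ n, Cc (n + 1) (x (n + 1)) ⊆ Cc n (x n) := fun n => hF2 n _ (hxQ n)
  refine ⟨x 0, (hxQ 0).1.1, joined_of_seq (D := fun n => Cc n (x n)) ?_ ?_ ?_⟩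
  · exact fun n => (connectedComponentIn_subset _ _).trans inter_subset_left
  · intro ε hε
    obtain ⟨N, hN⟩ := exists_nat_one_div_lt hε
    refine ⟨N, fun n hn => ((connectedComponentIn_subset _ _).trans inter_subset_right).trans
      (ball_subset_ball ?_)⟩
    refine le_trans ?_ hN.le
    apply one_div_le_one_div_of_le (by positivity)
    have : (N:ℝ) ≤ n := by exact_mod_cast hn
    linarith
  · intro n
    have hpc : IsPathConnected (Cc n (x n)) :=
      (((hVo.inter isOpen_ball).connectedComponentIn).isConnected_iff_isPathConnected).1
        (isConnected_connectedComponentIn_iff.2 (hxQ n).1)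
    exact hpc.joinedIn _ (mem_connectedComponentIn (hxQ n).1) _
      (hxs n (mem_connectedComponentIn (hxQ (n + 1)).1))

end PeanoAcc
open Set Metric Topology

namespace PeanoAcc

lemma exists_gap {A : Set ℝ} (hA : IsClosed A) {a b m : ℝ} (ha : a ∈ A) (hb : b ∈ A)
    (ham : a ≤ m) (hmb : m ≤ b) :
    ∃ p ∈ A, ∃ q ∈ A, p ≤ m ∧ m ≤ q ∧ a ≤ p ∧ q ≤ b ∧ (∀ u ∈ A, u ≤ m → u ≤ p) ∧
      (∀ u ∈ A, m ≤ u → q ≤ u) := by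
  have h1 : IsCompact (A ∩ Icc a m) := isCompact_Icc.inter_left hA
  have h2 : IsCompact (A ∩ Icc m b) := isCompact_Icc.inter_left hA
  obtain ⟨p, ⟨hpA, hp1, hp2⟩, hp⟩ := h1.exists_isGreatest ⟨a, ha, le_rfl, ham⟩
  obtain ⟨q, ⟨hqA, hq1, hq2⟩, hq⟩ := h2.exists_isLeast ⟨b, hb, hmb, le_rfl⟩
  refine ⟨p, hpA, q, hqA, hp2, hq1, hp1, hq2, fun u hu hum => ?_, fun u hu hum => ?_⟩
  · by_cases h : a ≤ u
    · exact hp ⟨hu, h, hum⟩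
    · linarith
  · by_cases h : u ≤ b
    · exact hq ⟨hu, hum, h⟩
    · linarith

/-- Closed subsets of `[0,1]` all of whose gaps are loops of `γ`. -/
def LoopSet (γ : ℝ → ℂ) : Set (Set ℝ) :=
  {A | IsClosed A ∧ (0:ℝ) ∈ A ∧ (1:ℝ) ∈ A ∧ A ⊆ Icc 0 1 ∧
    ∀ a ∈ A, ∀ b ∈ A, a < b → (∀ u ∈ A, ¬ (a < u ∧ u < b)) → γ a = γ b}

lemma exists_minimal_loopSet {γ : ℝ → ℂ} (hγ : Continuous γ) :
    ∃ A, Minimal (· ∈ LoopSet γ) A := by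
  refine zorn_superset _ fun c hc hchain => ?_
  rcases c.eq_empty_or_nonempty with rfl | hne
  · refine ⟨Icc 0 1, ⟨isClosed_Icc, by simp, by simp, subset_rfl, ?_⟩, by simp⟩
    intro a ha b hb hab h
    exact absurd ⟨by linarith, by linarith⟩ (h ((a + b) / 2) ⟨by linarith [ha.1, hb.1], by linarith [ha.2, hb.2]⟩)
  refine ⟨⋂₀ c, ⟨isClosed_sInter fun A hA => (hc hA).1, fun A hA => (hc hA).2.1,
    fun A hA => (hc hA).2.2.1, ?_, ?_⟩, fun s hs => sInter_subset_of_mem hs⟩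
  · obtain ⟨A, hA⟩ := hne
    exact (sInter_subset_of_mem hA).trans (hc hA).2.2.2.1
  intro a ha b hb hab hgap
  refine eq_of_forall_dist_le fun ε hε => ?_
  obtain ⟨δ₁, hδ₁, h1⟩ := Metric.continuous_iff.1 hγ a (ε / 2) (half_pos hε)
  obtain ⟨δ₂, hδ₂, h2⟩ := Metric.continuous_iff.1 hγ b (ε / 2) (half_pos hε)
  obtain ⟨δ, hδ, hd1, hd2, hd3⟩ : ∃ δ > 0, δ ≤ δ₁ ∧ δ ≤ δ₂ ∧ δ ≤ (b - a) / 2 :=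
    ⟨min δ₁ (min δ₂ ((b - a) / 2)), by
      refine lt_min hδ₁ (lt_min hδ₂ ?_); linarith, by simp, by simp, by simp⟩
  have : Nonempty c := hne.to_subtype
  obtain ⟨⟨A, hA⟩, hAe⟩ := (isCompact_Icc (a := a + δ) (b := b - δ)).elim_directed_family_closed
    (fun A : c => (A : Set ℝ)) (fun A => (hc A.2).1) (by
      rw [← sInter_eq_iInter]
      ext u
      simp only [mem_inter_iff, mem_empty_iff_false, iff_false, not_and]
      intro hu huc
      exact hgap u huc ⟨by linarith [hu.1], by linarith [hu.2]⟩) (by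
      intro A B
      rcases hchain.total A.2 B.2 with h | h
      · exact ⟨A, subset_rfl, h⟩
      · exact ⟨B, h, subset_rfl⟩)
  have hAe' : ∀ u ∈ A, ¬ (a + δ ≤ u ∧ u ≤ b - δ) := fun u hu h => by
    have : u ∈ Icc (a + δ) (b - δ) ∩ A := ⟨h, hu⟩
    rw [hAe] at this
    exact this
  obtain ⟨p, hpA, q, hqA, hpm, hmq, hap, hqb, hp, hq⟩ := exists_gap (hc hA).1 (ha A hA) (hb A hA)
    (m := (a + b) / 2) (by linarith) (by linarith)
  have hpa : p < a + δ := by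
    by_contra h
    exact hAe' p hpA ⟨by linarith, by linarith⟩
  have hqb' : b - δ < q := by
    by_contra h
    exact hAe' q hqA ⟨by linarith, by linarith⟩
  have hpq : γ p = γ q := by
    refine (hc hA).2.2.2.2 p hpA q hqA (by linarith) fun u hu huu => ?_
    rcases le_total u ((a + b) / 2) with h | h
    · linarith [hp u hu h, huu.1]
    · linarith [hq u hu h, huu.2]
  have e1 := h1 p (by rw [Real.dist_eq, abs_of_nonneg (by linarith)]; linarith)
  have e2 := h2 q (by rw [Real.dist_eq, abs_sub_comm, abs_of_nonneg (by linarith)]; linarith)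
  rw [hpq] at e1
  have := dist_triangle_left (γ a) (γ b) (γ q)
  linarith

/-- Every path can be replaced by a monotone path in its image. -/
lemma exists_monotone_path {γ : ℝ → ℂ} (hγ : Continuous γ) :
    ∃ η : ℝ → ℂ, ContinuousOn η (Icc 0 1) ∧ η 0 = γ 0 ∧ η 1 = γ 1 ∧
      η '' Icc 0 1 ⊆ γ '' Icc 0 1 ∧
      ∀ s ∈ Icc (0:ℝ) 1, ∀ t ∈ Icc (0:ℝ) 1, s ≤ t → η s = η t → ∀ u ∈ Icc s t, η u = η s := by
  obtain ⟨A, ⟨hAc, h0, h1, hA01, hgap⟩, hmin⟩ := exists_minimal_loopSet hγ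
  have hloop : ∀ a ∈ A, ∀ b ∈ A, a < b → γ a = γ b → ∀ u ∈ A, ¬ (a < u ∧ u < b) := by
    intro a ha b hb hab hγab u hu huab
    have hmem : A \ Ioo a b ∈ LoopSet γ := by
      refine ⟨hAc.sdiff isOpen_Ioo, ⟨h0, fun h => ?_⟩, ⟨h1, fun h => ?_⟩, diff_subset.trans hA01, ?_⟩
      · linarith [h.1, (hA01 ha).1]
      · linarith [h.2, (hA01 hb).2]
      · intro c hc d hd hcd hcd'
        have haA : a ∈ A \ Ioo a b := ⟨ha, by simp⟩
        have hbA : b ∈ A \ Ioo a b := ⟨hb, by simp⟩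
        have hc' : c ≤ a ∨ b ≤ c := by
          by_contra h
          push Not at h
          exact hc.2 h
        have hd' : d ≤ a ∨ b ≤ d := by
          by_contra h
          push Not at h
          exact hd.2 h
        by_cases hcase : c ≤ a ∧ b ≤ d
        · have e1 : c = a := by
            by_contra h
            exact hcd' a haA ⟨lt_of_le_of_ne hcase.1 h, by linarith⟩
          have e2 : d = b := by
            by_contra h
            exact hcd' b hbA ⟨by linarith, lt_of_le_of_ne hcase.2 (Ne.symm h)⟩
          rw [e1, e2, hγab]
        · refine hgap c hc.1 d hd.1 hcd fun v hv hvv => hcd' v ⟨hv, fun hvab => hcase ?_⟩ hvv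
          constructor
          · rcases hc' with h | h
            · exact h
            · linarith [hvab.2, hvv.1]
          · rcases hd' with h | h
            · linarith [hvab.1, hvv.2]
            · exact h
    exact (hmin hmem diff_subset hu).2 huab
  have hr : ∀ t : ℝ, ∃ p, t ∈ Icc (0:ℝ) 1 → p ∈ A ∧ p ≤ t ∧ ∀ u ∈ A, u ≤ t → u ≤ p := by
    intro t
    by_cases ht : t ∈ Icc (0:ℝ) 1
    · obtain ⟨p, hpA, q, -, hp1, -, -, -, hp2, -⟩ := exists_gap hAc h0 h1 ht.1 ht.2
      exact ⟨p, fun _ => ⟨hpA, hp1, hp2⟩⟩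
    · exact ⟨0, fun h => absurd h ht⟩
  choose r hr using hr
  have hrA : ∀ t ∈ A, r t = t := fun t ht =>
    le_antisymm (hr t (hA01 ht)).2.1 ((hr t (hA01 ht)).2.2 t ht le_rfl)
  have hdich : ∀ s ∈ Icc (0:ℝ) 1, ∀ t ∈ Icc (0:ℝ) 1, s ≤ t →
      r s = r t ∨ ∃ p ∈ Icc s t, γ (r s) = γ p ∧ r t ∈ Icc s t := by
    intro s hs t ht hst
    obtain ⟨hs1, hs2, hs3⟩ := hr s hs
    obtain ⟨ht1, ht2, ht3⟩ := hr t ht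
    by_cases h : r t < s
    · left
      exact le_antisymm (ht3 _ hs1 (hs2.trans hst)) (hs3 _ ht1 h.le)
    · right
      push Not at h
      obtain ⟨-, -, p, hpA, -, hsp, -, hp2, -, hp⟩ := exists_gap hAc h0 ht1 hs.1 h
      refine ⟨p, ⟨hsp, hp2.trans ht2⟩, ?_, h, ht2⟩
      rcases hsp.lt_or_eq with hlt | heq
      · refine hgap _ hs1 _ hpA (by linarith) fun u hu huu => ?_
        rcases le_total u s with h' | h'
        · linarith [hs3 u hu h', huu.1]
        · linarith [hp u hu h', huu.2]
      · rw [← heq] at hpA ⊢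
        rw [hrA s hpA]
  refine ⟨fun t => γ (r t), ?_, ?_, ?_, ?_, ?_⟩
  · have huc : UniformContinuousOn γ (Icc 0 1) :=
      isCompact_Icc.uniformContinuousOn_of_continuous hγ.continuousOn
    refine UniformContinuousOn.continuousOn ?_
    rw [Metric.uniformContinuousOn_iff] at huc ⊢
    intro ε hε
    obtain ⟨δ, hδ, h⟩ := huc ε hε
    refine ⟨δ, hδ, ?_⟩
    have key : ∀ s ∈ Icc (0:ℝ) 1, ∀ t ∈ Icc (0:ℝ) 1, s ≤ t → dist s t < δ →
        dist (γ (r s)) (γ (r t)) < ε := by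
      intro s hs t ht hst hd
      rcases hdich s hs t ht hst with h1 | ⟨p, hp, h1, h2⟩
      · rwa [h1, dist_self]
      · rw [h1]
        refine h p ⟨hs.1.trans hp.1, hp.2.trans ht.2⟩ _ ⟨hs.1.trans h2.1, h2.2.trans ht.2⟩ ?_
        refine lt_of_le_of_lt ?_ hd
        exact Real.dist_le_of_mem_uIcc (by rwa [uIcc_of_le hst]) (by rwa [uIcc_of_le hst])
    intro s hs t ht hd
    rcases le_total s t with hst | hst
    · exact key s hs t ht hst hd
    · rw [dist_comm] at hd ⊢
      exact key t ht s hs hst hd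
  · simp only [hrA 0 h0]
  · simp only [hrA 1 h1]
  · rintro _ ⟨t, ht, rfl⟩
    exact ⟨r t, hA01 (hr t ht).1, rfl⟩
  · intro s hs t ht hst heq u hu
    simp only at heq ⊢
    have hu01 : u ∈ Icc (0:ℝ) 1 := ⟨hs.1.trans hu.1, hu.2.trans ht.2⟩
    obtain ⟨hs1, hs2, hs3⟩ := hr s hs
    obtain ⟨ht1, ht2, ht3⟩ := hr t ht
    obtain ⟨hu1, hu2, hu3⟩ := hr u hu01
    have a1 : r s ≤ r u := hu3 _ hs1 (hs2.trans hu.1)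
    have a2 : r u ≤ r t := ht3 _ hu1 (hu2.trans hu.2)
    rcases a1.lt_or_eq with a1 | a1
    · rcases a2.lt_or_eq with a2 | a2
      · exact absurd ⟨a1, a2⟩ (hloop _ hs1 _ ht1 (a1.trans a2) heq _ hu1)
      · rw [a2, heq]
    · rw [a1]

end PeanoAcc
open Set Metric Topology

namespace PeanoAcc

/-- Parametrization of a monotone path as an arc. -/
lemma exists_gauge {η : ℝ → ℂ} (hη : ContinuousOn η (Icc 0 1))
    (hmono : ∀ s ∈ Icc (0:ℝ) 1, ∀ t ∈ Icc (0:ℝ) 1, s ≤ t → η s = η t → ∀ u ∈ Icc s t, η u = η s) :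
    ∃ φ : ℝ → ℝ, ContinuousOn φ (Icc 0 1) ∧
      (∀ s ∈ Icc (0:ℝ) 1, ∀ t ∈ Icc (0:ℝ) 1, s ≤ t → η s = η t → φ s = φ t) ∧
      (∀ s ∈ Icc (0:ℝ) 1, ∀ t ∈ Icc (0:ℝ) 1, s ≤ t → η s ≠ η t → φ s < φ t) := by
  let D : ℝ → ℝ → ℝ := fun t u => infDist (η u) (η '' Icc 0 t)
  have hDc : ∀ t, ContinuousOn (D t) (Icc 0 1) := fun t =>
    (continuous_infDist_pt _).comp_continuousOn hη
  have hDi : ∀ t, IntervalIntegrable (D t) MeasureTheory.volume 0 1 := fun t =>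
    ContinuousOn.intervalIntegrable (by rw [uIcc_of_le zero_le_one]; exact hDc t)
  have hne : ∀ t ∈ Icc (0:ℝ) 1, (η '' Icc 0 t).Nonempty := fun t ht =>
    ⟨η 0, mem_image_of_mem _ ⟨le_rfl, ht.1⟩⟩
  have hanti : ∀ s ∈ Icc (0:ℝ) 1, ∀ t ∈ Icc (0:ℝ) 1, s ≤ t → ∀ u, D t u ≤ D s u :=
    fun s hs t ht hst u => infDist_le_infDist_of_subset (image_mono (Icc_subset_Icc_right hst)) (hne s hs)
  refine ⟨fun t => - ∫ u in (0:ℝ)..1, D t u, ?_, ?_, ?_⟩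
  · have huc := isCompact_Icc.uniformContinuousOn_of_continuous hη
    refine ContinuousOn.neg ?_
    refine UniformContinuousOn.continuousOn ?_
    rw [Metric.uniformContinuousOn_iff] at huc ⊢
    intro ε hε
    obtain ⟨δ, hδ, h⟩ := huc (ε / 2) (half_pos hε)
    refine ⟨δ, hδ, ?_⟩
    have key : ∀ s ∈ Icc (0:ℝ) 1, ∀ t ∈ Icc (0:ℝ) 1, s ≤ t → dist s t < δ →
        dist (∫ u in (0:ℝ)..1, D s u) (∫ u in (0:ℝ)..1, D t u) < ε := by
      intro s hs t ht hst hd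
      have hle : ∀ u, D s u ≤ D t u + ε / 2 := by
        intro u
        have : D s u - ε / 2 ≤ D t u := by
          refine (le_infDist (hne t ht)).2 ?_
          rintro _ ⟨v, hv, rfl⟩
          have hv01 : v ∈ Icc (0:ℝ) 1 := ⟨hv.1, hv.2.trans ht.2⟩
          have hm : min v s ∈ Icc (0:ℝ) s := ⟨le_min hv.1 hs.1, min_le_right _ _⟩
          have h1 : D s u ≤ dist (η u) (η (min v s)) := infDist_le_dist_of_mem (mem_image_of_mem _ hm)
          have h2 : dist (η (min v s)) (η v) < ε / 2 := by
            refine h _ ⟨hm.1, hm.2.trans hs.2⟩ v hv01 (lt_of_le_of_lt ?_ hd)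
            rw [Real.dist_eq, Real.dist_eq, abs_sub_comm, abs_sub_comm s t,
              abs_of_nonneg (by linarith [min_le_left v s]), abs_of_nonneg (by linarith)]
            rcases le_total v s with h' | h'
            · rw [min_eq_left h']; linarith
            · rw [min_eq_right h']; linarith [hv.2]
          have h3 := dist_triangle_right (η u) (η (min v s)) (η v)
          rw [dist_comm (η (min v s))] at h2
          have := dist_triangle (η u) (η v) (η (min v s))
          linarith
        linarith
      have i1 : ∫ u in (0:ℝ)..1, D t u ≤ ∫ u in (0:ℝ)..1, D s u :=
        intervalIntegral.integral_mono_on zero_le_one (hDi t) (hDi s) fun u _ => hanti s hs t ht hst u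
      have i2 : ∫ u in (0:ℝ)..1, D s u ≤ ∫ u in (0:ℝ)..1, (D t u + ε / 2) :=
        intervalIntegral.integral_mono_on zero_le_one (hDi s)
          ((hDi t).add intervalIntegrable_const) fun u _ => hle u
      rw [intervalIntegral.integral_add (hDi t) intervalIntegrable_const] at i2
      simp only [intervalIntegral.integral_const, sub_zero, one_smul] at i2
      rw [Real.dist_eq, abs_of_nonneg (by linarith)]
      linarith
    intro s hs t ht hd
    rcases le_total s t with hst | hst
    · exact key s hs t ht hst hd
    · rw [dist_comm] at hd ⊢
      exact key t ht s hs hst hd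
  · intro s hs t ht hst heq
    have : η '' Icc 0 s = η '' Icc 0 t := by
      apply Subset.antisymm (image_mono (Icc_subset_Icc_right hst))
      rintro _ ⟨v, hv, rfl⟩
      rcases le_total v s with h | h
      · exact mem_image_of_mem _ ⟨hv.1, h⟩
      · rw [hmono s hs t ht hst heq v ⟨h, hv.2⟩]
        exact mem_image_of_mem _ ⟨hs.1, le_rfl⟩
    simp only [D, this]
  · intro s hs t ht hst hne'
    have hnot : η t ∉ η '' Icc 0 s := by
      rintro ⟨v, hv, hvt⟩
      have hv01 : v ∈ Icc (0:ℝ) 1 := ⟨hv.1, hv.2.trans hs.2⟩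
      have := hmono v hv01 t ht (hv.2.trans hst) hvt s ⟨hv.2, hst⟩
      exact hne' (this.trans hvt)
    have hcpt : IsCompact (η '' Icc 0 s) :=
      isCompact_Icc.image_of_continuousOn (hη.mono (Icc_subset_Icc_right hs.2))
    have hpos : 0 < D s t := (hcpt.isClosed.notMem_iff_infDist_pos (hne s hs)).1 hnot
    have hzero : D t t = 0 := infDist_zero_of_mem (mem_image_of_mem _ ⟨ht.1, le_rfl⟩)
    refine neg_lt_neg ?_
    refine intervalIntegral.integral_lt_integral_of_continuousOn_of_le_of_exists_lt zero_lt_one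
      (hDc t) (hDc s) (fun u _ => hanti s hs t ht hst u) ⟨t, ht, ?_⟩
    rw [hzero]; exact hpos

lemma exists_arc {γ : ℝ → ℂ} (hγ : Continuous γ) (hne : γ 0 ≠ γ 1) :
    ∃ Γ : ℝ → ℂ, ContinuousOn Γ (Icc 0 1) ∧ InjOn Γ (Icc 0 1) ∧ Γ 0 = γ 0 ∧ Γ 1 = γ 1 ∧
      Γ '' Icc 0 1 ⊆ γ '' Icc 0 1 := by
  obtain ⟨η, hη, hη0, hη1, hsub, hmono⟩ := exists_monotone_path hγ
  obtain ⟨φ, hφ, hφ1, hφ2⟩ := exists_gauge hη hmono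
  have m0 : (0:ℝ) ∈ Icc (0:ℝ) 1 := by simp
  have m1 : (1:ℝ) ∈ Icc (0:ℝ) 1 := by simp
  have hiff : ∀ s ∈ Icc (0:ℝ) 1, ∀ t ∈ Icc (0:ℝ) 1, η s = η t ↔ φ s = φ t := by
    have key : ∀ s ∈ Icc (0:ℝ) 1, ∀ t ∈ Icc (0:ℝ) 1, s ≤ t → (η s = η t ↔ φ s = φ t) := by
      intro s hs t ht hst
      refine ⟨hφ1 s hs t ht hst, fun h => ?_⟩
      by_contra h'
      exact (hφ2 s hs t ht hst h').ne h
    intro s hs t ht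
    rcases le_total s t with h | h
    · exact key s hs t ht h
    · rw [eq_comm, key t ht s hs h, eq_comm]
  have hlt : φ 0 < φ 1 := hφ2 0 m0 1 m1 zero_le_one (by rwa [hη0, hη1])
  let ℓ : ℝ → ℝ := fun v => φ 0 + v * (φ 1 - φ 0)
  have hσ : ∀ v : ℝ, ∃ t, v ∈ Icc (0:ℝ) 1 → t ∈ Icc (0:ℝ) 1 ∧ φ t = ℓ v := by
    intro v
    by_cases hv : v ∈ Icc (0:ℝ) 1
    · have : ℓ v ∈ Icc (φ 0) (φ 1) := by
        simp only [ℓ]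
        constructor <;> nlinarith [hv.1, hv.2]
      obtain ⟨t, ht, h⟩ := intermediate_value_Icc zero_le_one hφ this
      exact ⟨t, fun _ => ⟨ht, h⟩⟩
    · exact ⟨0, fun h => absurd h hv⟩
  choose σ hσ using hσ
  refine ⟨fun v => η (σ v), ?_, ?_, ?_, ?_, ?_⟩
  · rw [continuousOn_iff_isClosed]
    intro F hF
    refine ⟨ℓ ⁻¹' (φ '' (Icc 0 1 ∩ η ⁻¹' F)), ?_, ?_⟩
    · have : IsCompact (Icc 0 1 ∩ η ⁻¹' F) :=
        isCompact_Icc.of_isClosed_subset (hη.preimage_isClosed_of_isClosed isClosed_Icc hF)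
          inter_subset_left
      have h2 := (this.image_of_continuousOn (hφ.mono inter_subset_left)).isClosed
      exact h2.preimage (by fun_prop)
    · ext v
      constructor
      · rintro ⟨h1, hv⟩
        exact ⟨⟨σ v, ⟨(hσ v hv).1, h1⟩, (hσ v hv).2⟩, hv⟩
      · rintro ⟨⟨t, ⟨ht, htF⟩, h⟩, hv⟩
        refine ⟨?_, hv⟩
        have : η (σ v) = η t := (hiff _ (hσ v hv).1 _ ht).2 ((hσ v hv).2.trans h.symm)
        simp only [mem_preimage, this]
        exact htF
  · intro v hv v' hv' h
    have h1 := (hiff _ (hσ v hv).1 _ (hσ v' hv').1).1 h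
    rw [(hσ v hv).2, (hσ v' hv').2] at h1
    have h2 : v * (φ 1 - φ 0) = v' * (φ 1 - φ 0) := by simpa [ℓ] using h1
    exact mul_right_cancel₀ (by linarith) h2
  · rw [← hη0]
    refine (hiff _ (hσ 0 m0).1 _ m0).2 ?_
    rw [(hσ 0 m0).2]; simp [ℓ]
  · rw [← hη1]
    refine (hiff _ (hσ 1 m1).1 _ m1).2 ?_
    rw [(hσ 1 m1).2]; simp [ℓ]
  · rintro _ ⟨v, hv, rfl⟩
    exact hsub (mem_image_of_mem _ (hσ v hv).1)

theorem main_complex {P V : Set ℂ} (hPc : IsCompact P) (hPl : LocallyConnectedSpace P)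
    (hVo : IsOpen V) (hVc : IsConnected V)
    (hVP : closure V \ V ⊆ P) (hdis : Disjoint V P) {z z' : ℂ} (hz : z ∈ closure V \ V)
    (hz' : z' ∈ closure V \ V) (hne : z ≠ z') :
    ∃ γ : ℝ → ℂ, ContinuousOn γ (Icc 0 1) ∧ InjOn γ (Icc 0 1) ∧ γ 0 = z ∧ γ 1 = z' ∧
      γ '' Ioo 0 1 ⊆ V := by
  have hS := smallCover_of_locallyConnected hPc hPl
  obtain ⟨x, hx, hxz⟩ := accessible hS hVo hVc hVP hdis hz.1
  obtain ⟨x', hx', hxz'⟩ := accessible hS hVo hVc hVP hdis hz'.1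
  have hpc : IsPathConnected V := hVo.isConnected_iff_isPathConnected.1 hVc
  have hxx' := hpc.joinedIn x hx x' hx'
  have hj : JoinedIn (insert z (insert z' V)) z z' := by
    refine (hxz.symm.mono ?_).trans ((hxx'.mono ?_).trans (hxz'.mono ?_))
    · exact insert_subset_insert (subset_insert _ _)
    · exact (subset_insert _ _).trans (subset_insert _ _)
    · exact subset_insert _ _
  obtain ⟨p, hp⟩ := hj
  obtain ⟨Γ, hΓc, hΓi, hΓ0, hΓ1, hΓ⟩ := exists_arc (γ := p.extend) p.continuous_extend (by simpa using hne)
  rw [Path.extend_zero] at hΓ0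
  rw [Path.extend_one] at hΓ1
  refine ⟨Γ, hΓc, hΓi, hΓ0, hΓ1, ?_⟩
  rintro _ ⟨t, ht, rfl⟩
  have htI : t ∈ Icc (0:ℝ) 1 := Ioo_subset_Icc_self ht
  obtain ⟨s, hs, hst⟩ := hΓ (mem_image_of_mem Γ htI)
  have hmem := hp ⟨s, hs⟩
  rw [← Path.extend_apply p hs, hst] at hmem
  rcases hmem with h | h | h
  · rw [← hΓ0] at h
    exact absurd (hΓi htI (by simp) h) ht.1.ne'
  · rw [← hΓ1] at h
    exact absurd (hΓi htI (by simp) h) ht.2.ne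
  · exact h

end PeanoAcc

/-- Two distinct boundary points of a complementary component of a Peano continuum
can be joined by an arc whose interior lies in the component. -/
theorem stmt_7 (P : Set (ℝ × ℝ)) (hPc : IsCompact P) (hPconn : IsConnected P)
    (hPlc : LocallyConnectedSpace P)
    (V : Set (ℝ × ℝ)) (hV : ∃ p ∈ Pᶜ, V = connectedComponentIn Pᶜ p)
    (z z' : ℝ × ℝ) (hz : z ∈ closure V \ V) (hz' : z' ∈ closure V \ V)
    (hne : z ≠ z') :
    ∃ γ : ℝ → ℝ × ℝ, ContinuousOn γ (Set.Icc 0 1) ∧ Set.InjOn γ (Set.Icc 0 1) ∧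
      γ 0 = z ∧ γ 1 = z' ∧ γ '' Set.Ioo 0 1 ⊆ V := by
  obtain ⟨p, hp, rfl⟩ := hV
  set V := connectedComponentIn Pᶜ p with hVdef
  have hPo : IsOpen Pᶜ := hPc.isClosed.isOpen_compl
  have hVo : IsOpen V := hPo.connectedComponentIn
  have hVc : IsConnected V := isConnected_connectedComponentIn_iff.2 hp
  have hVP : closure V \ V ⊆ P := by
    rintro y ⟨hy, hyV⟩
    by_contra hyP
    have h1 : connectedComponentIn Pᶜ y ∈ 𝓝 y :=
      (hPo.connectedComponentIn).mem_nhds (mem_connectedComponentIn hyP)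
    obtain ⟨w, hw1, hw2⟩ := mem_closure_iff_nhds.1 hy _ h1
    apply hyV
    rw [hVdef, connectedComponentIn_eq hw2, ← connectedComponentIn_eq hw1]
    exact mem_connectedComponentIn hyP
  have hdis : Disjoint V P := by
    rw [Set.disjoint_left]
    exact fun w hw => connectedComponentIn_subset _ _ hw
  let e : (ℝ × ℝ) ≃ₜ ℂ := Complex.equivRealProdCLM.symm.toHomeomorph
  have hcl : closure (e '' V) \ e '' V = e '' (closure V \ V) := by
    rw [← e.image_closure, image_sdiff e.injective]
  obtain ⟨γ, hγc, hγi, hγ0, hγ1, hγ⟩ := PeanoAcc.main_complex (P := e '' P) (V := e '' V)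
    (hPc.image e.continuous) ((e.image P).symm.locallyConnectedSpace)
    (e.isOpenMap V hVo) (hVc.image e e.continuous.continuousOn)
    (by rw [hcl]; exact image_mono hVP) ((disjoint_image_iff e.injective).2 hdis)
    (z := e z) (z' := e z') (by rw [hcl]; exact mem_image_of_mem _ hz)
    (by rw [hcl]; exact mem_image_of_mem _ hz') (fun h => hne (e.injective h))
  refine ⟨fun t => e.symm (γ t), e.symm.continuous.comp_continuousOn hγc,
    fun s hs t ht h => hγi hs ht (e.symm.injective h), by simp [hγ0], by simp [hγ1], ?_⟩
  rintro _ ⟨t, ht, rfl⟩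
  obtain ⟨w, hw, hwt⟩ := hγ (mem_image_of_mem γ ht)
  simp only [← hwt, Homeomorph.symm_apply_apply]
  exact hw
end

section
/- Let D be a disc in ℝ² with boundary circle C = ∂D, and let ρ : [0,1] → C be a quasi-covering map (continuous, injective on [0,1), ρ(0) = ρ(1)). Then for any two interior points v, v' of D, the rotational angles satisfy ∠(ρ(0) v ρ(1), ρ) = ∠(ρ(0) v' ρ(1), ρ), and this common value is 2π or -2π. -/
open Complex

/-- The directed angle `∠ x v y ∈ (-π, π]` from the ray `v → x` to the ray `v → y`. -/
noncomputable def dirAngle (v x y : ℂ) : ℝ := Complex.arg ((y - v) / (x - v))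

/-- `r` is a partition of `[a,b]` into `n` steps with mesh `< δ`. -/
def IsFinePartition (a b δ : ℝ) (n : ℕ) (r : ℕ → ℝ) : Prop :=
  r 0 = a ∧ r n = b ∧ ∀ k < n, 0 < r (k + 1) - r k ∧ r (k + 1) - r k < δ

/-- The sum of directed angles seen from `v` along the partition `r` of the path `ρ`. -/
noncomputable def angSum (ρ : ℝ → ℂ) (v : ℂ) (n : ℕ) (r : ℕ → ℝ) : ℝ :=
  ∑ k ∈ Finset.range n, dirAngle v (ρ (r k)) (ρ (r (k + 1)))

open Set

theorem exists_log {A : Type} [NormedAddCommGroup A] [NormedSpace ℝ A] (f : A → ℂ)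
    (hf : Continuous f) (h0 : ∀ a, f a ≠ 0) :
    ∃ g : A → ℂ, Continuous g ∧ ∀ a, Complex.exp (g a) = f a := by
  obtain ⟨F, hF, -⟩ := Complex.isCoveringMapOn_exp.existsUnique_continuousMap_lifts
    (A := A) (f := ⟨f, hf⟩) (a₀ := 0) (e₀ := Complex.log (f 0))
    (by simp [Complex.exp_log (h0 0)]) (by simpa using h0)
  exact ⟨F, F.continuous, fun a => congrFun hF.2 a⟩

theorem const_of_exp_one {A : Type} [TopologicalSpace A] {S : Set A} (hS : IsPreconnected S)
    {g : A → ℂ} (hg : ContinuousOn g S) (h1 : ∀ x ∈ S, Complex.exp (g x) = 1)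
    {x y : A} (hx : x ∈ S) (hy : y ∈ S) : g x = g y := by
  have := Complex.isCoveringMap_exp.eqOn_of_comp_eqOn hS hg (g₂ := fun _ => g y)
    continuousOn_const (fun z hz => by simp [h1 z hz, h1 y hy]) hy rfl
  exact this hx

/-- `f` (restricted to `[0,1]`) has a continuous logarithm with increment `2πi m`. -/
def HasW (f : ℝ → ℂ) (m : ℤ) : Prop :=
  ∃ L : ℝ → ℂ, Continuous L ∧ (∀ t ∈ Icc (0:ℝ) 1, Complex.exp (L t) = f t) ∧
    L 1 - L 0 = m * (2 * Real.pi * Complex.I)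

def clamp (t : ℝ) : ℝ := max 0 (min t 1)

theorem clamp_cont : Continuous clamp := by unfold clamp; fun_prop
theorem clamp_mem (t : ℝ) : clamp t ∈ Icc (0:ℝ) 1 := by simp [clamp]
theorem clamp_eq {t : ℝ} (ht : t ∈ Icc (0:ℝ) 1) : clamp t = t := by simp [clamp, ht.1, ht.2]

theorem hasW_congr {f g : ℝ → ℂ} {m : ℤ} (h : HasW f m) (hfg : ∀ t ∈ Icc (0:ℝ) 1, f t = g t) :
    HasW g m := by
  obtain ⟨L, h1, h2, h3⟩ := h
  exact ⟨L, h1, fun t ht => (h2 t ht).trans (hfg t ht), h3⟩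

theorem two_pi_I_ne : (2 * Real.pi * Complex.I : ℂ) ≠ 0 := Complex.two_pi_I_ne_zero

theorem hasW_exists {f : ℝ → ℂ} (hf : ContinuousOn f (Icc 0 1))
    (h0 : ∀ t ∈ Icc (0:ℝ) 1, f t ≠ 0) (h01 : f 0 = f 1) : ∃ m, HasW f m := by
  obtain ⟨L, hL, hL'⟩ := exists_log (fun t => f (clamp t))
    (hf.comp_continuous clamp_cont clamp_mem) (fun t => h0 _ (clamp_mem t))
  have key : ∀ t ∈ Icc (0:ℝ) 1, Complex.exp (L t) = f t := fun t ht => by rw [hL', clamp_eq ht]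
  have : Complex.exp (L 1) = Complex.exp (L 0) := by
    rw [key 1 (by simp), key 0 (by simp), h01]
  obtain ⟨m, hm⟩ := Complex.exp_eq_exp_iff_exists_int.1 this
  exact ⟨m, L, hL, key, by rw [hm]; ring⟩

theorem hasW_unique {f : ℝ → ℂ} {m m' : ℤ} (h : HasW f m) (h' : HasW f m') : m = m' := by
  obtain ⟨L, h1, h2, h3⟩ := h
  obtain ⟨L', h1', h2', h3'⟩ := h'
  have := const_of_exp_one (S := Icc (0:ℝ) 1) isPreconnected_Icc (g := fun t => L t - L' t)
    (h1.sub h1').continuousOn (fun t ht => by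
      rw [Complex.exp_sub, h2 t ht, ← h2' t ht, div_self (Complex.exp_ne_zero _)])
    (x := 0) (y := 1) (by simp) (by simp)
  have h4 : L 1 - L 0 = L' 1 - L' 0 := by linear_combination -this
  rw [h3, h3'] at h4
  exact_mod_cast mul_right_cancel₀ two_pi_I_ne h4

theorem hasW_homotopy {H : ℝ × ℝ → ℂ} (hH : ContinuousOn H (Icc 0 1 ×ˢ Icc 0 1))
    (h0 : ∀ p ∈ Icc (0:ℝ) 1 ×ˢ Icc (0:ℝ) 1, H p ≠ 0)
    (h01 : ∀ s ∈ Icc (0:ℝ) 1, H (0, s) = H (1, s)) :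
    ∃ m, HasW (fun t => H (t, 0)) m ∧ HasW (fun t => H (t, 1)) m := by
  obtain ⟨L, hL, hL'⟩ := exists_log (fun p : ℝ × ℝ => H (clamp p.1, clamp p.2))
    (hH.comp_continuous (f := fun p : ℝ × ℝ => (clamp p.1, clamp p.2))
      ((clamp_cont.comp continuous_fst).prodMk (clamp_cont.comp continuous_snd))
      (fun p => ⟨clamp_mem _, clamp_mem _⟩)) (fun p => h0 _ ⟨clamp_mem _, clamp_mem _⟩)
  have key : ∀ t ∈ Icc (0:ℝ) 1, ∀ s ∈ Icc (0:ℝ) 1, Complex.exp (L (t, s)) = H (t, s) :=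
    fun t ht s hs => by rw [hL', clamp_eq ht, clamp_eq hs]
  have z0 : (0:ℝ) ∈ Icc (0:ℝ) 1 := by simp
  have z1 : (1:ℝ) ∈ Icc (0:ℝ) 1 := by simp
  have hc := const_of_exp_one (S := Icc (0:ℝ) 1) isPreconnected_Icc
    (g := fun s => L (1, s) - L (0, s)) (by fun_prop) (fun s hs => by
      rw [Complex.exp_sub, key 1 z1 s hs, key 0 z0 s hs, ← h01 s hs, div_self (h0 _ ⟨z0, hs⟩)])
    (x := 0) (y := 1) (by simp) (by simp)
  have : Complex.exp (L (1, 0)) = Complex.exp (L (0, 0)) := by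
    rw [key 1 z1 0 z0, key 0 z0 0 z0, h01 0 z0]
  obtain ⟨m, hm⟩ := Complex.exp_eq_exp_iff_exists_int.1 this
  have h4 : L (1, 0) - L (0, 0) = m * (2 * Real.pi * Complex.I) := by rw [hm]; ring
  refine ⟨m, ⟨fun t => L (t, 0), by fun_prop, fun t ht => key t ht 0 z0, h4⟩,
    ⟨fun t => L (t, 1), by fun_prop, fun t ht => key t ht 1 z1, ?_⟩⟩
  rw [← h4]; exact hc.symm

theorem hasW_const {c : ℂ} (hc : c ≠ 0) : HasW (fun _ => c) 0 :=
  ⟨fun _ => Complex.log c, continuous_const, fun _ _ => Complex.exp_log hc, by simp⟩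

theorem hasW_circle {ε : ℂ} (hε : ε ≠ 0) :
    HasW (fun t => ε * Complex.exp (2 * Real.pi * Complex.I * t)) 1 :=
  ⟨fun t => Complex.log ε + 2 * Real.pi * Complex.I * t, by fun_prop, fun t _ => by
    rw [Complex.exp_add, Complex.exp_log hε], by push_cast; ring⟩

theorem hasW_comp {F : ℂ → ℂ} {w : ℂ} (hF : ContinuousOn F {w}ᶜ) (h0 : ∀ z, z ≠ w → F z ≠ 0) :
    ∃ k : ℤ, ∀ (f : ℝ → ℂ) (m : ℤ), HasW (fun t => f t - w) m → HasW (fun t => F (f t)) (k * m) := by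
  have hne : ∀ s, w + Complex.exp s ≠ w := fun s => by simp
  obtain ⟨G, hG, hG'⟩ := exists_log (fun s : ℂ => F (w + Complex.exp s))
    (hF.comp_continuous (by fun_prop) hne) (fun s => h0 _ (hne s))
  have hp : ∀ s, Complex.exp (G (s + 2 * Real.pi * Complex.I) - G s) = 1 := fun s => by
    rw [Complex.exp_sub, hG', hG', Complex.exp_add, Complex.exp_two_pi_mul_I, mul_one,
      div_self (h0 _ (hne s))]
  obtain ⟨k, hk⟩ := Complex.exp_eq_one_iff.1 (hp 0)
  have hstep : ∀ s, G (s + 2 * Real.pi * Complex.I) - G s = k * (2 * Real.pi * Complex.I) :=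
    fun s => by
      rw [← hk]
      exact const_of_exp_one (S := univ) isPreconnected_univ
        (g := fun s => G (s + 2 * Real.pi * Complex.I) - G s) (by fun_prop) (fun s _ => hp s)
        (mem_univ _) (mem_univ _)
  have hshift : ∀ (m : ℤ) s, G (s + m * (2 * Real.pi * Complex.I)) - G s
      = (k * m : ℤ) * (2 * Real.pi * Complex.I) := by
    intro m s
    induction m using Int.induction_on with
    | zero => simp
    | succ i ih =>
      have := hstep (s + (i : ℤ) * (2 * Real.pi * Complex.I))
      rw [show s + ((i + 1 : ℤ) : ℂ) * (2 * Real.pi * Complex.I)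
        = s + (i : ℤ) * (2 * Real.pi * Complex.I) + 2 * Real.pi * Complex.I by push_cast; ring]
      push_cast at *
      linear_combination this + ih
    | pred i ih =>
      have := hstep (s + (-i - 1 : ℤ) * (2 * Real.pi * Complex.I))
      rw [show s + ((-i - 1 : ℤ) : ℂ) * (2 * Real.pi * Complex.I) + 2 * Real.pi * Complex.I
        = s + (-i : ℤ) * (2 * Real.pi * Complex.I) by push_cast; ring] at this
      push_cast at *
      linear_combination ih - this
  refine ⟨k, fun f m ⟨L, h1, h2, h3⟩ => ⟨fun t => G (L t), by fun_prop, fun t ht => ?_, ?_⟩⟩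
  · rw [hG', h2 t ht]; congr 1; ring
  · rw [← hshift m (L 0), ← h3]; congr 2; ring

theorem hasW_im {σ : ℝ → ℂ} (hn : ∀ t ∈ Icc (0:ℝ) 1, ‖σ t‖ = 1) {m : ℤ} (h : HasW σ m) :
    ∃ θ : ℝ → ℝ, Continuous θ ∧ (∀ t ∈ Icc (0:ℝ) 1, Complex.exp (θ t * Complex.I) = σ t) ∧
      θ 1 - θ 0 = m * (2 * Real.pi) := by
  obtain ⟨L, h1, h2, h3⟩ := h
  refine ⟨fun t => (L t).im, by fun_prop, fun t ht => ?_, ?_⟩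
  · rw [← h2 t ht]
    have := hn t ht
    rw [← h2 t ht, Complex.norm_exp, Real.exp_eq_one_iff] at this
    congr 1
    apply Complex.ext <;> simp [this]
  · have := congrArg Complex.im h3
    simpa using this

theorem exp_shift (x : ℝ) (j : ℤ) :
    Complex.exp ((x + j * (2 * Real.pi) : ℝ) * Complex.I) = Complex.exp (x * Complex.I) := by
  rw [Complex.exp_eq_exp_iff_exists_int]
  exact ⟨j, by push_cast; ring⟩

theorem hasW_inj {σ : ℝ → ℂ} (hn : ∀ t ∈ Icc (0:ℝ) 1, ‖σ t‖ = 1)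
    (hinj : InjOn σ (Ico 0 1)) {m : ℤ} (h : HasW σ m) : m = 1 ∨ m = -1 := by
  obtain ⟨θ, h1, h2, h3⟩ := hasW_im hn h
  have z0 : (0:ℝ) ∈ Icc (0:ℝ) 1 := by simp
  have z1 : (1:ℝ) ∈ Icc (0:ℝ) 1 := by simp
  have hpi := Real.pi_pos
  -- no interior point returns to the base value
  have hno : ∀ t ∈ Icc (0:ℝ) 1, ∀ j : ℤ, θ t = θ 0 + j * (2 * Real.pi) → t = 0 ∨ t = 1 := by
    intro t ht j hj
    by_contra hcon
    push Not at hcon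
    have : σ t = σ 0 := by rw [← h2 t ht, ← h2 0 z0, hj, exp_shift]
    exact hcon.1 (hinj ⟨ht.1, lt_of_le_of_ne ht.2 hcon.2⟩ ⟨le_rfl, one_pos⟩ this)
  by_contra hcon
  push Not at hcon
  rcases lt_trichotomy m 0 with hm | hm | hm
  · have hm2 : m ≤ -2 := by omega
    have hm3 : (m:ℝ) ≤ -2 := by exact_mod_cast hm2
    obtain ⟨t, ht, hte⟩ := intermediate_value_Icc' zero_le_one h1.continuousOn
      (show θ 0 + (-1 : ℤ) * (2 * Real.pi) ∈ Icc (θ 1) (θ 0) by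
        constructor <;> push_cast <;> nlinarith)
    rcases hno t ht _ hte with rfl | rfl
    · push_cast at hte; linarith
    · push_cast at hte; nlinarith
  · subst hm
    have e01 : θ 1 = θ 0 := by simpa [sub_eq_zero] using h3
    have hhalf : θ (1/2) ≠ θ 0 := fun he => by
      rcases hno (1/2) (by norm_num) 0 (by simpa using he) with h | h <;> norm_num at h
    set y := (θ (1/2) + θ 0) / 2 with hy
    have hy1 : y ∈ uIcc (θ 0) (θ (1/2)) := by
      rw [mem_uIcc]; rcases le_total (θ 0) (θ (1/2)) with h | h
      · left; constructor <;> linarith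
      · right; constructor <;> linarith
    have hy2 : y ∈ uIcc (θ (1/2)) (θ 1) := by rw [e01, uIcc_comm]; exact hy1
    obtain ⟨t1, ht1, e1⟩ := intermediate_value_uIcc h1.continuousOn hy1
    obtain ⟨t2, ht2, e2⟩ := intermediate_value_uIcc h1.continuousOn hy2
    rw [uIcc_of_le (by norm_num)] at ht1 ht2
    have hne2 : t2 ≠ 1 := by rintro rfl; apply hhalf; linarith
    have hne1 : t1 ≠ 1/2 := by rintro rfl; apply hhalf; linarith
    have hlt := lt_of_le_of_ne ht1.2 hne1
    have : t1 = t2 := hinj ⟨ht1.1, by linarith⟩ ⟨by linarith [ht2.1], lt_of_le_of_ne ht2.2 hne2⟩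
      (by rw [← h2 t1 ⟨ht1.1, by linarith⟩, ← h2 t2 ⟨by linarith [ht2.1], ht2.2⟩, e1, e2])
    linarith [ht2.1]
  · have hm2 : 2 ≤ m := by omega
    have hm3 : (2:ℝ) ≤ m := by exact_mod_cast hm2
    obtain ⟨t, ht, hte⟩ := intermediate_value_Icc zero_le_one h1.continuousOn
      (show θ 0 + (1 : ℤ) * (2 * Real.pi) ∈ Icc (θ 0) (θ 1) by
        constructor <;> push_cast <;> nlinarith)
    rcases hno t ht _ hte with rfl | rfl
    · push_cast at hte; linarith
    · push_cast at hte; nlinarith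

theorem hasW_surj {σ : ℝ → ℂ} (hn : ∀ t ∈ Icc (0:ℝ) 1, ‖σ t‖ = 1)
    {m : ℤ} (h : HasW σ m) (hm : m = 1 ∨ m = -1) {z : ℂ} (hz : ‖z‖ = 1) :
    ∃ t ∈ Icc (0:ℝ) 1, σ t = z := by
  obtain ⟨θ, h1, h2, h3⟩ := hasW_im hn h
  have hpi := Real.pi_pos
  set a := min (θ 0) (θ 1)
  have hz' : Complex.exp (z.arg * Complex.I) = z := by
    have := Complex.norm_mul_exp_arg_mul_I z
    rwa [hz, Complex.ofReal_one, one_mul] at this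
  have hb := toIcoMod_mem_Ico Real.two_pi_pos a z.arg
  have hmem : toIcoMod Real.two_pi_pos a z.arg ∈ uIcc (θ 0) (θ 1) := by
    refine ⟨hb.1, hb.2.le.trans ?_⟩
    change min (θ 0) (θ 1) + _ ≤ max (θ 0) (θ 1)
    rcases hm with rfl | rfl <;> push_cast at h3
    · rw [min_eq_left (by linarith), max_eq_right (by linarith)]; linarith
    · rw [min_eq_right (by linarith), max_eq_left (by linarith)]; linarith
  obtain ⟨t, ht, e⟩ := intermediate_value_uIcc h1.continuousOn hmem
  rw [uIcc_of_le zero_le_one] at ht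
  refine ⟨t, ht, ?_⟩
  have := exp_shift z.arg (-toIcoDiv Real.two_pi_pos a z.arg)
  rw [hz'] at this
  rw [← h2 t ht, e, toIcoMod, sub_eq_add_neg, ← neg_zsmul, zsmul_eq_mul]
  exact this

theorem angle_step {f : ℝ → ℂ} {L : ℝ → ℂ} (hL : Continuous L) {a b : ℝ} (hab : a ≤ b)
    (h2 : ∀ t ∈ Icc a b, Complex.exp (L t) = f t)
    (hnear : ∀ t ∈ Icc a b, ‖f t - f a‖ < ‖f a‖) :
    Complex.arg (f b / f a) = (L b).im - (L a).im := by
  have ha : a ∈ Icc a b := ⟨le_rfl, hab⟩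
  have hb : b ∈ Icc a b := ⟨hab, le_rfl⟩
  have h0 : f a ≠ 0 := by rw [← h2 a ha]; exact Complex.exp_ne_zero _
  have hq : ∀ t ∈ Icc a b, Complex.exp (L t - L a) = f t / f a := fun t ht => by
    rw [Complex.exp_sub, h2 t ht, h2 a ha]
  have hs : ∀ t ∈ Icc a b, Complex.exp (L t - L a) ∈ Complex.slitPlane := fun t ht => by
    rw [← add_sub_cancel 1 (Complex.exp (L t - L a))]
    apply Complex.mem_slitPlane_of_norm_lt_one
    rw [hq t ht, div_sub_one h0, norm_div, div_lt_one (norm_pos_iff.2 h0)]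
    exact hnear t ht
  have hc := const_of_exp_one (S := Icc a b) isPreconnected_Icc
    (g := fun t => L t - L a - Complex.log (Complex.exp (L t - L a)))
    (ContinuousOn.sub (by fun_prop) (ContinuousOn.clog (by fun_prop) hs))
    (fun t _ => by rw [Complex.exp_sub, Complex.exp_log (Complex.exp_ne_zero _),
      div_self (Complex.exp_ne_zero _)]) hb ha
  simp only [sub_self, Complex.exp_zero, Complex.log_one] at hc
  rw [hq b hb, sub_eq_zero] at hc
  rw [← Complex.log_im, ← hc, Complex.sub_im]

theorem angSum_eq {ρ : ℝ → ℂ} {v : ℂ} {m : ℤ} (h : HasW (fun t => ρ t - v) m) {δ : ℝ}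
    (hfine : ∀ r ∈ Icc (0 : ℝ) 1, ∀ s ∈ Icc (0 : ℝ) 1, |r - s| < δ →
      dist (ρ r) (ρ s) < Metric.infDist v (ρ '' Icc 0 1) / 3)
    {n : ℕ} {r : ℕ → ℝ} (hr : IsFinePartition 0 1 δ n r) :
    angSum ρ v n r = m * (2 * Real.pi) := by
  obtain ⟨L, h1, h2, h3⟩ := h
  obtain ⟨r0, rn, hk⟩ := hr
  have hlow : ∀ k ≤ n, 0 ≤ r k := by
    intro k hkn
    induction k with
    | zero => rw [r0]
    | succ k ih => linarith [ih (by omega), (hk k (by omega)).1]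
  have hup : ∀ j ≤ n, r (n - j) ≤ 1 := by
    intro j hj
    induction j with
    | zero => simp [rn]
    | succ j ih =>
      have := (hk (n - (j+1)) (by omega)).1
      rw [show n - (j+1) + 1 = n - j by omega] at this
      linarith [ih (by omega)]
  have hmem : ∀ k ≤ n, r k ∈ Icc (0:ℝ) 1 := fun k hkn => ⟨hlow k hkn, by
    have := hup (n - k) (by omega)
    rwa [show n - (n - k) = k by omega] at this⟩
  have hstep : ∀ k ∈ Finset.range n, dirAngle v (ρ (r k)) (ρ (r (k+1)))
      = (L (r (k+1))).im - (L (r k)).im := by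
    intro k hkn
    rw [Finset.mem_range] at hkn
    have ha := hmem k hkn.le
    have hb := hmem (k+1) hkn
    have hsub : ∀ t ∈ Icc (r k) (r (k+1)), t ∈ Icc (0:ℝ) 1 :=
      fun t ht => ⟨ha.1.trans ht.1, ht.2.trans hb.2⟩
    refine angle_step (f := fun t => ρ t - v) h1 (by linarith [(hk k hkn).1])
      (fun t ht => h2 t (hsub t ht)) (fun t ht => ?_)
    have h4 := hfine t (hsub t ht) (r k) ha (by
      rw [abs_of_nonneg (by linarith [ht.1])]; linarith [ht.2, (hk k hkn).2])
    have h5 : Metric.infDist v (ρ '' Icc 0 1) ≤ dist v (ρ (r k)) :=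
      Metric.infDist_le_dist_of_mem (mem_image_of_mem _ ha)
    have h6 : (0:ℝ) ≤ Metric.infDist v (ρ '' Icc 0 1) := Metric.infDist_nonneg
    rw [dist_comm, dist_eq_norm] at h5
    rw [dist_eq_norm] at h4
    simp only [sub_sub_sub_cancel_right]
    linarith
  unfold angSum
  rw [Finset.sum_congr rfl hstep, Finset.sum_range_sub (fun k => (L (r k)).im), r0, rn]
  have := congrArg Complex.im h3
  simpa using this

theorem disc_maps (D : Set ℂ) (hD : Nonempty (D ≃ₜ (Metric.closedBall (0 : ℂ) 1))) :
    ∃ φ ψ : ℂ → ℂ, ContinuousOn φ (Metric.closedBall 0 1) ∧ ContinuousOn ψ D ∧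
      MapsTo φ (Metric.closedBall 0 1) D ∧ MapsTo ψ D (Metric.closedBall 0 1) ∧
      (∀ z ∈ Metric.closedBall (0:ℂ) 1, ψ (φ z) = z) ∧ (∀ x ∈ D, φ (ψ x) = x) := by
  classical
  obtain ⟨h⟩ := hD
  refine ⟨fun z => if hz : z ∈ Metric.closedBall (0:ℂ) 1 then (h.symm ⟨z, hz⟩ : ℂ) else 0,
    fun x => if hx : x ∈ D then (h ⟨x, hx⟩ : ℂ) else 0, ?_, ?_, ?_, ?_, ?_, ?_⟩
  · rw [continuousOn_iff_continuous_domRestrict]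
    refine (continuous_subtype_val.comp h.symm.continuous).congr fun z => ?_
    have := z.2
    simp [-Metric.mem_closedBall]
  · rw [continuousOn_iff_continuous_domRestrict]
    refine (continuous_subtype_val.comp h.continuous).congr fun z => ?_
    have := z.2
    simp
  · intro z hz
    simp only [hz, dif_pos]
    exact Subtype.coe_prop _
  · intro z hz
    simp only [hz, dif_pos]
    exact Subtype.coe_prop _
  · intro z hz
    simp only [hz, dif_pos, Subtype.coe_prop, Subtype.coe_eta, Homeomorph.apply_symm_apply]
  · intro z hz
    simp only [hz, dif_pos, Subtype.coe_prop, Subtype.coe_eta, Homeomorph.symm_apply_apply]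

/-- The standard parametrization of the unit circle. -/
noncomputable def circ (t : ℝ) : ℂ := Complex.exp ((t * (2 * Real.pi) : ℝ) * Complex.I)

theorem circ_cont : Continuous circ := by unfold circ; fun_prop
theorem circ_norm (t : ℝ) : ‖circ t‖ = 1 := Complex.norm_exp_ofReal_mul_I _
theorem circ01 : circ 0 = circ 1 := by
  have := exp_shift 0 1
  unfold circ; simp
theorem circ_inj : InjOn circ (Ico 0 1) := by
  have hpi := Real.pi_pos
  intro a ha b hb hab
  obtain ⟨k, hk⟩ := Complex.exp_eq_exp_iff_exists_int.1 hab
  have h1 : a * (2 * Real.pi) = b * (2 * Real.pi) + k * (2 * Real.pi) := by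
    have := congrArg Complex.im hk
    simpa using this
  have h2 : a = b + k := by
    have : a * (2 * Real.pi) = (b + k) * (2 * Real.pi) := by linarith
    exact mul_right_cancel₀ (by positivity) this
  have h3 : (k:ℝ) < 1 := by linarith [ha.2, hb.1]
  have h4 : (-1:ℝ) < k := by linarith [ha.1, hb.2]
  have h3' : k < 1 := by exact_mod_cast h3
  have h4' : -1 < k := by exact_mod_cast h4
  have : k = 0 := by omega
  simpa [this] using h2

theorem hasW_circ {ε : ℂ} (hε : ε ≠ 0) : HasW (fun t => ε * circ t) 1 :=
  hasW_congr (hasW_circle hε) fun t _ => by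
    unfold circ; congr 2; push_cast; ring

/-- A simple closed curve has an inverse parametrization onto the unit circle. -/
theorem curve_inverse (ρ : ℝ → ℂ) (hρcont : ContinuousOn ρ (Icc 0 1))
    (hρinj : InjOn ρ (Ico 0 1)) (hρ01 : ρ 0 = ρ 1) :
    ∃ κ : ℂ → ℂ, ContinuousOn κ (ρ '' Icc 0 1) ∧ InjOn κ (ρ '' Icc 0 1) ∧
      ∀ x ∈ ρ '' Icc 0 1, ‖κ x‖ = 1 := by
  classical
  -- reduce a parameter to [0,1)
  have hred : ∀ t ∈ Icc (0:ℝ) 1, ∃ t' ∈ Ico (0:ℝ) 1, ρ t = ρ t' ∧ circ t = circ t' := by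
    intro t ht
    rcases eq_or_lt_of_le ht.2 with h | h
    · exact ⟨0, by simp, by rw [h, hρ01], by rw [h, circ01]⟩
    · exact ⟨t, ⟨ht.1, h⟩, rfl, rfl⟩
  have hiff : ∀ a ∈ Icc (0:ℝ) 1, ∀ b ∈ Icc (0:ℝ) 1, ρ a = ρ b ↔ circ a = circ b := by
    intro a ha b hb
    obtain ⟨a', ha', h1, h2⟩ := hred a ha
    obtain ⟨b', hb', h3, h4⟩ := hred b hb
    rw [h1, h2, h3, h4, hρinj.eq_iff ha' hb', circ_inj.eq_iff ha' hb']
  let κ : ℂ → ℂ := fun x => if hx : x ∈ ρ '' Icc 0 1 then circ hx.choose else 0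
  have hκ : ∀ t ∈ Icc (0:ℝ) 1, κ (ρ t) = circ t := by
    intro t ht
    have hx : ρ t ∈ ρ '' Icc 0 1 := mem_image_of_mem _ ht
    simp only [κ, hx, dif_pos]
    exact (hiff _ hx.choose_spec.1 _ ht).1 hx.choose_spec.2
  refine ⟨κ, ?_, ?_, ?_⟩
  · let q : Icc (0:ℝ) 1 → ρ '' Icc 0 1 := fun t => ⟨ρ t, mem_image_of_mem _ t.2⟩
    have hqc : Continuous q := by
      apply Continuous.subtype_mk
      exact hρcont.domRestrict
    have hqs : Function.Surjective q := by
      rintro ⟨x, t, ht, rfl⟩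
      exact ⟨⟨t, ht⟩, rfl⟩
    have hq : Topology.IsQuotientMap q := hqc.isClosedMap.isQuotientMap hqc hqs
    rw [continuousOn_iff_continuous_domRestrict, hq.continuous_iff]
    refine (circ_cont.comp continuous_subtype_val).congr fun t => ?_
    exact (hκ t t.2).symm
  · rintro _ ⟨a, ha, rfl⟩ _ ⟨b, hb, rfl⟩ hab
    rw [hκ a ha, hκ b hb] at hab
    exact (hiff a ha b hb).2 hab
  · rintro _ ⟨a, ha, rfl⟩
    rw [hκ a ha]
    exact circ_norm _

/-- A disc, with chosen maps. -/
theorem core (D : Set ℂ) (hD : Nonempty (D ≃ₜ (Metric.closedBall (0 : ℂ) 1)))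
    (ρ : ℝ → ℂ) (hρcont : ContinuousOn ρ (Icc 0 1))
    (hρinj : InjOn ρ (Ico 0 1)) (hρ01 : ρ 0 = ρ 1)
    (hρsurj : ρ '' Icc 0 1 = frontier D)
    (v v' : ℂ) (hv : v ∈ interior D) (hv' : v' ∈ interior D) :
    ∃ m : ℤ, (m = 1 ∨ m = -1) ∧ HasW (fun t => ρ t - v) m ∧ HasW (fun t => ρ t - v') m := by
  obtain ⟨φ, ψ, hφ, hψ, hφD, hψB, hψφ, hφψ⟩ := disc_maps D hD
  have hDim : D = φ '' Metric.closedBall 0 1 := by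
    apply Subset.antisymm
    · intro x hx; exact ⟨ψ x, hψB hx, hφψ x hx⟩
    · rintro _ ⟨z, hz, rfl⟩; exact hφD hz
  have hDcl : IsClosed D := by
    rw [hDim]; exact ((isCompact_closedBall _ _).image_of_continuousOn hφ).isClosed
  have hfD : frontier D ⊆ D := hDcl.frontier_subset
  have hφinj : InjOn φ (Metric.closedBall 0 1) := fun a ha b hb hab => by
    rw [← hψφ a ha, ← hψφ b hb, hab]
  have hsph : ∀ z : ℂ, ‖z‖ = 1 → z ∈ Metric.closedBall (0:ℂ) 1 := fun z hz => by simp [hz]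
  -- small circles around interior points
  have hsmall : ∀ p ∈ interior D, ∃ ε : ℝ, 0 < ε ∧ ∀ t, p + ε * circ t ∈ D := by
    intro p hp
    obtain ⟨ε, hε, hsub⟩ := Metric.isOpen_iff.1 isOpen_interior p hp
    refine ⟨ε / 2, by positivity, fun t => interior_subset (hsub ?_)⟩
    rw [Metric.mem_ball, dist_eq_norm, add_sub_cancel_left, norm_mul, circ_norm, mul_one,
      Complex.norm_real, Real.norm_eq_abs, abs_of_pos (by positivity)]
    linarith
  -- boundary points of the ball are mapped to the frontier
  have hbd : ∀ z : ℂ, ‖z‖ = 1 → φ z ∉ interior D := by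
    intro z hz hshift
    obtain ⟨ε, hε, hc⟩ := hsmall _ hshift
    have hεne : (ε : ℂ) ≠ 0 := by exact_mod_cast hε.ne'
    have hcc : Continuous (fun t => φ z + ε * circ t) :=
      continuous_const.add (continuous_const.mul circ_cont)
    have hγc : Continuous (fun t => ψ (φ z + ε * circ t)) := hψ.comp_continuous hcc hc
    have hγB : ∀ t, ‖ψ (φ z + ε * circ t)‖ ≤ 1 := fun t => by simpa using hψB (hc t)
    have hγne : ∀ t, ψ (φ z + ε * circ t) ≠ z := fun t he => by
      have h1 := hφψ _ (hc t)
      rw [he] at h1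
      have h2 : (ε : ℂ) * circ t = 0 := by linear_combination -h1
      have h3 := congrArg norm h2
      rw [norm_mul, circ_norm, mul_one, norm_zero, norm_eq_zero] at h3
      exact hεne h3
    have hmem : ∀ p ∈ Icc (0:ℝ) 1 ×ˢ Icc (0:ℝ) 1,
        (p.2 : ℂ) * ψ (φ z + ε * circ p.1) ∈ Metric.closedBall (0:ℂ) 1 := fun p hp => by
      rw [mem_closedBall_zero_iff, norm_mul, Complex.norm_real, Real.norm_eq_abs,
        abs_of_nonneg hp.2.1]
      exact mul_le_one₀ hp.2.2 (norm_nonneg _) (hγB _)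
    obtain ⟨m, hm0, hm1⟩ := hasW_homotopy
      (H := fun p => φ ((p.2 : ℂ) * ψ (φ z + ε * circ p.1)) - φ z)
      ((hφ.comp (Continuous.continuousOn (by
          exact (Complex.continuous_ofReal.comp continuous_snd).mul (hγc.comp continuous_fst)))
          hmem).sub continuousOn_const)
      (fun p hp he => by
        have h1 := hφinj (hmem p hp) (hsph z hz) (sub_eq_zero.1 he)
        have h2 := congrArg norm h1
        rw [norm_mul, Complex.norm_real, Real.norm_eq_abs, abs_of_nonneg hp.2.1, hz] at h2
        have h3 : p.2 = 1 := by
          apply le_antisymm hp.2.2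
          rw [← h2]
          exact mul_le_of_le_one_right hp.2.1 (hγB _)
        rw [h3] at h1
        exact hγne p.1 (by simpa using h1))
      (fun s _ => by simp only [circ01])
    have e0 : m = 0 := by
      refine hasW_unique hm0 (hasW_congr (hasW_const (c := φ 0 - φ z) ?_) fun t _ => by simp)
      intro he
      have := hφinj (by simp) (hsph z hz) (sub_eq_zero.1 he)
      rw [← this] at hz; simp at hz
    have e1 : m = 1 := by
      refine hasW_unique hm1 (hasW_congr (hasW_circ hεne) fun t _ => ?_)
      simp only [Complex.ofReal_one, one_mul]
      rw [hφψ _ (hc t)]; ring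
    omega
  have hbd' : ∀ z : ℂ, ‖z‖ = 1 → φ z ∈ frontier D := fun z hz => by
    rw [hDcl.frontier_eq]; exact ⟨hφD (hsph z hz), hbd z hz⟩
  -- the frontier is the image of the circle
  have hfr : ∀ x ∈ frontier D, ‖ψ x‖ = 1 := by
    intro x hx
    obtain ⟨κ, hκc, hκi, hκn⟩ := curve_inverse ρ hρcont hρinj hρ01
    rw [hρsurj] at hκc hκi hκn
    have hmem : ∀ t, φ (circ t) ∈ frontier D := fun t => hbd' _ (circ_norm t)
    have hσc : Continuous (fun t => κ (φ (circ t))) :=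
      hκc.comp_continuous (hφ.comp_continuous circ_cont fun t => hsph _ (circ_norm t)) hmem
    have hσn : ∀ t ∈ Icc (0:ℝ) 1, ‖κ (φ (circ t))‖ = 1 := fun t _ => hκn _ (hmem t)
    have hσi : InjOn (fun t => κ (φ (circ t))) (Ico 0 1) := fun a ha b hb hab =>
      circ_inj ha hb (hφinj (hsph _ (circ_norm a)) (hsph _ (circ_norm b))
        (hκi (hmem a) (hmem b) hab))
    obtain ⟨m, hm⟩ := hasW_exists hσc.continuousOn
      (fun t ht he => by have := hσn t ht; rw [he] at this; simp at this) (by rw [circ01])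
    obtain ⟨t, -, ht⟩ := hasW_surj hσn hm (hasW_inj hσn hσi hm) (hκn x hx)
    rw [← hκi (hmem t) hx ht, hψφ _ (hsph _ (circ_norm t)), circ_norm]
  have hρf : ∀ t ∈ Icc (0:ℝ) 1, ρ t ∈ frontier D := fun t ht => by
    rw [← hρsurj]; exact mem_image_of_mem _ ht
  have hψint : ∀ x ∈ interior D, ‖ψ x‖ < 1 := fun x hx => by
    have h1 : ‖ψ x‖ ≤ 1 := by simpa using hψB (interior_subset hx)
    refine lt_of_le_of_ne h1 fun he => hbd _ he ?_
    rwa [hφψ x (interior_subset hx)]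
  have hφint : ∀ z : ℂ, ‖z‖ < 1 → φ z ∈ interior D := fun z hz => by
    have hzB : z ∈ Metric.closedBall (0:ℂ) 1 := by simpa using hz.le
    by_contra hcon
    have := hfr (φ z) (by rw [hDcl.frontier_eq]; exact ⟨hφD hzB, hcon⟩)
    rw [hψφ z hzB] at this
    exact hz.ne this
  -- the curve in the ball
  have hσc : ContinuousOn (fun t => ψ (ρ t)) (Icc 0 1) :=
    hψ.comp hρcont fun t ht => hfD (hρf t ht)
  have hσn : ∀ t ∈ Icc (0:ℝ) 1, ‖ψ (ρ t)‖ = 1 := fun t ht => hfr _ (hρf t ht)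
  have hσi : InjOn (fun t => ψ (ρ t)) (Ico 0 1) := fun a ha b hb hab => by
    apply hρinj ha hb
    rw [← hφψ _ (hfD (hρf a ⟨ha.1, ha.2.le⟩)), ← hφψ _ (hfD (hρf b ⟨hb.1, hb.2.le⟩))]
    exact congrArg φ hab
  -- winding about `v` is a unit
  have hunit : ∃ m : ℤ, (m = 1 ∨ m = -1) ∧ HasW (fun t => ρ t - v) m := by
    set w := ψ v with hw
    have hw1 : ‖w‖ < 1 := hψint v hv
    have hwB : w ∈ Metric.closedBall (0:ℂ) 1 := by simpa using hw1.le
    have hφw : φ w = v := hφψ v (interior_subset hv)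
    -- winding of the curve in the ball about `w`
    obtain ⟨m, hm0, hm1⟩ := hasW_homotopy (H := fun p => ψ (ρ p.1) - (p.2 : ℂ) * w)
      ((hσc.comp continuousOn_fst fun p hp => hp.1).sub (by fun_prop))
      (fun p hp he => by
        have h1 := congrArg norm (sub_eq_zero.1 he)
        rw [hσn _ hp.1, norm_mul, Complex.norm_real, Real.norm_eq_abs,
          abs_of_nonneg hp.2.1] at h1
        have := mul_le_of_le_one_left (norm_nonneg w) hp.2.2
        linarith)
      (fun s _ => by simp only [hρ01])
    have hmu : m = 1 ∨ m = -1 := hasW_inj hσn hσi (hasW_congr hm0 fun t _ => by simp)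
    have hm1' : HasW (fun t => ψ (ρ t) - w) m := hasW_congr hm1 fun t _ => by simp
    -- the retraction
    let P : ℂ → ℂ := fun z => ((max 1 ‖z‖ : ℝ) : ℂ)⁻¹ * z
    have hmax : ∀ z : ℂ, (0:ℝ) < max 1 ‖z‖ := fun z => lt_max_of_lt_left one_pos
    have hPc : Continuous P := by
      refine Continuous.mul (Continuous.inv₀ (by fun_prop) fun z => ?_) continuous_id
      exact_mod_cast (hmax z).ne'
    have hPn : ∀ z, ‖P z‖ = (max 1 ‖z‖)⁻¹ * ‖z‖ := fun z => by
      simp only [P]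
      rw [norm_mul, norm_inv, Complex.norm_real, Real.norm_eq_abs, abs_of_pos (hmax z)]
    have hPB : ∀ z, P z ∈ Metric.closedBall (0:ℂ) 1 := fun z => by
      rw [mem_closedBall_zero_iff, hPn, inv_mul_le_one₀ (hmax z)]
      exact le_max_right _ _
    have hPid : ∀ z : ℂ, ‖z‖ ≤ 1 → P z = z := fun z hz => by
      simp [P, max_eq_left hz]
    have hPne : ∀ z, z ≠ w → P z ≠ w := fun z hz he => by
      rcases le_total ‖z‖ 1 with h | h
      · exact hz ((hPid z h).symm.trans he)
      · have := hPn z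
        rw [he, max_eq_right h, inv_mul_cancel₀ (by linarith)] at this
        linarith
    obtain ⟨k, hk⟩ := hasW_comp (F := fun z => φ (P z) - v) (w := w)
      ((hφ.comp_continuous hPc hPB).sub continuous_const).continuousOn
      (fun z hz he => hPne z hz (hφinj (hPB z) hwB (by rw [hφw]; exact sub_eq_zero.1 he)))
    have h1 : HasW (fun t => ρ t - v) (k * m) := hasW_congr (hk _ _ hm1') fun t ht => by
      rw [hPid _ (hσn t ht).le, hφψ _ (hfD (hρf t ht))]
    -- the small circle forces `k` to be a unit
    obtain ⟨ε, hε, hc⟩ := hsmall v hv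
    have hεne : (ε : ℂ) ≠ 0 := by exact_mod_cast hε.ne'
    have hγc : Continuous (fun t => ψ (v + ε * circ t)) :=
      hψ.comp_continuous (continuous_const.add (continuous_const.mul circ_cont)) hc
    obtain ⟨j, hj⟩ := hasW_exists (f := fun t => ψ (v + ε * circ t) - w)
      (hγc.sub continuous_const).continuousOn
      (fun t _ he => by
        have h1 := hφψ _ (hc t)
        rw [sub_eq_zero.1 he, hφw] at h1
        have h2 : (ε : ℂ) * circ t = 0 := by linear_combination -h1
        have h3 := congrArg norm h2
        rw [norm_mul, circ_norm, mul_one, norm_zero, norm_eq_zero] at h3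
        exact hεne h3)
      (by simp only [circ01])
    have h2 : HasW (fun t => (ε : ℂ) * circ t) (k * j) := hasW_congr (hk _ _ hj) fun t _ => by
      rw [hPid _ (by simpa using hψB (hc t)), hφψ _ (hc t)]; ring
    have h3 : k * j = 1 := hasW_unique h2 (hasW_circ hεne)
    have hku : k = 1 ∨ k = -1 := Int.eq_one_or_neg_one_of_mul_eq_one h3
    refine ⟨k * m, ?_, h1⟩
    rcases hku with rfl | rfl <;> rcases hmu with rfl | rfl <;> simp
  obtain ⟨m, hmu, hm⟩ := hunit
  refine ⟨m, hmu, hm, ?_⟩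
  -- independence of the point
  have hpath : ∀ s ∈ Icc (0:ℝ) 1, ‖(1 - s : ℂ) * ψ v + s * ψ v'‖ < 1 := fun s hs => by
    have h1 := hψint v hv
    have h2 := hψint v' hv'
    have := (convex_ball (0:ℂ) 1) (x := ψ v) (by simpa using h1) (y := ψ v') (by simpa using h2)
      (a := 1 - s) (b := s) (by linarith [hs.2]) hs.1 (by ring)
    simpa [Complex.real_smul] using this
  have hne : ∀ p ∈ Icc (0:ℝ) 1 ×ˢ Icc (0:ℝ) 1,
      ρ p.1 - φ ((1 - p.2 : ℂ) * ψ v + p.2 * ψ v') ≠ 0 := fun p hp he => by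
    have h1 := hρf _ hp.1
    rw [sub_eq_zero.1 he, hDcl.frontier_eq] at h1
    exact h1.2 (hφint _ (hpath _ hp.2))
  obtain ⟨m', h0, h1⟩ := hasW_homotopy
    (H := fun p => ρ p.1 - φ ((1 - p.2 : ℂ) * ψ v + p.2 * ψ v'))
    ((hρcont.comp continuousOn_fst fun p hp => hp.1).sub
      (hφ.comp (by fun_prop) fun p hp => by simpa using (hpath _ hp.2).le))
    hne (fun s _ => by simp only [hρ01])
  have e0 : m' = m := hasW_unique (hasW_congr h0 fun t _ => by
    simp [hφψ v (interior_subset hv)]) hm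
  rw [← e0]
  exact hasW_congr h1 fun t _ => by simp [hφψ v' (interior_subset hv')]

/-- For a quasi-covering map `ρ : [0,1] → C` of the boundary circle `C` of a disc
`D ⊆ ℂ`, the rotational angle `∠(ρ(0) v ρ(1), ρ)` is the same for all interior points
`v` of `D`, and equals `2π` or `-2π`. -/
theorem stmt_16 (D : Set ℂ) (hD : Nonempty (D ≃ₜ (Metric.closedBall (0 : ℂ) 1)))
    (ρ : ℝ → ℂ) (hρcont : ContinuousOn ρ (Set.Icc 0 1))
    (hρinj : Set.InjOn ρ (Set.Ico 0 1)) (hρ01 : ρ 0 = ρ 1)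
    (hρsurj : ρ '' Set.Icc 0 1 = frontier D)
    (v v' : ℂ) (hv : v ∈ interior D) (hv' : v' ∈ interior D)
    (δ δ' : ℝ) (hδ : 0 < δ) (hδ' : 0 < δ')
    (hδfine : ∀ r ∈ Set.Icc (0 : ℝ) 1, ∀ s ∈ Set.Icc (0 : ℝ) 1, |r - s| < δ →
      dist (ρ r) (ρ s) < Metric.infDist v (ρ '' Set.Icc 0 1) / 3)
    (hδ'fine : ∀ r ∈ Set.Icc (0 : ℝ) 1, ∀ s ∈ Set.Icc (0 : ℝ) 1, |r - s| < δ' →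
      dist (ρ r) (ρ s) < Metric.infDist v' (ρ '' Set.Icc 0 1) / 3)
    (n n' : ℕ) (r r' : ℕ → ℝ)
    (hr : IsFinePartition 0 1 δ n r) (hr' : IsFinePartition 0 1 δ' n' r') :
    angSum ρ v n r = angSum ρ v' n' r' ∧
      (angSum ρ v n r = 2 * Real.pi ∨ angSum ρ v n r = -(2 * Real.pi)) := by
  obtain ⟨m, hm, h1, h2⟩ := core D hD ρ hρcont hρinj hρ01 hρsurj v v' hv hv'
  rw [angSum_eq h1 hδfine hr, angSum_eq h2 hδ'fine hr']
  refine ⟨rfl, ?_⟩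
  rcases hm with rfl | rfl
  · left; simp
  · right; simp
end

section
/- Let f : ℝ² → ℝ² be an orientation-preserving homeomorphism. If f has a periodic point (a point x with f^n(x) = x for some positive integer n), then f has a fixed point. -/
open unitInterval in
/-- Homotopy lifting for the complex exponential. -/
lemma lift_general {A : Type*} [TopologicalSpace A] (h : I × A → ℂ) (hc : Continuous h)
    (hne : ∀ p, h p ≠ 0) (g : A → ℂ) (hg : Continuous g) (h0 : ∀ a, h (0, a) = Complex.exp (g a)) :
    ∃ L : I × A → ℂ, Continuous L ∧ (∀ p, Complex.exp (L p) = h p) ∧ ∀ a, L (0, a) = g a := by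
  let H : C(I × A, {z : ℂ // z ≠ 0}) := ⟨fun p => ⟨h p, hne p⟩, hc.subtype_mk _⟩
  have H0 : ∀ a, H (0, a) = (fun z : ℂ => (⟨_, z.exp_ne_zero⟩ : {z : ℂ // z ≠ 0})) ((⟨g, hg⟩ : C(A, ℂ)) a) :=
    fun a => Subtype.ext (h0 a)
  refine ⟨Complex.isCoveringMap_exp.liftHomotopy H ⟨g, hg⟩ H0, ContinuousMap.continuous _, ?_, ?_⟩
  · intro p
    exact congrArg Subtype.val (congrFun (Complex.isCoveringMap_exp.liftHomotopy_lifts H ⟨g, hg⟩ H0) p)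
  · intro a
    exact Complex.isCoveringMap_exp.liftHomotopy_zero H ⟨g, hg⟩ H0 a

/-- A continuous function whose exponential is constant is constant. -/
lemma exp_const {A : Type*} [TopologicalSpace A] {S : Set A} (hS : IsPreconnected S) (g : A → ℂ)
    (hg : ContinuousOn g S) (c : ℂ) (hc : ∀ x ∈ S, Complex.exp (g x) = c) {x y : A} (hx : x ∈ S)
    (hy : y ∈ S) : g x = g y := by
  have : PreconnectedSpace S := Subtype.preconnectedSpace hS
  have := Complex.isCoveringMap_exp.const_of_comp (g := S.domRestrict g)
    (continuousOn_iff_continuous_domRestrict.mp hg)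
    (fun a b => Subtype.ext ((hc a a.2).trans (hc b b.2).symm)) ⟨x, hx⟩ ⟨y, hy⟩
  exact this

open unitInterval in
/-- Logarithms exist on star-convex sets. -/
lemma star_log {E : Type*} [NormedAddCommGroup E] [NormedSpace ℝ E] {D : Set E} {c : E}
    (hD : StarConvex ℝ c D) (hcD : c ∈ D) (g : E → ℂ) (hg : ContinuousOn g D)
    (hne : ∀ x ∈ D, g x ≠ 0) :
    ∃ L : E → ℂ, ContinuousOn L D ∧ ∀ x ∈ D, Complex.exp (L x) = g x := by
  classical
  have hmem : ∀ p : I × D, c + (p.1 : ℝ) • ((p.2 : E) - c) ∈ D := fun p =>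
    hD.add_smul_sub_mem p.2.2 p.1.2.1 p.1.2.2
  obtain ⟨L, hL, hexp, -⟩ := lift_general (A := D) (fun p => g (c + (p.1 : ℝ) • ((p.2 : E) - c)))
    (hg.comp_continuous (by fun_prop) hmem) (fun p => hne _ (hmem p))
    (fun _ => Complex.log (g c)) continuous_const
    (fun a => by simp [Complex.exp_log (hne c hcD)])
  refine ⟨fun x => if h : x ∈ D then L (1, ⟨x, h⟩) else 0, ?_, ?_⟩
  · rw [continuousOn_iff_continuous_domRestrict]
    have : D.domRestrict (fun x => if h : x ∈ D then L (1, ⟨x, h⟩) else 0) = fun x => L (1, x) := by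
      ext x; simp [Set.domRestrict]
    rw [this]; fun_prop
  · intro x hx
    simp [hx, hexp]

open unitInterval in
/-- The (complex) angle variation along the isotopy. -/
lemma exists_var (H : ℝ → ℂ → ℂ) (hH : Continuous fun p : ℝ × ℂ => H p.1 p.2)
    (hinj : ∀ t, Function.Injective (H t)) (h0 : ∀ z, H 0 z = z) :
    ∃ a : ℂ × ℂ → ℂ, ContinuousOn a {p | p.1 ≠ p.2} ∧
      (∀ z w, z ≠ w → Complex.exp (a (z, w)) * (w - z) = H 1 w - H 1 z) ∧
      (∀ z w, z ≠ w → a (z, w) = a (w, z)) := by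
  classical
  set D : Set (ℂ × ℂ) := {p | p.1 ≠ p.2} with hDdef
  have hsub : ∀ p : D, (p : ℂ × ℂ).2 - (p : ℂ × ℂ).1 ≠ 0 := fun p => sub_ne_zero.mpr (Ne.symm p.2)
  have hc1 : Continuous fun p : I × D => H p.1 (p.2 : ℂ × ℂ).2 :=
    hH.comp (f := fun p : I × D => ((p.1 : ℝ), (p.2 : ℂ × ℂ).2)) (by fun_prop)
  have hc2 : Continuous fun p : I × D => H p.1 (p.2 : ℂ × ℂ).1 :=
    hH.comp (f := fun p : I × D => ((p.1 : ℝ), (p.2 : ℂ × ℂ).1)) (by fun_prop)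
  obtain ⟨L, hL, hexp, hL0⟩ := lift_general (A := D)
    (fun p => (H p.1 (p.2 : ℂ × ℂ).2 - H p.1 (p.2 : ℂ × ℂ).1) / ((p.2 : ℂ × ℂ).2 - (p.2 : ℂ × ℂ).1))
    ((hc1.sub hc2).div (by fun_prop) (fun p => hsub p.2))
    (fun p => div_ne_zero (sub_ne_zero.mpr fun h => p.2.2 (hinj _ h).symm) (hsub p.2))
    (fun _ => 0) continuous_const
    (fun p => by simp [h0, div_self (hsub p)])
  have hsymm : ∀ z w (h : z ≠ w), L (1, ⟨(z, w), h⟩) = L (1, ⟨(w, z), h.symm⟩) := by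
    intro z w h
    have := exp_const (A := I) (S := Set.univ) isPreconnected_univ
      (fun t => L (t, ⟨(z, w), h⟩) - L (t, ⟨(w, z), h.symm⟩))
      (Continuous.continuousOn (by fun_prop)) 1 (by
        intro t _
        have h1 : H t w - H t z ≠ 0 := sub_ne_zero.mpr fun h' => h (hinj _ h').symm
        have h2 : w - z ≠ 0 := sub_ne_zero.mpr h.symm
        rw [Complex.exp_sub, hexp, hexp]
        simp only
        rw [← neg_sub (H t w), ← neg_sub w z, neg_div_neg_eq]
        exact div_self (div_ne_zero h1 h2)) (Set.mem_univ 1) (Set.mem_univ 0)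
    simp only [hL0, sub_self] at this
    exact sub_eq_zero.mp this
  refine ⟨fun x => if h : x ∈ D then L (1, ⟨x, h⟩) else 0, ?_, ?_, ?_⟩
  · rw [continuousOn_iff_continuous_domRestrict]
    have : D.domRestrict (fun x => if h : x ∈ D then L (1, ⟨x, h⟩) else 0) = fun x => L (1, x) := by
      ext x; simp [Set.domRestrict]
    rw [this]; fun_prop
  · intro z w h
    have h' : (z, w) ∈ D := h
    simp only [h', dite_true, hexp]
    exact div_mul_cancel₀ _ (sub_ne_zero.mpr h.symm)
  · intro z w h
    have h' : (z, w) ∈ D := h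
    have h'' : (w, z) ∈ D := h.symm
    simp only [h', h'', dite_true]
    exact hsymm z w h

/-- Main contradiction: a curve `G` with `G (u+1) = f (G u)` whose first self-intersection
is at time `t ≥ 2`. -/
lemma main_curve (H : ℝ → ℂ → ℂ) (hH : Continuous fun p : ℝ × ℂ => H p.1 p.2)
    (hinj : ∀ t, Function.Injective (H t)) (h0 : ∀ z, H 0 z = z) (f : ℂ → ℂ) (hf : H 1 = f)
    (hfix : ∀ z, f z ≠ z) (G : ℝ → ℂ) (t s : ℝ) (ht : 2 ≤ t) (hs0 : 0 ≤ s) (hs1 : s < 1)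
    (hG : ContinuousOn G (Set.Icc 0 t)) (hGf : ∀ u, 0 ≤ u → G (u + 1) = f (G u))
    (hGinj : ∀ u v, 0 ≤ u → u < v → v < t → G u ≠ G v) (hst : G s = G t) : False := by
  have hfc : Continuous f := by
    rw [← hf]; exact hH.comp (f := fun z : ℂ => ((1 : ℝ), z)) (by fun_prop)
  have hfinj : Function.Injective f := hf ▸ hinj 1
  obtain ⟨a, hac, haexp, hasymm⟩ := exists_var H hH hinj h0
  rw [hf] at haexp
  obtain ⟨Λ, hΛc, hΛ⟩ := star_log (D := (Set.univ : Set ℂ)) (c := 0) (starConvex_univ _) trivial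
    (fun z => f z - z) (by fun_prop) (fun z _ => sub_ne_zero.mpr (hfix z))
  rw [continuousOn_univ] at hΛc
  replace hΛ : ∀ z, Complex.exp (Λ z) = f z - z := fun z => hΛ z trivial
  -- the domain
  set D : Set (ℝ × ℝ) := {p | 0 ≤ p.1 ∧ p.1 < p.2 ∧ p.2 ≤ t ∧ ¬ (p.1 = s ∧ p.2 = t)} with hD
  have hGD : ∀ u v, (u, v) ∈ D → G u ≠ G v := by
    rintro u v ⟨h1, h2, h3, h4⟩ h
    simp only at h1 h2 h3 h4
    rcases lt_or_eq_of_le h3 with h5 | h5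
    · exact hGinj u v h1 h2 h5 h
    · rw [h5, ← hst] at h
      have hne : u ≠ s := fun h6 => h4 ⟨h6, h5⟩
      rcases lt_or_gt_of_ne hne with h7 | h7
      · exact hGinj u s h1 h7 (by linarith) h
      · exact hGinj s u hs0 h7 (by linarith) h.symm
  have hstar : StarConvex ℝ ((0, 1) : ℝ × ℝ) D := by
    rintro ⟨u, v⟩ ⟨h1, h2, h3, h4⟩ x y hx hy hxy
    simp only at h1 h2 h3 h4
    rcases eq_or_lt_of_le hx with h | h
    · subst h
      have : y = 1 := by linarith
      subst this
      simpa [hD] using ⟨h1, h2, h3, fun a b => h4 ⟨a, b⟩⟩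
    · have e1 : y * v ≤ y * t := mul_le_mul_of_nonneg_left h3 hy
      have e2 : y * u ≤ y * v := mul_le_mul_of_nonneg_left h2.le hy
      have e3 : x * 1 < x * t := mul_lt_mul_of_pos_left (by linarith) h
      have e4 : x * t + y * t = t := by rw [← add_mul, hxy, one_mul]
      have e5 := mul_nonneg hy h1
      refine ⟨?_, ?_, ?_, ?_⟩ <;> simp only [Prod.fst_add, Prod.snd_add, Prod.smul_fst, Prod.smul_snd, smul_eq_mul]
      · linarith
      · linarith
      · linarith
      · rintro ⟨-, h6⟩; linarith
  have hGfst : ContinuousOn (fun p : ℝ × ℝ => G p.1) D :=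
    hG.comp continuous_fst.continuousOn (fun p hp => ⟨hp.1, hp.2.1.le.trans hp.2.2.1⟩)
  have hGsnd : ContinuousOn (fun p : ℝ × ℝ => G p.2) D :=
    hG.comp continuous_snd.continuousOn (fun p hp => ⟨hp.1.trans hp.2.1.le, hp.2.2.1⟩)
  obtain ⟨φ, hφc, hφ⟩ := star_log hstar (by refine ⟨?_, ?_, ?_, ?_⟩ <;> simp <;> intros <;> linarith)
    (fun p => G p.2 - G p.1) (hGsnd.sub hGfst) (fun p hp => sub_ne_zero.mpr (hGD p.1 p.2 hp).symm)
  have mk : ∀ u v, 0 ≤ u → u < v → v ≤ t → (v < t ∨ u ≠ s) → (u, v) ∈ D := by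
    intro u v h1 h2 h3 h4
    refine ⟨h1, h2, h3, ?_⟩
    rintro ⟨h5, h6⟩
    rcases h4 with h4 | h4
    · exact h4.ne h6
    · exact h4 h5
  -- (1)
  have hafc : Continuous fun z => a (z, f z) :=
    hac.comp_continuous (f := fun z => (z, f z)) (by fun_prop) (fun z => (hfix z).symm)
  have k1 : ∀ z w, Λ (f z) - Λ z - a (z, f z) = Λ (f w) - Λ w - a (w, f w) := by
    intro z w
    refine exp_const isPreconnected_univ (fun z => Λ (f z) - Λ z - a (z, f z))
      (((hΛc.comp hfc).sub hΛc).sub hafc).continuousOn 1 ?_ (Set.mem_univ z) (Set.mem_univ w)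
    intro z _
    have h1 : f z - z ≠ 0 := sub_ne_zero.mpr (hfix z)
    rw [Complex.exp_sub, Complex.exp_sub, hΛ, hΛ, ← haexp z (f z) (hfix z).symm]
    have := Complex.exp_ne_zero (a (z, f z))
    field_simp
  -- (2)
  set D1 : Set (ℝ × ℝ) := {p | 0 ≤ p.1 ∧ p.1 < p.2 ∧ p.2 ≤ t - 1} with hD1
  have hD1D : ∀ p ∈ D1, p ∈ D := fun p hp => mk p.1 p.2 hp.1 hp.2.1 (by linarith [hp.2.2])
    (Or.inl (by linarith [hp.2.2]))
  have hD1D' : ∀ p ∈ D1, (p.1 + 1, p.2 + 1) ∈ D := fun p hp =>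
    mk _ _ (by linarith [hp.1]) (by linarith [hp.2.1]) (by linarith [hp.2.2])
    (Or.inr (by linarith [hp.1]))
  have hD1conv : Convex ℝ D1 := by
    have : D1 = {p : ℝ × ℝ | 0 ≤ p.1} ∩ ({p | p.1 - p.2 < 0} ∩ {p | p.2 ≤ t - 1}) := by
      ext p; simp [hD1]
    rw [this]
    refine (convex_halfSpace_ge (f := Prod.fst) (LinearMap.fst ℝ ℝ ℝ).isLinear 0).inter
      ((convex_halfSpace_lt (f := fun p : ℝ × ℝ => p.1 - p.2)
        (LinearMap.fst ℝ ℝ ℝ - LinearMap.snd ℝ ℝ ℝ).isLinear 0).inter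
      (convex_halfSpace_le (f := Prod.snd) (LinearMap.snd ℝ ℝ ℝ).isLinear _))
  have k2 : ∀ p ∈ D1, ∀ q ∈ D1,
      φ (p.1 + 1, p.2 + 1) - φ p - a (G p.1, G p.2) =
      φ (q.1 + 1, q.2 + 1) - φ q - a (G q.1, G q.2) := by
    intro p hp q hq
    refine exp_const hD1conv.isPreconnected
      (fun p => φ (p.1 + 1, p.2 + 1) - φ p - a (G p.1, G p.2)) ?_ 1 ?_ hp hq
    · refine (ContinuousOn.sub ?_ (hφc.mono hD1D)).sub ?_
      · exact hφc.comp (f := fun p : ℝ × ℝ => (p.1 + 1, p.2 + 1))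
          (Continuous.continuousOn (by fun_prop)) hD1D'
      · exact hac.comp (f := fun p : ℝ × ℝ => (G p.1, G p.2))
          ((hGfst.mono hD1D).prodMk (hGsnd.mono hD1D)) (fun p hp => hGD p.1 p.2 (hD1D p hp))
    · intro p hp
      have hne := hGD p.1 p.2 (hD1D p hp)
      have h1 : G p.2 - G p.1 ≠ 0 := sub_ne_zero.mpr hne.symm
      rw [Complex.exp_sub, Complex.exp_sub, hφ _ (hD1D' p hp), hφ _ (hD1D p hp)]
      simp only
      rw [hGf _ hp.1, hGf _ (hp.1.trans hp.2.1.le), ← haexp _ _ hne]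
      have := Complex.exp_ne_zero (a (G p.1, G p.2))
      field_simp
  -- (3)
  have hd3 : ∀ u ∈ Set.Icc 0 (t - 1), (u, u + 1) ∈ D := fun u hu =>
    mk _ _ hu.1 (by linarith) (by linarith [hu.2]) (by
      by_cases h : u = s
      · left; linarith
      · right; exact h)
  have k3 : ∀ u ∈ Set.Icc 0 (t - 1), ∀ v ∈ Set.Icc 0 (t - 1),
      φ (u, u + 1) - Λ (G u) = φ (v, v + 1) - Λ (G v) := by
    intro u hu v hv
    refine exp_const isPreconnected_Icc (fun u => φ (u, u + 1) - Λ (G u)) ?_ 1 ?_ hu hv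
    · refine ContinuousOn.sub ?_ ?_
      · exact hφc.comp (f := fun u : ℝ => (u, u + 1)) (Continuous.continuousOn (by fun_prop)) hd3
      · exact hΛc.comp_continuousOn (hG.mono (Set.Icc_subset_Icc le_rfl (by linarith)))
    · intro u hu
      rw [Complex.exp_sub, hφ _ (hd3 u hu), hΛ]
      simp only
      rw [hGf _ hu.1]
      exact div_self (sub_ne_zero.mpr (hfix _))
  -- (4)
  have hd4 : ∀ u ∈ Set.Ioo s t, (u, t) ∈ D := fun u hu =>
    mk _ _ (hs0.trans hu.1.le) hu.2 le_rfl (Or.inr hu.1.ne')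
  have hd4' : ∀ u ∈ Set.Ioo s t, (s, u) ∈ D := fun u hu =>
    mk _ _ hs0 hu.1 hu.2.le (Or.inl hu.2)
  have e4 : ∀ u ∈ Set.Ioo s t, Complex.exp (φ (u, t) - φ (s, u)) = -1 := by
    intro u hu
    rw [Complex.exp_sub, hφ _ (hd4 u hu), hφ _ (hd4' u hu)]
    simp only
    rw [← hst, ← neg_sub (G u), neg_div, div_self (sub_ne_zero.mpr (hGD _ _ (hd4' u hu)).symm)]
  have k4 : φ (s + 1, t) - φ (s, s + 1) = φ (t - 1, t) - φ (s, t - 1) := by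
    refine exp_const isPreconnected_Ioo (S := Set.Ioo s t) (fun u => φ (u, t) - φ (s, u)) ?_ (-1) e4
      ⟨by linarith, by linarith⟩ ⟨by linarith, by linarith⟩
    refine ContinuousOn.sub ?_ ?_
    · exact hφc.comp (f := fun u : ℝ => (u, t)) (Continuous.continuousOn (by fun_prop)) hd4
    · exact hφc.comp (f := fun u : ℝ => (s, u)) (Continuous.continuousOn (by fun_prop)) hd4'
  have hexpfour := e4 (s + 1) ⟨by linarith, by linarith⟩
  -- assemble
  have G1 : G 1 = f (G 0) := by simpa using hGf 0 le_rfl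
  have Gt : G t = f (G (t - 1)) := by simpa using hGf (t - 1) (by linarith)
  have q1 := k3 0 ⟨le_rfl, by linarith⟩ 1 ⟨by linarith, by linarith⟩
  have q2 := k3 s ⟨hs0, by linarith⟩ 0 ⟨le_rfl, by linarith⟩
  have q3 := k3 (t - 1) ⟨by linarith, le_rfl⟩ 0 ⟨le_rfl, by linarith⟩
  have q4 := k2 (0, 1) ⟨le_rfl, one_pos, by simp only; linarith⟩ (s, t - 1)
    ⟨hs0, by simp only; linarith, le_rfl⟩
  have q5 := k1 (G 0) (G (t - 1))
  have q6 := hasymm (G (t - 1)) (G s) (by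
    rw [hst, Gt]; exact (hfix _).symm)
  simp only [zero_add, sub_add_cancel] at q1 q2 q3 q4
  rw [← G1, ← Gt, ← hst, q6] at q5
  have hC : φ (s + 1, t) - φ (s, s + 1) = 0 := by
    have : (2 : ℂ) * (φ (s + 1, t) - φ (s, s + 1)) = 0 := by
      linear_combination k4 - q2 + q3 - q4 + q5 - q1
    simpa using this
  rw [hC, Complex.exp_zero] at hexpfour
  norm_num at hexpfour

/-- Brouwer's lemma on the complex plane. -/
lemma brouwer_complex (H : ℝ → ℂ ≃ₜ ℂ) (hH : Continuous fun p : ℝ × ℂ => H p.1 p.2)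
    (h0 : ∀ z, H 0 z = z) (f : ℂ ≃ₜ ℂ) (hf : H 1 = f) (x : ℂ) (n : ℕ) (hn : 0 < n)
    (hx : (⇑f)^[n] x = x) : ∃ z, f z = z := by
  by_contra! hfix
  have hn2 : 2 ≤ n := by
    by_contra h
    have : n = 1 := by omega
    subst this
    exact hfix x (by simpa using hx)
  -- minimal critical disc
  obtain ⟨w, hw⟩ : ∃ w, ∀ y, max (dist w x) (dist (f w) x) ≤ max (dist y x) (dist (f y) x) := by
    refine Continuous.exists_forall_le (f := fun y => max (dist y x) (dist (f y) x)) (by fun_prop) ?_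
    exact Filter.tendsto_atTop_mono (fun y => le_max_left _ _) (tendsto_dist_right_cocompact_atTop x)
  set r := max (dist w x) (dist (f w) x) with hr
  have hrpos : 0 < r := by
    rcases lt_or_eq_of_le (le_max_of_le_left dist_nonneg : 0 ≤ r) with h | h
    · exact h
    · exfalso
      have h1 : dist w x ≤ 0 := h ▸ le_max_left _ _
      have h2 : dist (f w) x ≤ 0 := h ▸ le_max_right _ _
      exact hfix w ((dist_le_zero.mp h2).trans (dist_le_zero.mp h1).symm)
  set B := Metric.ball x r with hB
  have hfree : ∀ y ∈ B, f y ∉ B := fun y hy hfy =>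
    absurd (hw y) (not_le.mpr (max_lt hy hfy))
  have hcl : closure B = Metric.closedBall x r := closure_ball x hrpos.ne'
  have hwc : w ∈ closure B := by rw [hcl, Metric.mem_closedBall]; exact le_max_left _ _
  have hfwc : f w ∈ closure B := by rw [hcl, Metric.mem_closedBall]; exact le_max_right _ _
  -- `B` misses the image of its closure, and its closure misses the image of `B`
  have F1 : ∀ y ∈ closure B, f y ∉ B := by
    intro y hy hfy
    obtain ⟨z, hz1, hz2⟩ := mem_closure_iff.mp hy (f ⁻¹' B) (Metric.isOpen_ball.preimage f.continuous) hfy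
    exact hfree z hz2 hz1
  have F2 : ∀ y ∈ B, f y ∉ closure B := by
    intro y hy hfy
    obtain ⟨z, hz1, hz2⟩ := mem_closure_iff.mp hfy (f.symm ⁻¹' B)
      (Metric.isOpen_ball.preimage f.symm.continuous) (by simpa using hy)
    exact hfree (f.symm z) hz1 (by simpa using hz2)
  have hwB : w ∉ B := fun h => F2 w h hfwc
  have hfwB : f w ∉ B := F1 w hwc
  have hwr : ‖w - x‖ = r := by
    rw [← dist_eq_norm]
    exact le_antisymm (le_max_left _ _) (not_lt.mp hwB)
  have hfwr : ‖f w - x‖ = r := by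
    rw [← dist_eq_norm]
    exact le_antisymm (le_max_right _ _) (not_lt.mp hfwB)
  -- the translation arc
  set α : ℝ → ℂ := fun u => x + (max (1 - 2 * u) 0 : ℝ) • (w - x) + (max (2 * u - 1) 0 : ℝ) • (f w - x)
    with hα
  have hαc : Continuous α := by fun_prop
  have α0 : α 0 = w := by simp [hα]
  have α1 : α 1 = f w := by simp [hα]; norm_num
  have αl : ∀ u, u ≤ 1 / 2 → α u = x + (1 - 2 * u) • (w - x) := by
    intro u hu
    simp only [hα]
    rw [max_eq_left (by linarith), max_eq_right (by linarith), zero_smul, add_zero]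
  have αr : ∀ u, 1 / 2 ≤ u → α u = x + (2 * u - 1) • (f w - x) := by
    intro u hu
    simp only [hα]
    rw [max_eq_right (by linarith), max_eq_left (by linarith), zero_smul, add_zero]
  have αhalf : α (1 / 2) = x := by rw [αl _ le_rfl]; norm_num
  have αnorm : ∀ u, ‖α u - x‖ = |1 - 2 * u| * r := by
    intro u
    rcases le_total u (1 / 2) with h | h
    · rw [αl u h, add_sub_cancel_left, norm_smul, hwr, Real.norm_eq_abs]
    · rw [αr u h, add_sub_cancel_left, norm_smul, hfwr, Real.norm_eq_abs, abs_sub_comm]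
  have αB : ∀ u, 0 < u → u < 1 → α u ∈ B := by
    intro u h1 h2
    rw [hB, Metric.mem_ball, dist_eq_norm, αnorm]
    have : |1 - 2 * u| < 1 := abs_lt.mpr ⟨by linarith, by linarith⟩
    nlinarith
  have αcB : ∀ u, 0 ≤ u → u < 1 → α u ∈ closure B := by
    intro u h1 h2
    rcases eq_or_lt_of_le h1 with h | h
    · rw [← h, α0]; exact hwc
    · exact subset_closure (αB u h h2)
  have αinj : ∀ u v, 0 ≤ u → u < v → v < 1 → α u ≠ α v := by
    intro u v hu huv hv h
    have h1 : |1 - 2 * u| = |1 - 2 * v| := by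
      have := αnorm u
      rw [h, αnorm] at this
      exact (mul_right_cancel₀ hrpos.ne' this).symm
    rcases abs_eq_abs.mp h1 with h2 | h2
    · linarith
    · have hu' : u < 1 / 2 := by linarith
      rw [αl u hu'.le, αr v (by linarith), h2] at h
      have h3 : (2 * v - 1) • (w - x) = (2 * v - 1) • (f w - x) := by
        have := add_left_cancel h
        rwa [neg_sub] at this
      have h4 := smul_right_injective ℂ (show (2 * v - 1) ≠ 0 by linarith) h3
      exact hfix w (sub_left_inj.mp h4).symm
  -- the curve
  set G : ℝ → ℂ := fun u => (⇑f)^[⌊u⌋₊] (α (u - ⌊u⌋₊)) with hGdef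
  have hGf : ∀ u, 0 ≤ u → G (u + 1) = f (G u) := by
    intro u hu
    simp only [hGdef]
    rw [Nat.floor_add_one hu, Function.iterate_succ_apply']
    push_cast
    rw [add_sub_add_right_eq_sub]
  have hG1 : ∀ u, 0 ≤ u → u < 1 → G u = α u := by
    intro u h1 h2
    have : ⌊u⌋₊ = 0 := Nat.floor_eq_zero.mpr h2
    simp [hGdef, this]
  have hG1' : ∀ u, 0 ≤ u → u ≤ 1 → G u = α u := by
    intro u h1 h2
    rcases eq_or_lt_of_le h2 with h | h
    · rw [h, α1]
      have := hGf 0 le_rfl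
      rw [zero_add, hG1 0 le_rfl one_pos, α0] at this
      exact this
    · exact hG1 u h1 h
  have hGc : ∀ m : ℕ, ContinuousOn G (Set.Icc 0 (m + 1 : ℝ)) := by
    intro m
    induction m with
    | zero =>
      refine hαc.continuousOn.congr fun u hu => hG1' u hu.1 (by simpa using hu.2)
    | succ m ih =>
      have e : Set.Icc (0 : ℝ) ((m + 1 : ℕ) + 1 : ℝ) = Set.Icc 0 1 ∪ Set.Icc 1 ((m + 1 : ℕ) + 1 : ℝ) :=
        (Set.Icc_union_Icc_eq_Icc zero_le_one (by push_cast; linarith [(m.cast_nonneg : (0:ℝ) ≤ m)])).symm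
      rw [e]
      refine ContinuousOn.union_of_isClosed ?_ ?_ isClosed_Icc isClosed_Icc
      · exact hαc.continuousOn.congr fun u hu => hG1' u hu.1 hu.2
      · have : ContinuousOn (fun u => f (G (u - 1))) (Set.Icc 1 ((m + 1 : ℕ) + 1 : ℝ)) := by
          refine f.continuous.comp_continuousOn (ih.comp (Continuous.continuousOn (by fun_prop)) ?_)
          intro u hu
          have := hu.2
          push_cast at this
          exact ⟨by linarith [hu.1], by linarith⟩
        refine this.congr fun u hu => ?_
        have := hGf (u - 1) (by linarith [hu.1])
        rwa [sub_add_cancel] at this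
  have hGcont : ∀ T : ℝ, ContinuousOn G (Set.Icc 0 T) := by
    intro T
    obtain ⟨m, hm⟩ := exists_nat_ge T
    exact (hGc m).mono (Set.Icc_subset_Icc le_rfl (by linarith))
  have hGadd : ∀ (m : ℕ) u, 0 ≤ u → G (u + m) = (⇑f)^[m] (G u) := by
    intro m
    induction m with
    | zero => intro u _; simp
    | succ m ih =>
      intro u hu
      rw [Function.iterate_succ_apply', ← ih u hu, ← hGf _ (by positivity)]
      push_cast; rw [add_assoc]
  have hGinj2 : ∀ u v, 0 ≤ u → u < v → v < 2 → u < 1 → G u ≠ G v := by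
    intro u v hu huv hv hu1 h
    rcases lt_or_ge v 1 with hv1 | hv1
    · rw [hG1 u hu hu1, hG1 v (by linarith) hv1] at h
      exact αinj u v hu huv hv1 h
    · have h1 := hGf (v - 1) (by linarith)
      rw [sub_add_cancel, hG1 (v - 1) (by linarith) (by linarith)] at h1
      rw [h1, hG1 u hu hu1] at h
      have hv' : α (v - 1) ∈ closure B := αcB _ (by linarith) (by linarith)
      rcases eq_or_lt_of_le hu with h2 | h2
      · rw [← h2, α0] at h
        rcases eq_or_lt_of_le (show 0 ≤ v - 1 by linarith) with h3 | h3
        · rw [← h3, α0] at h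
          exact hfix w h.symm
        · exact F2 _ (αB _ h3 (by linarith)) (h ▸ hwc)
      · exact F1 _ hv' (h ▸ αB u h2 hu1)
  -- first self-intersection
  have hGhalf : G (1 / 2) = x := by rw [hG1 _ (by norm_num) (by norm_num), αhalf]
  have hN : (2 : ℝ) ≤ 1 / 2 + n := by
    have : (2 : ℝ) ≤ n := by exact_mod_cast hn2
    linarith
  set N : ℝ := 1 / 2 + n with hNdef
  have hGN : G N = x := by rw [hNdef, hGadd _ _ (by norm_num), hGhalf, hx]
  set K : Set (ℝ × ℝ) := {p | p ∈ Set.Icc (0 : ℝ) 1 ×ˢ Set.Icc 2 N ∧ G p.1 = G p.2} with hK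
  have hKc : IsCompact K := by
    have c1 : ContinuousOn (fun p : ℝ × ℝ => G p.1 - G p.2) (Set.Icc (0 : ℝ) 1 ×ˢ Set.Icc 2 N) :=
      ((hGcont 1).comp continuous_fst.continuousOn fun p hp => hp.1).sub
        ((hGcont N).comp continuous_snd.continuousOn fun p hp => ⟨by linarith [hp.2.1], hp.2.2⟩)
    have c2 := c1.preimage_isClosed_of_isClosed (isClosed_Icc.prod isClosed_Icc)
      (isClosed_singleton (x := (0 : ℂ)))
    refine (isCompact_Icc.prod isCompact_Icc).of_isClosed_subset (t := K) ?_ (fun p hp => hp.1)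
    convert c2 using 1
    ext p
    simp [hK, sub_eq_zero]
  have hKne : K.Nonempty := ⟨(1 / 2, N), ⟨⟨by norm_num, by norm_num⟩, hN, le_rfl⟩, by
    simp only; rw [hGN, hGhalf]⟩
  obtain ⟨⟨s, t⟩, ⟨⟨⟨hs0, hs1⟩, ht2, htN⟩, hst⟩, hmin⟩ :=
    hKc.exists_isMinOn hKne (continuous_snd.continuousOn)
  simp only at hs0 hs1 ht2 htN hst
  have hmin' : ∀ u v, 0 ≤ u → u ≤ 1 → 2 ≤ v → v < t → G u ≠ G v := by
    intro u v h1 h2 h3 h4 h5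
    have : t ≤ v := hmin (show (u, v) ∈ K from ⟨⟨⟨h1, h2⟩, h3, by linarith⟩, h5⟩)
    linarith
  have hGinj : ∀ u v, 0 ≤ u → u < v → v < t → G u ≠ G v := by
    have key : ∀ (m : ℕ) (u v : ℝ), 0 ≤ u → u < m + 1 → u < v → v < t → G u ≠ G v := by
      intro m
      induction m with
      | zero =>
        intro u v h1 h2 h3 h4
        have h2' : u < 1 := by simpa using h2
        rcases lt_or_ge v 2 with h5 | h5
        · exact hGinj2 u v h1 h3 h5 h2'
        · exact hmin' u v h1 h2'.le h5 h4
      | succ m ih =>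
        intro u v h1 h2 h3 h4 h5
        rcases lt_or_ge u 1 with h6 | h6
        · rcases lt_or_ge v 2 with h7 | h7
          · exact hGinj2 u v h1 h3 h7 h6 h5
          · exact hmin' u v h1 h6.le h7 h4 h5
        · have e1 := hGf (u - 1) (by linarith)
          have e2 := hGf (v - 1) (by linarith)
          rw [sub_add_cancel] at e1 e2
          rw [e1, e2] at h5
          push_cast at h2
          exact ih (u - 1) (v - 1) (by linarith) (by linarith) (by linarith) (by linarith)
            (f.injective h5)
    intro u v h1 h2 h3
    obtain ⟨m, hm⟩ := exists_nat_ge u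
    exact key m u v h1 (by linarith) h2 h3
  have hs1' : s < 1 := by
    rcases lt_or_eq_of_le hs1 with h | h
    · exact h
    · exfalso
      subst h
      have e1 := hGf 0 le_rfl
      have e2 := hGf (t - 1) (by linarith)
      rw [sub_add_cancel] at e2
      rw [zero_add] at e1
      rw [e1, e2] at hst
      exact hGinj 0 (t - 1) le_rfl (by linarith) (by linarith) (f.injective hst)
  exact main_curve (fun t => H t) hH (fun t => (H t).injective) h0 f (by simp [hf]) hfix G t s ht2 hs0 hs1'
    (hGcont t) hGf hGinj hst

/-- Brouwer's Lemma: an orientation-preserving homeomorphism of the plane with a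
periodic point has a fixed point. Orientation preservation is expressed by the
(equivalent, for plane homeomorphisms) condition that `f` is isotopic to the
identity through homeomorphisms. -/
theorem stmt_19 (f : (ℝ × ℝ) ≃ₜ (ℝ × ℝ))
    (horient : ∃ H : ℝ → (ℝ × ℝ) ≃ₜ (ℝ × ℝ),
      Continuous (fun p : ℝ × (ℝ × ℝ) => H p.1 p.2) ∧
      H 0 = Homeomorph.refl (ℝ × ℝ) ∧ H 1 = f)
    (hper : ∃ x : ℝ × ℝ, ∃ n : ℕ, 0 < n ∧ (⇑f)^[n] x = x) :
    ∃ z : ℝ × ℝ, f z = z := by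
  obtain ⟨H, hH, hH0, hH1⟩ := horient
  obtain ⟨x, n, hn, hx⟩ := hper
  let e : ℂ ≃ₜ ℝ × ℝ := Complex.equivRealProdCLM.toHomeomorph
  have hconj : Function.Semiconj e ((e.trans f).trans e.symm) f := fun z => by simp
  obtain ⟨z, hz⟩ := brouwer_complex (fun t => (e.trans (H t)).trans e.symm)
    (e.symm.continuous.comp (hH.comp (f := fun p : ℝ × ℂ => (p.1, e p.2)) (by fun_prop)))
    (fun z => by simp [hH0]) ((e.trans f).trans e.symm) (by simp [hH1]) (e.symm x) n hn (by
      apply e.injective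
      rw [hconj.iterate_right n (e.symm x), e.apply_symm_apply, hx])
  refine ⟨e z, ?_⟩
  have := congrArg e hz
  simpa using this
end
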